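/- arXiv:2203.16129 — 4 statements merged into one kernel-verified Lean document; each statement's English description precedes it below -/
import Mathlib

section
/- Let q be a prime power. There exists an antipodal plane of order 3 together with an embedding of it into PG(2,q) if and only if q = 2^h with h even. -/
/-- An antipodal plane of order `s`: a partial linear space with
`s^2 + s + 2` points and lines, every line incident with exactly `s + 1` points and
every point incident with exactly `s + 1` lines. -/
structure IsAntipodalPlane {P L : Type*} (s : ℕ) (R : P → L → Prop) : Prop where
  line_two_le : ∀ l : L, 2 ≤ {x | R x l}.ncard
  partial_linear : ∀ x y : P, x ≠ y → ∀ l m : L, R x l → R y l → R x m → R y m → l = m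
  card_points : Nat.card P = s ^ 2 + s + 2
  card_lines : Nat.card L = s ^ 2 + s + 2
  line_card : ∀ l : L, {x | R x l}.ncard = s + 1
  point_card : ∀ x : P, {l | R x l}.ncard = s + 1

/-- Points of `PG(2,q)`: the 1-dimensional subspaces of `F_q ^ 3`. -/
def PGPoint (F : Type*) [Field F] : Type _ :=
  {W : Submodule F (Fin 3 → F) // Module.finrank F W = 1}

/-- Lines of `PG(2,q)`: the 2-dimensional subspaces of `F_q ^ 3`. -/
def PGLine (F : Type*) [Field F] : Type _ :=
  {W : Submodule F (Fin 3 → F) // Module.finrank F W = 2}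

/-- Incidence in `PG(2,q)`: containment of subspaces. -/
def PGIncidence (F : Type*) [Field F] : PGPoint F → PGLine F → Prop :=
  fun x l => x.1 ≤ l.1

/-- An embedding of the incidence structure `R` into the incidence structure `R'`:
injective maps on points and lines preserving incidence and non-incidence. -/
def HasEmbedding {P L P' L' : Type*} (R : P → L → Prop) (R' : P' → L' → Prop) : Prop :=
  ∃ (φ : P → P') (ψ : L → L'), Function.Injective φ ∧ Function.Injective ψ ∧
    ∀ (x : P) (l : L), R x l ↔ R' (φ x) (ψ l)

namespace AntiThree

/-! ### Combinatorics of antipodal planes of order three -/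

theorem dual {P L : Type} {R : P → L → Prop} (H : IsAntipodalPlane 3 R) :
    IsAntipodalPlane 3 (fun l x => R x l) where
  line_two_le x := by rw [H.point_card x]; norm_num
  partial_linear l m hlm x y h1 h2 h3 h4 := by
    by_contra hxy
    exact hlm (H.partial_linear x y hxy l m h1 h3 h2 h4)
  card_points := H.card_lines
  card_lines := H.card_points
  line_card := H.point_card
  point_card := H.line_card

theorem exists_antipode {P L : Type} {R : P → L → Prop} (H : IsAntipodalPlane 3 R) (x : P) :
    ∃ x' : P, x' ≠ x ∧ (∀ l, R x l → ¬ R x' l) ∧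
      ∀ y, y ≠ x → y ≠ x' → ∃ l, R x l ∧ R y l := by
  classical
  have : Finite P := Nat.finite_of_card_ne_zero (by rw [H.card_points]; norm_num)
  have : Finite L := Nat.finite_of_card_ne_zero (by rw [H.card_lines]; norm_num)
  have := Fintype.ofFinite P
  have := Fintype.ofFinite L
  set Ls : Finset L := Finset.univ.filter (fun l => R x l) with hLs
  have hLc : Ls.card = 4 := by
    have := H.point_card x
    rw [Set.ncard_eq_toFinset_card'] at this
    refine Eq.trans ?_ this; congr 1; ext; simp [hLs]
  let t : L → Finset P := fun l => (Finset.univ.filter (fun y => R y l)).erase x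
  have htc : ∀ l ∈ Ls, (t l).card = 3 := by
    intro l hl
    have h1 := H.line_card l
    rw [Set.ncard_eq_toFinset_card'] at h1
    have h2 : (Finset.univ.filter (fun y => R y l)).card = 4 := by
      refine Eq.trans ?_ h1; congr 1; ext; simp
    have hx : R x l := by simpa [hLs] using hl
    simp only [t]
    rw [Finset.card_erase_of_mem (by simpa using hx), h2]
  have hd : (Ls.biUnion t).card = 12 := by
    rw [Finset.card_biUnion, Finset.sum_congr rfl htc]
    · simp [hLc]
    · intro l hl m hm hlm
      change Disjoint (t l) (t m)
      rw [Finset.disjoint_left]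
      intro y hy hy'
      simp only [hLs, t, Finset.mem_coe, Finset.mem_filter, Finset.mem_univ, true_and,
        Finset.mem_erase] at hl hm hy hy'
      exact hlm (H.partial_linear x y (Ne.symm hy.1) l m hl hy.2 hm hy'.2)
  have hx : x ∉ Ls.biUnion t := by simp [t]
  have h13 : (insert x (Ls.biUnion t)).card = 13 := by
    rw [Finset.card_insert_of_notMem hx, hd]
  have hc : ((insert x (Ls.biUnion t))ᶜ).card = 1 := by
    rw [Finset.card_compl, h13, ← Nat.card_eq_fintype_card, H.card_points]; norm_num
  obtain ⟨x', hx'⟩ := Finset.card_eq_one.1 hc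
  have key : ∀ y, y = x' ↔ (y ≠ x ∧ ∀ l, R x l → ¬ R y l) := by
    intro y
    rw [← Finset.mem_singleton, ← hx']
    simp only [Finset.mem_compl, Finset.mem_insert, Finset.mem_biUnion, hLs, t, Finset.mem_filter,
      Finset.mem_univ, true_and, Finset.mem_erase, not_or, not_exists, not_and]
    constructor
    · rintro ⟨h1, h2⟩
      exact ⟨h1, fun l hl => h2 l hl h1⟩
    · rintro ⟨h1, h2⟩
      exact ⟨h1, fun l hl _ => h2 l hl⟩
  refine ⟨x', ((key x').1 rfl).1, ((key x').1 rfl).2, ?_⟩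
  intro y hy hy'
  by_contra hcon
  push Not at hcon
  exact hy' ((key y).2 ⟨hy, hcon⟩)

/-- The labelled structure of an antipodal plane of order three. -/
theorem labelled {P L : Type} {R : P → L → Prop} (H : IsAntipodalPlane 3 R) :
    ∃ (p p' : P) (u v : Fin 4 → L), p ≠ p' ∧
      (∀ i, R p (u i) ∧ ¬ R p' (u i) ∧ R p' (v i) ∧ ¬ R p (v i)) ∧
      (∀ i j, i ≠ j → u i ≠ u j ∧ v i ≠ v j) ∧
      (∀ i j, i ≠ j → ∃ y, R y (u i) ∧ R y (v j)) ∧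
      (∀ i j k h : Fin 4, i ≠ j → i ≠ k → i ≠ h → j ≠ k → j ≠ h → k ≠ h →
        ∃ m, ¬ R p m ∧ ¬ R p' m ∧ (∃ y, R y m ∧ R y (u i) ∧ R y (v j)) ∧
          (∃ y, R y m ∧ R y (u j) ∧ R y (v k)) ∧ (∃ y, R y m ∧ R y (u k) ∧ R y (v h)) ∧
          (∃ y, R y m ∧ R y (u h) ∧ R y (v i))) := by
  classical
  have hPf : Finite P := Nat.finite_of_card_ne_zero (by rw [H.card_points]; norm_num)
  have hLf : Finite L := Nat.finite_of_card_ne_zero (by rw [H.card_lines]; norm_num)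
  have hne : Nonempty P := by
    by_contra h
    rw [not_nonempty_iff] at h
    have := H.card_points
    rw [Nat.card_of_isEmpty] at this
    norm_num at this
  choose a ha1 ha2 ha3 using exists_antipode H
  choose b hb1 hb2 hb3 using exists_antipode (dual H)
  have haa : ∀ x, a (a x) = x := by
    intro x
    by_contra hx
    obtain ⟨l, h1, h2⟩ := ha3 (a x) x (Ne.symm (ha1 x)) (Ne.symm hx)
    exact ha2 x l h2 h1
  have hbb : ∀ x, b (b x) = x := by
    intro x
    by_contra hx
    obtain ⟨l, h1, h2⟩ := hb3 (b x) x (Ne.symm (hb1 x)) (Ne.symm hx)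
    exact hb2 x l h2 h1
  -- antipodal point lies on antipodal line
  have hab : ∀ x l, R x l → R (a x) (b l) := by
    intro x l hxl
    by_contra hcon
    have hf : ∀ m, R (a x) m → ∃ y, R y l ∧ R y m := by
      intro m hm
      refine hb3 l m ?_ ?_
      · rintro rfl; exact ha2 x _ hxl hm
      · rintro rfl; exact hcon hm
    choose! f hf1 hf2 using hf
    have h1 : ({m | R (a x) m}).ncard ≤ ({y | R y l} \ {x}).ncard := by
      refine Set.ncard_le_ncard_of_injOn f ?_ ?_ (Set.toFinite _)
      · intro m hm
        refine ⟨hf1 m hm, ?_⟩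
        intro h
        have h' : f m = x := h
        have := hf2 m hm
        rw [h'] at this
        exact ha2 x m this hm
      · intro m hm n hn hmn
        have hy : a x ≠ f m := by
          intro h
          have := hf1 m hm
          rw [← h] at this
          exact ha2 x l hxl this
        exact H.partial_linear _ _ hy m n hm (hf2 m hm) hn (hmn ▸ hf2 n hn)
    rw [H.point_card, Set.ncard_sdiff_singleton_of_mem (by exact hxl), H.line_card] at h1
    norm_num at h1
  obtain ⟨p⟩ := hne
  have hu : ∃ u : Fin 4 → L, Function.Injective u ∧ ∀ l, R p l ↔ ∃ i, u i = l := by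
    have h4 : Nat.card {l | R p l} = 4 := H.point_card p
    let e : Fin 4 ≃ {l | R p l} := (Finite.equivFinOfCardEq h4).symm
    refine ⟨fun i => (e i).1, fun i j hij => e.injective (Subtype.ext hij), fun l => ?_⟩
    constructor
    · intro hl
      exact ⟨e.symm ⟨l, hl⟩, by simp⟩
    · rintro ⟨i, rfl⟩
      exact (e i).2
  obtain ⟨u, hui, hu⟩ := hu
  have hpu : ∀ i, R p (u i) := fun i => (hu _).2 ⟨i, rfl⟩
  have hpv : ∀ i, R (a p) (b (u i)) := fun i => hab _ _ (hpu i)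
  have hpu' : ∀ i, ¬ R (a p) (u i) := fun i => ha2 p _ (hpu i)
  have hpv' : ∀ i, ¬ R p (b (u i)) := fun i h => ha2 p _ h (hpv i)
  have hv : ∀ l, R (a p) l → ∃ i, b (u i) = l := by
    intro l hl
    have := hab _ _ hl
    rw [haa] at this
    obtain ⟨i, hi⟩ := (hu _).1 this
    exact ⟨i, by rw [hi, hbb]⟩
  have hbi : ∀ i j, i ≠ j → b (u i) ≠ b (u j) := by
    intro i j hij h
    apply hij; apply hui
    rw [← hbb (u i), h, hbb]
  have hint : ∀ i j, i ≠ j → ∃ y, R y (u i) ∧ R y (b (u j)) := by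
    intro i j hij
    refine hb3 (u i) (b (u j)) ?_ (hbi j i (Ne.symm hij))
    intro h
    exact hpv' j (h ▸ hpu i)
  have huu : ∀ i j y, i ≠ j → R y (u i) → R y (u j) → y = p := by
    intro i j y hij h1 h2
    by_contra hy
    exact hij (hui (H.partial_linear _ _ hy _ _ h1 (hpu i) h2 (hpu j)))
  have hvv : ∀ i j y, i ≠ j → R y (b (u i)) → R y (b (u j)) → y = a p := by
    intro i j y hij h1 h2
    by_contra hy
    exact hbi i j hij (H.partial_linear _ _ hy _ _ h1 (hpv i) h2 (hpv j))
  have hvne : ∀ i y, R y (b (u i)) → y ≠ p := by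
    rintro i y h rfl; exact hpv' i h
  have hune : ∀ i y, R y (u i) → y ≠ a p := by
    rintro i y h rfl; exact hpu' i h
  refine ⟨p, a p, u, fun i => b (u i), Ne.symm (ha1 p),
    fun i => ⟨hpu i, hpu' i, hpv i, hpv' i⟩, fun i j hij => ⟨fun h => hij (hui h), hbi i j hij⟩,
    hint, ?_⟩
  intro i j k h hij hik hih hjk hjh hkh
  obtain ⟨y, hy1, hy2⟩ := hint i j hij
  obtain ⟨z, hz1, hz2⟩ := hint j k hjk
  have hzy : z ≠ y := by
    rintro rfl
    exact hvne _ _ hy2 (huu i j _ hij hy1 hz1)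
  have hzay : z ≠ a y := by
    rintro rfl
    exact hune _ _ hz1 (hvv i k _ hik (hab _ _ hy1) hz2)
  obtain ⟨m, hym, hzm⟩ := ha3 y z hzy hzay
  have hpm : ¬ R p m := by
    intro hp
    have e1 := H.partial_linear _ _ (hvne _ _ hy2) _ _ hym hp hy1 (hpu i)
    have e2 := H.partial_linear _ _ (hvne _ _ hz2) _ _ hzm hp hz1 (hpu j)
    exact hij (hui (e1 ▸ e2))
  have hpm' : ¬ R (a p) m := by
    intro hp
    have e1 := H.partial_linear _ _ (hune _ _ hy1) _ _ hym hp hy2 (hpv j)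
    have e2 := H.partial_linear _ _ (hune _ _ hz1) _ _ hzm hp hz2 (hpv k)
    exact hbi j k hjk (e1 ▸ e2)
  -- every group is met by m
  have hmeet : ∀ g, ∃ w n, R w m ∧ R w (u g) ∧ R w (b (u n)) ∧ n ≠ g := by
    intro g
    obtain ⟨w, hw1, hw2⟩ := hb3 (u g) m (by rintro rfl; exact hpm (hpu g))
      (by rintro rfl; exact hpm' (hpv g))
    have hw3 : w ≠ a p := by rintro rfl; exact hpm' hw2
    have hw4 : w ≠ a (a p) := by rw [haa]; rintro rfl; exact hpm hw2
    obtain ⟨l, hl1, hl2⟩ := ha3 (a p) w hw3 hw4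
    obtain ⟨n, rfl⟩ := hv l hl1
    refine ⟨w, n, hw2, hw1, hl2, ?_⟩
    rintro rfl
    exact hb2 (u n) w hw1 hl2
  -- distinct groups give distinct labels
  have hlab : ∀ g g' n n' w w', g ≠ g' → R w m → R w (u g) → R w (b (u n)) → R w' m →
      R w' (u g') → R w' (b (u n')) → n ≠ n' := by
    intro g g' n n' w w' hg h1 h2 h3 h4 h5 h6 hn
    subst hn
    have hww : w ≠ w' := by
      rintro rfl
      exact hvne _ _ h3 (huu g g' _ hg h2 h5)
    have := H.partial_linear _ _ hww _ _ h1 h4 h3 h6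
    exact hpm' (this ▸ hpv n)
  obtain ⟨w, n, hw1, hw2, hw3, hn⟩ := hmeet h
  have n1 := hlab h i n j w y (Ne.symm hih) hw1 hw2 hw3 hym hy1 hy2
  have n2 := hlab h j n k w z (Ne.symm hjh) hw1 hw2 hw3 hzm hz1 hz2
  have hni : n = i := by clear * - hij hik hih hjk hjh hkh hn n1 n2; omega
  subst hni
  obtain ⟨w', n', hw1', hw2', hw3', hn'⟩ := hmeet k
  have n1' := hlab k n n' j w' y (Ne.symm hik) hw1' hw2' hw3' hym hy1 hy2
  have n3' := hlab k h n' n w' w hkh hw1' hw2' hw3' hw1 hw2 hw3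
  have hni' : n' = h := by clear * - hij hik hih hjk hjh hkh hn' n1' n3'; omega
  subst hni'
  exact ⟨m, hpm, hpm', ⟨y, hym, hy1, hy2⟩, ⟨z, hzm, hz1, hz2⟩, ⟨w', hw1', hw2', hw3'⟩,
    ⟨w, hw1, hw2, hw3⟩⟩

/-! ### Coordinates -/

theorem coords {P L F : Type} [Field F] {R : P → L → Prop}
    (h : HasEmbedding R (PGIncidence F)) (p p' : P) (hp : p ≠ p') :
    ∃ (X Y Z : P → F) (A B C : L → F),
      (∀ x l, R x l ↔ A l * X x + B l * Y x + C l * Z x = 0) ∧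
      (∀ x, ¬ (X x = 0 ∧ Y x = 0 ∧ Z x = 0)) ∧
      (∀ l, R p l ↔ A l = 0) ∧ (∀ l, R p' l ↔ B l = 0) := by
  obtain ⟨φ, ψ, hφ, hψ, hR⟩ := h
  have hvec : ∀ x, ∃ v : Fin 3 → F, v ≠ 0 ∧ (φ x).1 = Submodule.span F {v} := by
    intro x
    obtain ⟨v, hv, hs⟩ := finrank_eq_one_iff'.1 (φ x).2
    refine ⟨v.1, fun h => hv (Subtype.ext h), le_antisymm ?_ ?_⟩
    · intro w hw
      obtain ⟨c, hc⟩ := hs ⟨w, hw⟩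
      rw [Submodule.mem_span_singleton]
      exact ⟨c, congrArg Subtype.val hc⟩
    · rw [Submodule.span_singleton_le_iff_mem]
      exact v.2
  choose v hv0 hv using hvec
  have hfun : ∀ l, ∃ f : (Fin 3 → F) →ₗ[F] F, (ψ l).1 = LinearMap.ker f := by
    intro l
    have hlt : (ψ l).1 < ⊤ := by
      rw [lt_top_iff_ne_top]
      intro h
      have := (ψ l).2
      rw [h] at this
      simp at this
    obtain ⟨f, hf0, hf⟩ := Submodule.exists_le_ker_of_lt_top _ hlt
    refine ⟨f, Submodule.eq_of_le_of_finrank_eq hf ?_⟩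
    have h1 := LinearMap.finrank_range_add_finrank_ker f
    rw [LinearMap.range_eq_top.2 (LinearMap.surjective hf0)] at h1
    simp at h1
    rw [(ψ l).2]; omega
  choose f hf using hfun
  have hR' : ∀ x l, R x l ↔ f l (v x) = 0 := by
    intro x l
    rw [hR, PGIncidence, hv, hf, Submodule.span_singleton_le_iff_mem, LinearMap.mem_ker]
  have hli : LinearIndependent F ![v p, v p'] := by
    rw [LinearIndependent.pair_iff' (hv0 p)]
    intro c hc
    apply hp; apply hφ; apply Subtype.ext
    have hc0 : c ≠ 0 := by
      rintro rfl
      exact hv0 p' (by rw [← hc, zero_smul])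
    rw [hv, hv, ← hc]
    exact (Submodule.span_singleton_smul_eq (IsUnit.mk0 c hc0) _).symm
  obtain ⟨w, hw⟩ : ∃ w, w ∉ Submodule.span F (Set.range ![v p, v p']) := by
    by_contra hcon
    push Not at hcon
    have ht : Submodule.span F (Set.range ![v p, v p']) = ⊤ := eq_top_iff.2 fun x _ => hcon x
    have := finrank_span_eq_card hli
    rw [ht] at this
    simp at this
  have hli3 : LinearIndependent F ![w, v p, v p'] := by
    exact linearIndependent_finCons.2 ⟨hli, hw⟩
  let e := basisOfLinearIndependentOfCardEqFinrank hli3 (by simp)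
  have he0 : e 0 = w := by simp [e]
  have he1 : e 1 = v p := by simp [e]
  have he2 : e 2 = v p' := by simp [e]
  refine ⟨fun x => e.repr (v x) 1, fun x => e.repr (v x) 2, fun x => e.repr (v x) 0,
    fun l => f l (v p), fun l => f l (v p'), fun l => f l w, ?_, ?_, fun l => hR' p l,
    fun l => hR' p' l⟩
  · intro x l
    rw [hR']
    have hs := e.sum_repr (v x)
    rw [Fin.sum_univ_three, he0, he1, he2] at hs
    have : f l (v x) = f l (v p) * e.repr (v x) 1 + f l (v p') * e.repr (v x) 2
        + f l w * e.repr (v x) 0 := by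
      conv_lhs => rw [← hs]
      simp only [map_add, map_smul, smul_eq_mul]
      ring
    rw [this]
  · rintro x ⟨h1, h2, h3⟩
    apply hv0 x
    have hs := e.sum_repr (v x)
    simp only at h1 h2 h3
    rw [Fin.sum_univ_three, h1, h2, h3] at hs
    simpa using hs.symm

/-- Algebraic core. -/
theorem algebra {F : Type} [Field F] (a b : Fin 4 → F)
    (ha : ∀ i j, i ≠ j → a i ≠ a j) (hb : ∀ i j, i ≠ j → b i ≠ b j)
    (hc : ∀ i j k h : Fin 4, i ≠ j → i ≠ k → i ≠ h → j ≠ k → j ≠ h → k ≠ h →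
      ∃ s t : F, a j = s * b i + t ∧ a k = s * b j + t ∧ a h = s * b k + t ∧ a i = s * b h + t) :
    (2 : F) = 0 ∧ ∃ w : F, w ^ 3 = 1 ∧ w ≠ 1 := by
  have key : ∀ i j k h : Fin 4, i ≠ j → i ≠ k → i ≠ h → j ≠ k → j ≠ h → k ≠ h →
      a i + a k = a j + a h := by
    intro i j k h h1 h2 h3 h4 h5 h6
    obtain ⟨s, t, e1, e2, e3, e4⟩ := hc i j k h h1 h2 h3 h4 h5 h6
    obtain ⟨s', t', f1, f2, f3, f4⟩ := hc h k j i h6.symm h5.symm h3.symm h4.symm h2.symm h1.symm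
    have hs : s + s' = 0 := by
      have : (s + s') * (b i - b k) = 0 := by linear_combination f2 - f4 + e3 - e1
      exact (mul_eq_zero.1 this).resolve_right (sub_ne_zero.2 (hb i k h2))
    linear_combination e2 - e1 + f3 - f4 + (b j - b i) * hs
  have k1 := key 0 1 2 3 (by decide) (by decide) (by decide) (by decide) (by decide) (by decide)
  have k2 := key 0 1 3 2 (by decide) (by decide) (by decide) (by decide) (by decide) (by decide)
  refine ⟨?_, ?_⟩
  · have : (2 : F) * (a 2 - a 3) = 0 := by linear_combination k1 - k2
    exact (mul_eq_zero.1 this).resolve_right (sub_ne_zero.2 (ha 2 3 (by decide)))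
  · obtain ⟨s, t, e1, e2, e3, e4⟩ := hc 0 1 2 3 (by decide) (by decide) (by decide) (by decide)
      (by decide) (by decide)
    obtain ⟨s', t', f1, f2, f3, f4⟩ := hc 0 2 1 3 (by decide) (by decide) (by decide) (by decide)
      (by decide) (by decide)
    have h10 : a 1 - a 0 ≠ 0 := sub_ne_zero.2 (ha 1 0 (by decide))
    have hs : s ≠ 0 := by
      rintro rfl
      exact h10 (by linear_combination e1 - e4)
    have hw : s' / s * s = s' := div_mul_cancel₀ _ hs
    generalize s' / s = w at hw
    subst hw
    have g1 : a 2 - a 0 = w * (a 1 - a 0) := by linear_combination f1 - f4 - w * (e1 - e4)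
    have g2 : a 3 - a 0 = w * (a 2 - a 0) := by linear_combination f3 - f4 - w * (e2 - e4)
    have g3 : a 1 - a 0 = w * (a 3 - a 0) := by linear_combination f2 - f4 - w * (e3 - e4)
    refine ⟨w, ?_, ?_⟩
    · have : (w ^ 3 - 1) * (a 1 - a 0) = 0 := by
        linear_combination -w ^ 2 * g1 - w * g2 - g3
      exact sub_eq_zero.1 ((mul_eq_zero.1 this).resolve_right h10)
    · rintro rfl
      exact ha 2 1 (by decide) (by linear_combination g1)

theorem forward {P L F : Type} [Field F] {R : P → L → Prop} (H : IsAntipodalPlane 3 R)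
    (h : HasEmbedding R (PGIncidence F)) : (2 : F) = 0 ∧ ∃ w : F, w ^ 3 = 1 ∧ w ≠ 1 := by
  obtain ⟨p, p', u, v, hpp, hinc, hne, hint, hcyc⟩ := labelled H
  obtain ⟨X, Y, Z, A, B, C, hR, h0, hA, hB⟩ := coords h p p' hpp
  have hAu : ∀ i, A (u i) = 0 := fun i => (hA _).1 (hinc i).1
  have hBu : ∀ i, B (u i) ≠ 0 := fun i hh => (hinc i).2.1 ((hB _).2 hh)
  have hBv : ∀ i, B (v i) = 0 := fun i => (hB _).1 (hinc i).2.2.1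
  have hAv : ∀ i, A (v i) ≠ 0 := fun i hh => (hinc i).2.2.2 ((hA _).2 hh)
  let a : Fin 4 → F := fun j => - C (v j) / A (v j)
  let b : Fin 4 → F := fun i => - C (u i) / B (u i)
  have hu : ∀ x i, R x (u i) ↔ Y x = b i * Z x := by
    intro x i
    have := hBu i
    rw [hR, hAu]
    simp only [b]
    field_simp
    constructor <;> intro hh <;> linear_combination hh
  have hv : ∀ x i, R x (v i) ↔ X x = a i * Z x := by
    intro x i
    have := hAv i
    rw [hR, hBv]
    simp only [a]
    field_simp
    constructor <;> intro hh <;> linear_combination hh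
  have hex : ∀ i : Fin 4, ∃ j, j ≠ i := by decide
  apply algebra a b
  · intro i j hij hab
    obtain ⟨k, hk⟩ := hex i
    obtain ⟨y, hy1, hy2⟩ := hint k i hk
    have hy3 : R y (v j) := by rw [hv, ← hab, ← hv]; exact hy2
    have hyp : y ≠ p' := by rintro rfl; exact (hinc k).2.1 hy1
    exact (hne i j hij).2 (H.partial_linear _ _ hyp _ _ hy2 (hinc i).2.2.1 hy3 (hinc j).2.2.1)
  · intro i j hij hab
    obtain ⟨k, hk⟩ := hex i
    obtain ⟨y, hy1, hy2⟩ := hint i k hk.symm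
    have hy3 : R y (u j) := by rw [hu, ← hab, ← hu]; exact hy1
    have hyp : y ≠ p := by rintro rfl; exact (hinc k).2.2.2 hy2
    exact (hne i j hij).1 (H.partial_linear _ _ hyp _ _ hy1 (hinc i).1 hy3 (hinc j).1)
  · intro i j k h h1 h2 h3 h4 h5 h6
    obtain ⟨m, hm1, hm2, c1, c2, c3, c4⟩ := hcyc i j k h h1 h2 h3 h4 h5 h6
    have hAm : A m ≠ 0 := fun hh => hm1 ((hA _).2 hh)
    have conv : ∀ i j, (∃ y, R y m ∧ R y (u i) ∧ R y (v j)) →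
        a j = (- B m / A m) * b i + (- C m / A m) := by
      rintro i j ⟨y, r1, r2, r3⟩
      rw [hu] at r2
      rw [hv] at r3
      rw [hR] at r1
      have hz : Z y ≠ 0 := by
        intro hz
        exact h0 y ⟨by rw [r3, hz, mul_zero], by rw [r2, hz, mul_zero], hz⟩
      have : Z y * (A m * a j + B m * b i + C m) = 0 := by
        rw [r2, r3] at r1
        linear_combination r1
      have h' := (mul_eq_zero.1 this).resolve_left hz
      have h'' : a j = - (B m * b i + C m) / A m := by
        rw [eq_div_iff hAm]; linear_combination h'
      rw [h'']; ring
    exact ⟨_, _, conv _ _ c1, conv _ _ c2, conv _ _ c3, conv _ _ c4⟩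

/-! ### The construction: PG(2,4) minus a Baer subplane -/

def addT (a b : Fin 4) : Fin 4 :=
  (![![0, 1, 2, 3], ![1, 0, 3, 2], ![2, 3, 0, 1], ![3, 2, 1, 0]] : Fin 4 → Fin 4 → Fin 4) a b

def mulT (a b : Fin 4) : Fin 4 :=
  (![![0, 0, 0, 0], ![0, 1, 2, 3], ![0, 2, 3, 1], ![0, 3, 1, 2]] : Fin 4 → Fin 4 → Fin 4) a b

def V : Fin 14 → Fin 3 → Fin 4 :=
  ![![0, 1, 2], ![0, 1, 3], ![1, 0, 2], ![1, 0, 3], ![1, 1, 2], ![1, 1, 3],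
    ![1, 2, 0], ![1, 2, 1], ![1, 2, 2], ![1, 2, 3], ![1, 3, 0], ![1, 3, 1], ![1, 3, 2], ![1, 3, 3]]

def dotT (x l : Fin 14) : Fin 4 :=
  addT (addT (mulT (V l 0) (V x 0)) (mulT (V l 1) (V x 1))) (mulT (V l 2) (V x 2))

def BR (x l : Fin 14) : Prop := dotT x l = 0

instance : DecidableRel BR := fun x l => inferInstanceAs (Decidable (dotT x l = 0))

theorem BR_card (l : Fin 14) : {x | BR x l}.ncard = 4 := by
  rw [Set.ncard_eq_toFinset_card']
  revert l
  decide +kernel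

theorem BR_card' (l : Fin 14) : {x | BR l x}.ncard = 4 := by
  rw [Set.ncard_eq_toFinset_card']
  revert l
  decide +kernel

theorem BR_plane : IsAntipodalPlane 3 BR where
  line_two_le l := by rw [BR_card]; norm_num
  partial_linear := by decide +kernel
  card_points := by simp
  card_lines := by simp
  line_card := BR_card
  point_card := BR_card'

theorem BR_sep : ∀ x y : Fin 14, (∀ l, BR x l ↔ BR y l) → x = y := by decide +kernel

theorem BR_sep' : ∀ x y : Fin 14, (∀ l, BR l x ↔ BR l y) → x = y := by decide +kernel

theorem V_ne : ∀ x, V x 0 = 1 ∨ V x 1 = 1 := by decide +kernel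

theorem backward {F : Type} [Field F] (h2 : (2 : F) = 0) (w : F) (hw : w ^ 2 + w + 1 = 0) :
    HasEmbedding BR (PGIncidence F) := by
  let ev : Fin 4 → F := ![0, 1, w, w + 1]
  have hw0 : w ≠ 0 := by rintro rfl; simp at hw
  have hw1 : w + 1 ≠ 0 := by
    intro h
    have : (1 : F) = 0 := by linear_combination hw - w * h
    exact one_ne_zero this
  have e0 : ∀ i, ev i = 0 ↔ i = 0 := by
    intro i
    fin_cases i <;> simp [ev, hw0, hw1]
  have eadd : ∀ i j, ev (addT i j) = ev i + ev j := by
    intro i j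
    fin_cases i <;> fin_cases j <;> simp [ev, addT]
    all_goals grind
  have emul : ∀ i j, ev (mulT i j) = ev i * ev j := by
    intro i j
    fin_cases i <;> fin_cases j <;> simp [ev, mulT]
    all_goals grind
  let vec : Fin 14 → Fin 3 → F := fun x i => ev (V x i)
  have hvec : ∀ x, vec x ≠ 0 := by
    intro x hx
    rcases V_ne x with h | h
    · have := congrFun hx 0
      simp [vec, h, ev] at this
    · have := congrFun hx 1
      simp [vec, h, ev] at this
  let f : Fin 14 → (Fin 3 → F) →ₗ[F] F := fun l => Fintype.linearCombination F (vec l)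
  have hf : ∀ l x, f l (vec x) = ev (dotT x l) := by
    intro l x
    simp only [f, Fintype.linearCombination_apply, Fin.sum_univ_three, dotT, eadd, emul, vec,
      smul_eq_mul]
    ring
  have hf0 : ∀ l, f l ≠ 0 := by
    intro l hl
    apply hvec l
    funext i
    have := congrArg (fun g => g (Pi.single i 1)) hl
    simpa [f] using this
  let φ : Fin 14 → PGPoint F := fun x => ⟨Submodule.span F {vec x}, finrank_span_singleton (hvec x)⟩
  let ψ : Fin 14 → PGLine F := fun l => ⟨LinearMap.ker (f l), by
    have h1 := LinearMap.finrank_range_add_finrank_ker (f l)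
    rw [LinearMap.range_eq_top.2 (LinearMap.surjective (hf0 l))] at h1
    simp at h1
    omega⟩
  have hR : ∀ x l, BR x l ↔ PGIncidence F (φ x) (ψ l) := by
    intro x l
    simp only [PGIncidence, φ, ψ]
    rw [Submodule.span_singleton_le_iff_mem, LinearMap.mem_ker, hf, e0]
    rfl
  refine ⟨φ, ψ, ?_, ?_, hR⟩
  · intro x y hxy
    exact BR_sep x y fun l => by rw [hR, hR, hxy]
  · intro x y hxy
    exact BR_sep' x y fun l => by rw [hR, hR, hxy]

theorem three_dvd (n : ℕ) : 3 ∣ 2 ^ n - 1 ↔ Even n := by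
  rcases Nat.even_or_odd' n with ⟨k, rfl | rfl⟩
  · have h : 2 ^ (2 * k) % 3 = 1 := by
      rw [pow_mul, Nat.pow_mod]; simp
    have : 0 < 2 ^ (2 * k) := by positivity
    simp only [even_two, Even.mul_right, iff_true]
    omega
  · have h : 2 ^ (2 * k) % 3 = 1 := by
      rw [pow_mul, Nat.pow_mod]; simp
    have h' : 2 ^ (2 * k + 1) = 2 * 2 ^ (2 * k) := by ring
    have ho : ¬ Even (2 * k + 1) := by simp
    simp only [ho, iff_false]
    omega

end AntiThree

/-- An antipodal plane of order `3` embeds in `PG(2,q)` iff `q = 2 ^ h` with `h` even. -/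
theorem antipodal_order_three_embeds_iff (q : ℕ) (F : Type) [Field F] [Fintype F]
    (hF : Fintype.card F = q) :
    (∃ (P L : Type) (R : P → L → Prop),
        IsAntipodalPlane 3 R ∧ HasEmbedding R (PGIncidence F)) ↔
      ∃ h : ℕ, Even h ∧ q = 2 ^ h := by
  classical
  have hcu : Fintype.card Fˣ = q - 1 := by rw [Fintype.card_units, hF]
  constructor
  · rintro ⟨P, L, R, H, hE⟩
    obtain ⟨h2, w, hw, hw1⟩ := AntiThree.forward H hE
    have : CharP F 2 := CharTwo.of_one_ne_zero_of_two_eq_zero one_ne_zero h2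
    obtain ⟨n, -, hn⟩ := FiniteField.card F 2
    have hq : q = 2 ^ (n : ℕ) := by rw [← hF, hn]
    refine ⟨n, ?_, hq⟩
    rw [← AntiThree.three_dvd, ← hq, ← hcu]
    have hu : orderOf (Units.ofPowEqOne w 3 hw (by norm_num)) = 3 := by
      apply orderOf_eq_prime
      · ext; simp [hw]
      · intro h
        exact hw1 (by simpa using congrArg Units.val h)
    rw [← hu]
    exact orderOf_dvd_card
  · rintro ⟨h, he, hq⟩
    have h2 : (2 : F) = 0 := by
      have := Nat.cast_card_eq_zero F
      rw [hF, hq] at this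
      push_cast at this
      exact eq_zero_of_pow_eq_zero this
    have h3 : 3 ∣ Fintype.card Fˣ := by
      rw [hcu, hq]; exact (AntiThree.three_dvd h).2 he
    have : Fact (Nat.Prime 3) := ⟨Nat.prime_three⟩
    obtain ⟨u, hu⟩ := exists_prime_orderOf_dvd_card 3 h3
    have hu3 : (u : F) ^ 3 = 1 := by
      have := pow_orderOf_eq_one u
      rw [hu] at this
      simpa using congrArg Units.val this
    have hu1 : (u : F) - 1 ≠ 0 := by
      intro hh
      have : u = 1 := by ext; simpa using sub_eq_zero.1 hh
      rw [this, orderOf_one] at hu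
      norm_num at hu
    have hw : (u : F) ^ 2 + u + 1 = 0 := by
      have : ((u : F) - 1) * ((u : F) ^ 2 + u + 1) = 0 := by linear_combination hu3
      exact (mul_eq_zero.1 this).resolve_left hu1
    exact ⟨_, _, _, AntiThree.BR_plane, AntiThree.backward h2 u hw⟩
end

section
/- Let s ≥ 4 be an integer and q a prime power. No antipodal plane of order s admits an embedding into the Desarguesian projective plane PG(2,q). -/
theorem AP_trans {I : Type} [Fintype I] [DecidableEq I] (s : ℕ) (hs : 4 ≤ s)
    (hI : Fintype.card I = s + 1) (Φ D : Finset (Equiv.Perm I))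
    (h1 : ∀ σ ∈ Φ, ∀ τ ∈ Φ, ∀ i j, i ≠ j → σ i = τ i → σ j = τ j → σ = τ)
    (h2 : ∀ σ ∈ Φ, ∀ τ ∈ Φ, ∀ ρ ∈ Φ, σ * τ⁻¹ * ρ ∈ Φ)
    (hD : D ⊆ Φ) (hDc : s * (s - 1) ≤ D.card)
    (i j k l : I) (hij : i ≠ j) (hkl : k ≠ l) : ∃ σ ∈ Φ, σ i = k ∧ σ j = l := by
  have hoff : (Finset.univ : Finset I).offDiag.card = s * (s + 1) := by
    rw [Finset.offDiag_card, Finset.card_univ, hI]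
    have : (s+1)*(s+1) = s*(s+1) + (s+1) := by ring
    omega
  have hΦ : s * (s - 1) ≤ Φ.card := hDc.trans (Finset.card_le_card hD)
  have hbig : s * (s + 1) < 2 * Φ.card := by
    obtain ⟨t, rfl⟩ : ∃ t, s = t + 4 := ⟨s - 4, by omega⟩
    have : t + 4 - 1 = t + 3 := by omega
    rw [this] at hΦ
    nlinarith
  obtain ⟨ψ, hψ⟩ : Φ.Nonempty := by
    rw [← Finset.card_pos]; omega
  let f : Equiv.Perm I → I × I := fun σ => (σ i, σ j)
  let g : Equiv.Perm I → I × I := fun σ => (ψ (σ⁻¹ k), ψ (σ⁻¹ l))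
  have hf : (Φ.image f).card = Φ.card := by
    apply Finset.card_image_of_injOn
    intro σ hσ τ hτ h
    simp only [f, Prod.mk.injEq] at h
    exact h1 σ hσ τ hτ i j hij h.1 h.2
  have hg : (Φ.image g).card = Φ.card := by
    apply Finset.card_image_of_injOn
    intro σ hσ τ hτ h
    simp only [g, Prod.mk.injEq, EmbeddingLike.apply_eq_iff_eq] at h
    apply h1 σ hσ τ hτ (σ⁻¹ k) (σ⁻¹ l) (by simpa using hkl)
    · conv_rhs => rw [h.1]
      simp
    · conv_rhs => rw [h.2]
      simp
  have hu : (Φ.image f ∪ Φ.image g).card ≤ s * (s + 1) := by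
    rw [← hoff]
    apply Finset.card_le_card
    intro p hp
    simp only [Finset.mem_union, Finset.mem_image] at hp
    rcases hp with ⟨σ, -, rfl⟩ | ⟨σ, -, rfl⟩
    · simp [f, hij]
    · simp [g, hkl]
  have hint : (Φ.image f ∩ Φ.image g).Nonempty := by
    rw [← Finset.card_pos]
    have := Finset.card_union_add_card_inter (Φ.image f) (Φ.image g)
    omega
  obtain ⟨p, hp⟩ := hint
  simp only [Finset.mem_inter, Finset.mem_image] at hp
  obtain ⟨⟨σ, hσ, rfl⟩, τ, hτ, h⟩ := hp
  simp only [f, g, Prod.mk.injEq] at h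
  refine ⟨τ * ψ⁻¹ * σ, h2 _ hτ _ hψ _ hσ, ?_, ?_⟩
  · simp [← h.1]
  · simp [← h.2]

theorem AP_comb {I : Type} [Fintype I] [DecidableEq I] (s : ℕ) (hs : 4 ≤ s)
    (hI : Fintype.card I = s + 1) (Φ D : Finset (Equiv.Perm I))
    (h1 : ∀ σ ∈ Φ, ∀ τ ∈ Φ, ∀ i j, i ≠ j → σ i = τ i → σ j = τ j → σ = τ)
    (h2 : ∀ σ ∈ Φ, ∀ τ ∈ Φ, ∀ ρ ∈ Φ, σ * τ⁻¹ * ρ ∈ Φ)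
    (hD : D ⊆ Φ) (hDc : s * (s - 1) ≤ D.card)
    (hder : ∀ σ ∈ D, ∀ i, σ i ≠ i) : False := by
  have key := AP_trans s hs hI Φ D h1 h2 hD hDc
  have hoff : (Finset.univ : Finset I).offDiag.card = s * (s + 1) := by
    rw [Finset.offDiag_card, Finset.card_univ, hI]
    have : (s+1)*(s+1) = s*(s+1) + (s+1) := by ring
    omega
  have hnt : Nontrivial I := by
    rw [← Fintype.one_lt_card_iff_nontrivial]; omega
  have hΦle : Φ.card ≤ s * (s + 1) := by
    obtain ⟨i, j, hij⟩ := exists_pair_ne I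
    rw [← hoff]
    apply Finset.card_le_card_of_injOn (fun σ => (σ i, σ j))
    · intro σ _
      simp [hij]
    · intro σ hσ τ hτ h
      simp only [Prod.mk.injEq] at h
      exact h1 σ hσ τ hτ i j hij h.1 h.2
  -- fixed points
  let n : Equiv.Perm I → Finset I := fun σ => Finset.univ.filter (fun i => σ i = i)
  have hsum1 : s * (s + 1) ≤ ∑ σ ∈ Φ, (n σ).card := by
    have : ∑ σ ∈ Φ, (n σ).card = ∑ i : I, (Φ.filter (fun σ => σ i = i)).card := by
      simp only [n, Finset.card_filter]
      exact Finset.sum_comm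
    rw [this]
    have hc : ∀ i : I, s ≤ (Φ.filter (fun σ => σ i = i)).card := by
      intro i
      obtain ⟨j, hj⟩ := exists_ne i
      have : (Finset.univ.erase i).card = s := by
        rw [Finset.card_erase_of_mem (Finset.mem_univ _), Finset.card_univ, hI]; rfl
      rw [← this]
      apply Finset.card_le_card_of_surjOn (fun σ => σ j)
      intro k hk
      have hk : k ≠ i := by simpa using hk
      obtain ⟨σ, hσ, e1, e2⟩ := key i j i k hj.symm hk.symm
      exact ⟨σ, by simp [hσ, e1], e2⟩
    calc s * (s + 1) = ∑ i : I, s := by simp [hI]; ring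
      _ ≤ _ := Finset.sum_le_sum (fun i _ => hc i)
  have hsum2 : ∑ σ ∈ Φ, (n σ).offDiag.card ≤ s * (s + 1) := by
    have : ∑ σ ∈ Φ, (n σ).offDiag.card
        = ∑ p ∈ (Finset.univ : Finset I).offDiag,
          (Φ.filter (fun σ => σ p.1 = p.1 ∧ σ p.2 = p.2)).card := by
      have e : ∀ σ, (n σ).offDiag = (Finset.univ : Finset I).offDiag.filter
          (fun p => σ p.1 = p.1 ∧ σ p.2 = p.2) := by
        intro σ
        ext p
        simp [n, Finset.mem_offDiag]
        tauto
      simp only [e, Finset.card_filter]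
      exact Finset.sum_comm
    rw [this, ← hoff, Finset.card_eq_sum_ones]
    apply Finset.sum_le_sum
    intro p hp
    rw [Finset.mem_offDiag] at hp
    rw [Finset.card_le_one]
    intro σ hσ τ hτ
    simp only [Finset.mem_filter] at hσ hτ
    exact h1 σ hσ.1 τ hτ.1 p.1 p.2 hp.2.2 (by rw [hσ.2.1, hτ.2.1]) (by rw [hσ.2.2, hτ.2.2])
  have hpt : ∀ σ ∈ Φ, 4 * (n σ).card ≤ (n σ).offDiag.card + if σ ∈ D then 0 else 6 := by
    intro σ _
    split_ifs with h
    · have : n σ = ∅ := by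
        simp only [n, Finset.filter_eq_empty_iff]
        intro i _
        exact hder σ h i
      simp [this]
    · rw [Finset.offDiag_card]
      generalize (n σ).card = m
      have : 5 * m ≤ m * m + 6 := by
        rcases le_or_gt m 2 with h | h
        · interval_cases m <;> simp
        · obtain ⟨t, rfl⟩ : ∃ t, m = t + 3 := ⟨m - 3, by omega⟩
          nlinarith
      omega
  have hS := Finset.sum_le_sum hpt
  rw [← Finset.mul_sum, Finset.sum_add_distrib] at hS
  have h6 : ∑ σ ∈ Φ, (if σ ∈ D then 0 else 6) = 6 * (Φ \ D).card := by
    rw [Finset.sum_ite]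
    simp [Finset.filter_notMem_eq_sdiff, mul_comm]
  rw [h6, Finset.card_sdiff_of_subset hD] at hS
  obtain ⟨t, rfl⟩ : ∃ t, s = t + 4 := ⟨s - 4, by omega⟩
  have e : t + 4 - 1 = t + 3 := by omega
  rw [e] at hDc
  have : Φ.card - D.card ≤ 2 * (t + 4) := by
    have : (t + 4) * (t + 4 + 1) = (t+4)*(t+3) + 2 * (t+4) := by ring
    omega
  nlinarith

/-- Affine version. -/
theorem AP_alg {I F : Type} [Fintype I] [Field F] (s : ℕ) (hs : 4 ≤ s)
    (hI : Fintype.card I = s + 1) (a b : I → F) (ha : Function.Injective a)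
    (hb : Function.Injective b) (D : Finset (F × F)) (hDc : s * (s - 1) ≤ D.card)
    (hc : ∀ p ∈ D, p.1 ≠ 0)
    (hD : ∀ p ∈ D, ∀ i, ∃ j, j ≠ i ∧ p.1 * b i + p.2 = a j) : False := by
  classical
  have hnt : Nontrivial I := by
    rw [← Fintype.one_lt_card_iff_nontrivial]; omega
  obtain ⟨i₀, j₀, hij₀⟩ := exists_pair_ne I
  let Q : Equiv.Perm I → F × F → Prop := fun σ p => ∀ i, p.1 * b i + p.2 = a (σ i)
  have hQ1 : ∀ σ p, Q σ p → p.1 ≠ 0 := by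
    intro σ p h h0
    have e1 := h i₀
    have e2 := h j₀
    rw [h0] at e1 e2
    apply hij₀
    apply σ.injective
    apply ha
    rw [← e1, ← e2]; ring
  have hex : ∀ p ∈ D, ∃ σ : Equiv.Perm I, Q σ p ∧ ∀ i, σ i ≠ i := by
    intro p hp
    choose f hf using hD p hp
    have : Function.Injective f := by
      intro i j hij
      have e1 := (hf i).2
      have e2 := (hf j).2
      rw [hij, ← e2] at e1
      apply hb
      exact mul_left_cancel₀ (hc p hp) (add_right_cancel e1)
    refine ⟨Equiv.ofBijective f (Finite.injective_iff_bijective.mp this), fun i => (hf i).2,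
      fun i => (hf i).1⟩
  have huniq : ∀ σ p q, Q σ p → Q σ q → p = q := by
    intro σ p q hp hq
    have e1 := (hp i₀).trans (hq i₀).symm
    have e2 := (hp j₀).trans (hq j₀).symm
    have hne : b i₀ - b j₀ ≠ 0 := sub_ne_zero.mpr (fun h => hij₀ (hb h))
    have h1 : p.1 = q.1 := by
      apply mul_right_cancel₀ hne
      linear_combination e1 - e2
    refine Prod.ext h1 ?_
    rw [h1] at e1
    exact add_left_cancel e1
  let g : F × F → Equiv.Perm I := fun p => if hp : p ∈ D then (hex p hp).choose else 1
  have hg : ∀ p ∈ D, Q (g p) p ∧ ∀ i, g p i ≠ i := by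
    intro p hp
    simp only [g, dif_pos hp]
    exact (hex p hp).choose_spec
  refine AP_comb s hs hI (Finset.univ.filter (fun σ => ∃ p, Q σ p)) (D.image g) ?_ ?_ ?_ ?_ ?_
  · intro σ hσ τ hτ i j hij e1 e2
    simp only [Finset.mem_filter, Finset.mem_univ, true_and] at hσ hτ
    obtain ⟨p, hp⟩ := hσ
    obtain ⟨q, hq⟩ := hτ
    have e1 : p.1 * b i + p.2 = q.1 * b i + q.2 := by rw [hp i, hq i, e1]
    have e2 : p.1 * b j + p.2 = q.1 * b j + q.2 := by rw [hp j, hq j, e2]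
    have hne : b i - b j ≠ 0 := sub_ne_zero.mpr (fun h => hij (hb h))
    have h1 : p.1 = q.1 := by
      apply mul_right_cancel₀ hne
      linear_combination e1 - e2
    have h2 : p.2 = q.2 := by
      rw [h1] at e1
      exact add_left_cancel e1
    ext k
    apply ha
    rw [← hp k, ← hq k, h1, h2]
  · intro σ hσ τ hτ ρ hρ
    simp only [Finset.mem_filter, Finset.mem_univ, true_and] at hσ hτ hρ ⊢
    obtain ⟨p, hp⟩ := hσ
    obtain ⟨q, hq⟩ := hτ
    obtain ⟨r, hr⟩ := hρ
    have hq0 := hQ1 _ _ hq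
    refine ⟨(p.1 * r.1 / q.1, p.1 * (r.2 - q.2) / q.1 + p.2), ?_⟩
    intro k
    have e1 := hr k
    have e2 := hq (τ⁻¹ (ρ k))
    have e3 := hp (τ⁻¹ (ρ k))
    rw [show τ (τ⁻¹ (ρ k)) = ρ k by simp] at e2
    simp only [Equiv.Perm.mul_apply]
    rw [← e3]
    have : b (τ⁻¹ (ρ k)) = (r.1 * b k + r.2 - q.2) / q.1 := by
      rw [eq_div_iff hq0, e1, ← e2]; ring
    rw [this]
    field_simp
    ring
  · intro σ hσ
    obtain ⟨p, hp, rfl⟩ := Finset.mem_image.mp hσ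
    simp only [Finset.mem_filter, Finset.mem_univ, true_and]
    exact ⟨p, (hg p hp).1⟩
  · rw [Finset.card_image_of_injOn]
    · exact hDc
    · intro p hp q hq h
      refine huniq (g p) p q (hg p hp).1 ?_
      rw [h]
      exact (hg q hq).1
  · intro σ hσ
    obtain ⟨p, hp, rfl⟩ := Finset.mem_image.mp hσ
    exact (hg p hp).2

section
variable {P L : Type} {s : ℕ} {R : P → L → Prop}

theorem AP_line_card [Fintype P] [Fintype L] (h : IsAntipodalPlane s R) (l : L)
    [DecidablePred fun x => R x l] :
    (Finset.univ.filter (fun x => R x l)).card = s + 1 := by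
  rw [← h.line_card l, Set.ncard_eq_toFinset_card']
  congr 1
  ext; simp

theorem AP_point_card [Fintype P] [Fintype L] (h : IsAntipodalPlane s R) (x : P)
    [DecidablePred fun l => R x l] :
    (Finset.univ.filter (fun l => R x l)).card = s + 1 := by
  rw [← h.point_card x, Set.ncard_eq_toFinset_card']
  congr 1
  ext; simp

theorem AP_anti [Fintype P] [Fintype L] (h : IsAntipodalPlane s R) (x : P) :
    ∃ x', x' ≠ x ∧ (∀ l, R x l → ¬ R x' l) ∧
      ∀ y, y ≠ x → y ≠ x' → ∃ l, R x l ∧ R y l := by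
  classical
  let T := (Finset.univ.filter (fun l => R x l)).biUnion
    (fun l => (Finset.univ.filter (fun y => R y l)).erase x)
  have hT : T.card = (s + 1) * s := by
    rw [Finset.card_biUnion]
    · rw [Finset.sum_congr rfl (g := fun _ => s)]
      · rw [Finset.sum_const, AP_point_card h x]; rfl
      · intro l hl
        rw [Finset.card_erase_of_mem (by simpa using hl), AP_line_card h l]; rfl
    · intro l hl m hm hlm
      refine Finset.disjoint_left.mpr ?_
      intro y hy hy'
      simp only [Finset.coe_filter, Set.mem_ofPred_eq, Finset.mem_filter, Finset.mem_univ, true_and, Finset.mem_erase] at *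
      exact hlm (h.partial_linear x y hy.1.symm l m hl hy.2 hm hy'.2)
  have hxT : x ∉ T := by simp [T]
  have hc : (insert x T)ᶜ.card = 1 := by
    rw [Finset.card_compl, Finset.card_insert_of_notMem hxT, hT, ← Nat.card_eq_fintype_card,
      h.card_points]
    have : s ^ 2 + s + 2 = (s + 1) * s + 1 + 1 := by ring
    omega
  obtain ⟨x', hx'⟩ := Finset.card_eq_one.mp hc
  have hmem : ∀ y, (y ≠ x ∧ ∀ l, R x l → ¬ R y l) ↔ y = x' := by
    intro y
    rw [← Finset.mem_singleton, ← hx']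
    simp only [T, Finset.mem_compl, Finset.mem_insert, Finset.mem_biUnion, Finset.mem_filter,
      Finset.mem_univ, true_and, Finset.mem_erase]
    push Not
    constructor
    · rintro ⟨h1, h2⟩
      exact ⟨h1, fun l hl _ => h2 l hl⟩
    · rintro ⟨h1, h2⟩
      exact ⟨h1, fun l hl => h2 l hl h1⟩
  refine ⟨x', ((hmem x').2 rfl).1, ((hmem x').2 rfl).2, ?_⟩
  intro y hy hy'
  by_contra hcon
  push Not at hcon
  exact hy' ((hmem y).1 ⟨hy, hcon⟩)

/-- A line missing `x` and its antipode meets all lines through `x`. -/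
theorem AP_meet [Fintype P] [Fintype L] (h : IsAntipodalPlane s R) (x x' : P)
    (hx : ∀ y, y ≠ x → y ≠ x' → ∃ l, R x l ∧ R y l) (m l : L) (hm : ¬ R x m) (hm' : ¬ R x' m)
    (hl : R x l) : ∃ y, R y m ∧ R y l := by
  classical
  have hex : ∀ y, R y m → ∃ l, R x l ∧ R y l := by
    intro y hy
    apply hx
    · rintro rfl; exact hm hy
    · rintro rfl; exact hm' hy
  let g : P → L := fun y => if hy : R y m then (hex y hy).choose else m
  have hg : ∀ y, R y m → R x (g y) ∧ R y (g y) := by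
    intro y hy
    simp only [g, dif_pos hy]
    exact (hex y hy).choose_spec
  have himg : (Finset.univ.filter (fun y => R y m)).image g
      = Finset.univ.filter (fun l => R x l) := by
    apply Finset.eq_of_subset_of_card_le
    · intro l hl
      obtain ⟨y, hy, rfl⟩ := Finset.mem_image.mp hl
      simp only [Finset.mem_filter, Finset.mem_univ, true_and] at hy ⊢
      exact (hg y hy).1
    · rw [AP_point_card h, Finset.card_image_of_injOn, AP_line_card h]
      intro y hy z hz hyz
      simp only [Finset.coe_filter, Finset.mem_univ, true_and, Set.mem_ofPred_eq] at hy hz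
      by_contra hne
      have h1 := hg y hy
      have h2 := hg z hz
      rw [← hyz] at h2
      have := h.partial_linear y z hne m (g y) hy hz h1.2 h2.2
      exact hm (by rw [this]; exact h1.1)
  have : l ∈ (Finset.univ.filter (fun y => R y m)).image g := by
    rw [himg]; simpa using hl
  obtain ⟨y, hy, rfl⟩ := Finset.mem_image.mp this
  simp only [Finset.mem_filter, Finset.mem_univ, true_and] at hy
  exact ⟨y, hy, (hg y hy).2⟩

theorem AP_disj [Fintype P] [Fintype L] (h : IsAntipodalPlane s R) (x x' : P)
    (hn : ∀ l, R x l → ¬ R x' l)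
    (hx : ∀ y, y ≠ x' → y ≠ x → ∃ l, R x' l ∧ R y l) (l : L) (hl : R x l) :
    ∃ k, R x' k ∧ (∀ y, R y l → ¬ R y k) ∧ ∀ k', R x' k' → (∀ y, R y l → ¬ R y k') → k' = k := by
  classical
  have hex : ∀ y, R y l → y ≠ x → ∃ l, R x' l ∧ R y l := by
    intro y hy hyx
    apply hx _ _ hyx
    rintro rfl; exact hn l hl hy
  let g : P → L := fun y => if hy : R y l ∧ y ≠ x then (hex y hy.1 hy.2).choose else l
  have hg : ∀ y, R y l → y ≠ x → R x' (g y) ∧ R y (g y) := by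
    intro y hy hy'
    simp only [g, dif_pos (And.intro hy hy')]
    exact (hex y hy hy').choose_spec
  let S := ((Finset.univ.filter (fun y => R y l)).erase x).image g
  have hS : S ⊆ Finset.univ.filter (fun l => R x' l) := by
    intro l hl
    obtain ⟨y, hy, rfl⟩ := Finset.mem_image.mp hl
    simp only [Finset.mem_erase, Finset.mem_filter, Finset.mem_univ, true_and] at hy ⊢
    exact (hg y hy.2 hy.1).1
  have hSc : S.card = s := by
    rw [Finset.card_image_of_injOn, Finset.card_erase_of_mem (by simpa using hl), AP_line_card h]
    · rfl
    · intro y hy z hz hyz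
      simp only [Finset.coe_erase, Finset.coe_filter, Finset.mem_univ, true_and, Set.mem_sdiff,
        Set.mem_ofPred_eq, Set.mem_singleton_iff] at hy hz
      by_contra hne
      have h1 := hg y hy.1 hy.2
      have h2 := hg z hz.1 hz.2
      rw [← hyz] at h2
      have := h.partial_linear y z hne l (g y) hy.1 hz.1 h1.2 h2.2
      exact hn l hl (by rw [this]; exact h1.1)
  have hc : (Finset.univ.filter (fun l => R x' l) \ S).card = 1 := by
    rw [Finset.card_sdiff_of_subset hS, AP_point_card h, hSc]; omega
  obtain ⟨k, hk⟩ := Finset.card_eq_one.mp hc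
  have hmem : ∀ k', (R x' k' ∧ k' ∉ S) ↔ k' = k := by
    intro k'
    rw [← Finset.mem_singleton, ← hk]
    simp
  refine ⟨k, ((hmem k).2 rfl).1, ?_, ?_⟩
  · intro y hy hyk
    have hyx : y ≠ x := by
      rintro rfl
      exact hn k hyk ((hmem k).2 rfl).1
    have hyx' : y ≠ x' := by
      rintro rfl
      exact hn l hl hy
    apply ((hmem k).2 rfl).2
    have := hg y hy hyx
    rw [h.partial_linear y x' hyx' k (g y) hyk ((hmem k).2 rfl).1 this.2 this.1]
    exact Finset.mem_image_of_mem _ (by simp [hyx, hy])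
  · intro k' hk' hd
    apply (hmem k').1
    refine ⟨hk', ?_⟩
    intro hmemS
    obtain ⟨y, hy, rfl⟩ := Finset.mem_image.mp hmemS
    simp only [Finset.mem_erase, Finset.mem_filter, Finset.mem_univ, true_and] at hy
    exact hd y hy.2 (hg y hy.2 hy.1).2

theorem AP_coord (F : Type) [Field F] (hE : HasEmbedding R (PGIncidence F)) :
    ∃ (u : P → Fin 3 → F) (f : L → (Fin 3 → F) →ₗ[F] F),
      (∀ x l, R x l ↔ f l (u x) = 0) ∧
      (∀ x y, x ≠ y → LinearIndependent F ![u x, u y]) ∧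
      (∀ x, u x ≠ 0) ∧
      (∀ l m, LinearMap.ker (f l) = LinearMap.ker (f m) → l = m) := by
  obtain ⟨φ, ψ, hφ, hψ, hR⟩ := hE
  have hp : ∀ x, ∃ v : Fin 3 → F, v ≠ 0 ∧ (φ x).1 = Submodule.span F {v} := by
    intro x
    have := (φ x).2
    obtain ⟨v, hv, hv'⟩ := finrank_eq_one_iff'.mp this
    refine ⟨v, by simpa using hv, ?_⟩
    apply le_antisymm
    · intro w hw
      obtain ⟨c, hc⟩ := hv' ⟨w, hw⟩
      rw [Submodule.mem_span_singleton]
      exact ⟨c, congrArg Subtype.val hc⟩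
    · rw [Submodule.span_singleton_le_iff_mem]
      exact v.2
  have hl : ∀ l, ∃ f : (Fin 3 → F) →ₗ[F] F, LinearMap.ker f = (ψ l).1 := by
    intro l
    have h2 := (ψ l).2
    have hlt : (ψ l).1 < ⊤ := by
      rw [lt_top_iff_ne_top]
      intro h
      rw [h, finrank_top] at h2
      simp at h2
    obtain ⟨f, hf, hle⟩ := Submodule.exists_le_ker_of_lt_top _ hlt
    refine ⟨f, (Submodule.eq_of_le_of_finrank_le hle ?_).symm⟩
    have h3 := LinearMap.finrank_range_add_finrank_ker f
    rw [LinearMap.range_eq_top.mpr (LinearMap.surjective hf), finrank_top] at h3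
    simp at h3
    omega
  choose u hu0 hu using hp
  choose f hf using hl
  refine ⟨u, f, ?_, ?_, hu0, ?_⟩
  · intro x l
    rw [hR, PGIncidence, hu, ← hf, Submodule.span_singleton_le_iff_mem, LinearMap.mem_ker]
  · intro x y hxy
    rw [LinearIndependent.pair_iff' (hu0 x)]
    intro a ha
    apply hxy
    apply hφ
    apply Subtype.ext
    rw [hu, hu, ← ha]
    have : a ≠ 0 := by
      rintro rfl
      exact hu0 y (by rw [← ha, zero_smul])
    exact (Submodule.span_singleton_smul_eq (IsUnit.mk0 a this) _).symm
  · intro l m hlm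
    apply hψ
    apply Subtype.ext
    rw [← hf, ← hf, hlm]

theorem AP_basis (F : Type) [Field F] (u v : Fin 3 → F) (h : LinearIndependent F ![u, v]) :
    ∃ B : Module.Basis (Fin 3) F (Fin 3 → F), B 0 = u ∧ B 1 = v := by
  have hlt : ∃ w, w ∉ Submodule.span F (Set.range ![u, v]) := by
    by_contra hcon
    push Not at hcon
    have : Submodule.span F (Set.range ![u, v]) = ⊤ := by
      rw [eq_top_iff]; intro w _; exact hcon w
    have h2 := finrank_span_eq_card h
    rw [this, finrank_top] at h2
    simp at h2
  obtain ⟨w, hw⟩ := hlt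
  have h3 : LinearIndependent F (Fin.snoc ![u, v] w : Fin 3 → Fin 3 → F) := h.finSnoc hw
  refine ⟨basisOfLinearIndependentOfCardEqFinrank h3 (by simp), ?_, ?_⟩
  · rw [coe_basisOfLinearIndependentOfCardEqFinrank]; rfl
  · rw [coe_basisOfLinearIndependentOfCardEqFinrank]; rfl
end

/-- No antipodal plane of order `s ≥ 4` embeds in a Desarguesian projective plane. -/
theorem no_embedded_antipodal_of_four_le {P L : Type} (s : ℕ) (hs : 4 ≤ s)
    (R : P → L → Prop) (h : IsAntipodalPlane s R)
    (F : Type) [Field F] [Fintype F] :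
    ¬ HasEmbedding R (PGIncidence F) := by
  classical
  intro hE
  have : Finite P := Nat.finite_of_card_ne_zero (by rw [h.card_points]; omega)
  have : Finite L := Nat.finite_of_card_ne_zero (by rw [h.card_lines]; omega)
  have := Fintype.ofFinite P
  have := Fintype.ofFinite L
  obtain ⟨u, f, hR, hind, hu0, hker⟩ := AP_coord F hE
  have hne : Nonempty P := (Nat.card_pos_iff.mp (by rw [h.card_points]; omega)).1
  obtain ⟨x⟩ := hne
  obtain ⟨x', hxx', hn, hx⟩ := AP_anti h x
  have hn' : ∀ l, R x' l → ¬ R x l := fun l h1 h2 => hn l h2 h1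
  have hx' : ∀ y, y ≠ x' → y ≠ x → ∃ l, R x' l ∧ R y l := by
    obtain ⟨z, hz, hzn, hz'⟩ := AP_anti h x'
    have : x = z := by
      by_contra hxz
      obtain ⟨l, h1, h2⟩ := hz' x hxx'.symm hxz
      exact hn l h2 h1
    rw [this]
    exact hz'
  obtain ⟨B, hB0, hB1⟩ := AP_basis F (u x) (u x') (hind x x' hxx'.symm)
  have hfx : ∀ l, R x l ↔ f l (B 0) = 0 := by intro l; rw [hB0]; exact hR x l
  have hfx' : ∀ l, R x' l ↔ f l (B 1) = 0 := by intro l; rw [hB1]; exact hR x' l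
  have hprop : ∀ l m (t : F), t ≠ 0 → (∀ i, f l (B i) = t * f m (B i)) → l = m := by
    intro l m t ht hi
    apply hker
    have : f l = t • f m := B.ext (fun i => by rw [hi]; rfl)
    rw [this, LinearMap.ker_smul _ _ ht]
  have hexp : ∀ l y, R y l ↔ B.repr (u y) 0 * f l (B 0) + B.repr (u y) 1 * f l (B 1)
      + B.repr (u y) 2 * f l (B 2) = 0 := by
    intro l y
    rw [hR]
    conv_lhs => rw [← B.sum_repr (u y), Fin.sum_univ_three]
    simp only [map_add, map_smul, smul_eq_mul]
  have hdual := AP_disj h x x' hn hx'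
  choose k hk1 hk2 hk3 using hdual
  have hcardI : Fintype.card {l // R x l} = s + 1 := by
    rw [Fintype.card_subtype, AP_point_card h]
  refine AP_alg (I := {l // R x l}) (F := F) s hs hcardI
    (fun l => - f l.1 (B 2) / f l.1 (B 1)) (fun l => - f (k l.1 l.2) (B 2) / f (k l.1 l.2) (B 0))
    ?_ ?_
    ((Finset.univ.filter (fun m => ¬ R x m ∧ ¬ R x' m)).image
      (fun m => (- f m (B 0) / f m (B 1), - f m (B 2) / f m (B 1)))) ?_ ?_ ?_
  · rintro ⟨l, hl⟩ ⟨m, hm⟩ e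
    have hl1 : f l (B 1) ≠ 0 := fun h0 => hn l hl ((hfx' l).2 h0)
    have hm1 : f m (B 1) ≠ 0 := fun h0 => hn m hm ((hfx' m).2 h0)
    simp only [Subtype.mk.injEq]
    apply hprop l m (f l (B 1) / f m (B 1)) (div_ne_zero hl1 hm1)
    simp only at e
    intro i
    fin_cases i
    · simp [(hfx l).1 hl, (hfx m).1 hm]
    · simp; field_simp
    · simp
      field_simp at e ⊢
      linear_combination -e
  · rintro ⟨l, hl⟩ ⟨m, hm⟩ e
    have hl' := hk1 l hl
    have hm' := hk1 m hm
    have hl1 : f (k l hl) (B 0) ≠ 0 := fun h0 => hn' _ hl' ((hfx _).2 h0)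
    have hm1 : f (k m hm) (B 0) ≠ 0 := fun h0 => hn' _ hm' ((hfx _).2 h0)
    have hkk : k l hl = k m hm := by
      apply hprop _ _ (f (k l hl) (B 0) / f (k m hm) (B 0)) (div_ne_zero hl1 hm1)
      simp only at e
      intro i
      fin_cases i
      · simp; field_simp
      · simp [(hfx' _).1 hl', (hfx' _).1 hm']
      · simp
        field_simp at e ⊢
        linear_combination -e
    obtain ⟨j, -, -, hj⟩ := AP_disj h x' x hn' hx (k l hl) hl'
    simp only [Subtype.mk.injEq]
    rw [hj l hl (fun y h1 h2 => hk2 l hl y h2 h1),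
      hj m hm (fun y h1 h2 => hk2 m hm y h2 (hkk ▸ h1))]
  · rw [Finset.card_image_of_injOn]
    · have e : Finset.univ.filter (fun m => ¬ R x m ∧ ¬ R x' m)
          = (Finset.univ.filter (fun m => R x m) ∪ Finset.univ.filter (fun m => R x' m))ᶜ := by
        ext m; simp
      rw [e, Finset.card_compl, Finset.card_union_of_disjoint, AP_point_card h, AP_point_card h,
        ← Nat.card_eq_fintype_card, h.card_lines]
      · obtain ⟨t, rfl⟩ : ∃ t, s = t + 1 := ⟨s - 1, by omega⟩
        have : (t + 1) ^ 2 + (t + 1) + 2 = (t + 1) * t + 2 * (t + 1) + 2 := by ring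
        rw [this, Nat.add_sub_cancel]
        omega
      · rw [Finset.disjoint_left]
        intro m h1 h2
        simp only [Finset.mem_filter, Finset.mem_univ, true_and] at h1 h2
        exact hn m h1 h2
    · intro l hl m hm e
      simp only [Finset.coe_filter, Finset.mem_univ, true_and, Set.mem_ofPred_eq] at hl hm
      simp only [Prod.mk.injEq] at e
      have hl1 : f l (B 1) ≠ 0 := fun h0 => hl.2 ((hfx' l).2 h0)
      have hm1 : f m (B 1) ≠ 0 := fun h0 => hm.2 ((hfx' m).2 h0)
      apply hprop l m (f l (B 1) / f m (B 1)) (div_ne_zero hl1 hm1)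
      obtain ⟨e0, e2⟩ := e
      intro i
      fin_cases i
      · simp
        field_simp at e0 ⊢
        linear_combination -e0
      · simp; field_simp
      · simp
        field_simp at e2 ⊢
        linear_combination -e2
  · intro p hp
    obtain ⟨m, hm, rfl⟩ := Finset.mem_image.mp hp
    simp only [Finset.mem_filter, Finset.mem_univ, true_and] at hm
    exact div_ne_zero (neg_ne_zero.mpr fun h0 => hm.1 ((hfx m).2 h0))
      (fun h0 => hm.2 ((hfx' m).2 h0))
  · rintro p hp ⟨l, hl⟩
    obtain ⟨m, hm, rfl⟩ := Finset.mem_image.mp hp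
    simp only [Finset.mem_filter, Finset.mem_univ, true_and] at hm
    have hl' := hk1 l hl
    obtain ⟨y, hym, hyk⟩ := AP_meet h x' x hx' m (k l hl) hm.2 hm.1 hl'
    have hyx : y ≠ x := by rintro rfl; exact hm.1 hym
    have hyx' : y ≠ x' := by rintro rfl; exact hm.2 hym
    obtain ⟨j, hxj, hyj⟩ := hx y hyx hyx'
    refine ⟨⟨j, hxj⟩, ?_, ?_⟩
    · intro e
      have e : j = l := congrArg Subtype.val e
      rw [e] at hyj
      exact hk2 l hl y hyj hyk
    · simp only
      have hm1 : f m (B 1) ≠ 0 := fun h0 => hm.2 ((hfx' m).2 h0)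
      have hj1 : f j (B 1) ≠ 0 := fun h0 => hn j hxj ((hfx' j).2 h0)
      have hk0 : f (k l hl) (B 0) ≠ 0 := fun h0 => hn' _ hl' ((hfx _).2 h0)
      have e1 := (hexp _ _).1 hym
      have e2 := (hexp _ _).1 hyk
      have e3 := (hexp _ _).1 hyj
      rw [(hfx' _).1 hl'] at e2
      rw [(hfx _).1 hxj] at e3
      set X := B.repr (u y) 0 with hX
      set Y := B.repr (u y) 1 with hY
      set Z := B.repr (u y) 2 with hZ
      have hZ0 : Z ≠ 0 := by
        intro h0
        rw [h0] at e2 e3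
        have hX0 : X = 0 := by
          have : X * f (k l hl) (B 0) = 0 := by linear_combination e2
          exact (mul_eq_zero.mp this).resolve_right hk0
        have hY0 : Y = 0 := by
          have : Y * f j (B 1) = 0 := by linear_combination e3
          exact (mul_eq_zero.mp this).resolve_right hj1
        apply hu0 y
        rw [← B.sum_repr (u y), Fin.sum_univ_three, ← hX, ← hY, ← hZ, hX0, hY0, h0]
        simp only [zero_smul, add_zero]
      have q1 : - f (k l hl) (B 2) / f (k l hl) (B 0) = X / Z := by
        rw [div_eq_div_iff hk0 hZ0]; linear_combination -e2
      have q2 : - f j (B 2) / f j (B 1) = Y / Z := by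
        rw [div_eq_div_iff hj1 hZ0]; linear_combination -e3
      rw [q1, q2]
      field_simp
      linear_combination -e1
end

section
/- Let p ≥ 3 be a prime, Π a finite projective plane of order p², and c a code word of C(Π)^⊥ of weight w(c) = 2p² − 2p + 2 + ε with 1 ≤ ε ≤ p − 2. Then every point P ∈ supp(c) is incident with at least 2p + 1 − ε lines that are 2-secants to supp(c). -/
/-- A projective plane of order `n`, given by an abstract incidence relation `R`. -/
structure IsProjectivePlaneOrder {P L : Type*} (n : ℕ) (R : P → L → Prop) : Prop where
  existsUnique_line : ∀ x y : P, x ≠ y → ∃! l : L, R x l ∧ R y l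
  existsUnique_point : ∀ l m : L, l ≠ m → ∃! x : P, R x l ∧ R x m
  quadrangle : ∃ a b c d : P, a ≠ b ∧ a ≠ c ∧ a ≠ d ∧ b ≠ c ∧ b ≠ d ∧ c ≠ d ∧
    ∀ l : L, ¬(R a l ∧ R b l ∧ R c l) ∧ ¬(R a l ∧ R b l ∧ R d l) ∧
      ¬(R a l ∧ R c l ∧ R d l) ∧ ¬(R b l ∧ R c l ∧ R d l)
  line_card : ∀ l : L, {x | R x l}.ncard = n + 1
  point_card : ∀ x : P, {l | R x l}.ncard = n + 1

/-- A code word of the dual code `C(Π)^⊥`: a function from points to `F_p` summing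
to zero on every line. -/
def IsDualCodeWord {P L : Type*} (p : ℕ) (R : P → L → Prop) (c : P → ZMod p) : Prop :=
  ∀ l : L, ∑ᶠ x ∈ {y : P | R y l}, c x = 0

/-- The number of `k`-secants to the point set `S` through the point `A`. -/
noncomputable def nSecants {P L : Type*} (R : P → L → Prop) (S : Set P) (k : ℕ) (A : P) : ℕ :=
  {l : L | R A l ∧ ({x | R x l} ∩ S).ncard = k}.ncard

/-- Every point of the support of a code word of weight `2p² - 2p + 2 + ε`,
`1 ≤ ε ≤ p - 2`, lies on at least `2p + 1 - ε` 2-secants to the support. -/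
theorem two_secants_lower_bound {Pt Ln : Type} [Finite Pt] [Finite Ln]
    (p : ℕ) (hp : p.Prime) (hp3 : 3 ≤ p)
    (R : Pt → Ln → Prop) (hPP : IsProjectivePlaneOrder (p ^ 2) R)
    (c : Pt → ZMod p) (hc : IsDualCodeWord p R c)
    (ε : ℕ) (hε1 : 1 ≤ ε) (hε2 : ε ≤ p - 2)
    (hw : (Function.support c).ncard = 2 * p ^ 2 - 2 * p + 2 + ε) :
    ∀ P ∈ Function.support c, 2 * p + 1 - ε ≤ nSecants R (Function.support c) 2 P := by
  classical
  intro P hP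
  haveI := Fintype.ofFinite Pt
  haveI := Fintype.ofFinite Ln
  set S : Finset Pt := Finset.univ.filter (fun x => c x ≠ 0) with hS
  set T : Finset Ln := Finset.univ.filter (fun l => R P l) with hT
  have hPS : P ∈ S := by
    rw [hS, Finset.mem_filter]; exact ⟨Finset.mem_univ _, hP⟩
  have hScard : S.card = 2 * p ^ 2 - 2 * p + 2 + ε := by
    rw [← hw, ← Set.ncard_coe_finset]
    congr 1
    ext x; simp [hS]
  have hTcard : T.card = p ^ 2 + 1 := by
    rw [← hPP.point_card P, ← Set.ncard_coe_finset]
    congr 1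
    ext x; simp [hT]
  have hm : ∀ l, ({x | R x l} ∩ Function.support c).ncard = (S.filter (fun x => R x l)).card := by
    intro l
    rw [← Set.ncard_coe_finset]
    congr 1
    ext x; simp [hS, and_comm]
  have hn : nSecants R (Function.support c) 2 P
      = (T.filter (fun l => (S.filter (fun x => R x l)).card = 2)).card := by
    unfold nSecants
    rw [← Set.ncard_coe_finset]
    congr 1
    ext l
    simp only [Set.mem_setOf_eq, Finset.coe_filter, hm, hT, Finset.mem_filter, Finset.mem_univ,
      true_and]
  have hge : ∀ l ∈ T, 2 ≤ (S.filter (fun x => R x l)).card := by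
    intro l hl
    have hPl : R P l := by simpa [hT] using hl
    have h1 : 0 < (S.filter (fun x => R x l)).card :=
      Finset.card_pos.mpr ⟨P, Finset.mem_filter.mpr ⟨hPS, hPl⟩⟩
    by_contra h2
    have h3 : ({x | R x l} ∩ Function.support c).ncard = 1 := by rw [hm]; omega
    obtain ⟨a, ha⟩ := Set.ncard_eq_one.mp h3
    have h4 := hc l
    rw [← finsum_mem_inter_support] at h4
    rw [ha, finsum_mem_singleton] at h4
    have h5 : a ∈ ({x | R x l} ∩ Function.support c) := by rw [ha]; rfl
    exact h5.2 h4
  have hsum : ∑ l ∈ T, (S.filter (fun x => R x l)).card = (p ^ 2 + 1) + (S.card - 1) := by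
    have h1 : ∑ l ∈ T, (S.filter (fun x => R x l)).card
        = ∑ x ∈ S, (T.filter (fun l => R x l)).card :=
      (Finset.sum_card_bipartiteAbove_eq_sum_card_bipartiteBelow (s := S) (t := T) R).symm
    rw [h1, ← Finset.add_sum_erase S _ hPS]
    congr 1
    · rw [← hTcard]
      congr 1
      apply Finset.filter_true_of_mem
      intro l hl
      simpa [hT] using hl
    · rw [← Finset.card_erase_of_mem hPS, Finset.card_eq_sum_ones]
      apply Finset.sum_congr rfl
      intro x hx
      obtain ⟨l, hl, hu⟩ := hPP.existsUnique_line P x (Finset.ne_of_mem_erase hx).symm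
      rw [Finset.card_eq_one]
      refine ⟨l, ?_⟩
      ext k
      simp only [hT, Finset.mem_filter, Finset.mem_univ, true_and, Finset.mem_singleton]
      exact ⟨fun h => hu k h, fun h => h ▸ hl⟩
  have hle : ∑ l ∈ T, 3 ≤ ∑ l ∈ T, ((S.filter (fun x => R x l)).card
      + if (S.filter (fun x => R x l)).card = 2 then 1 else 0) := by
    apply Finset.sum_le_sum
    intro l hl
    have := hge l hl
    split_ifs <;> omega
  rw [Finset.sum_add_distrib, hsum, ← Finset.card_filter, ← hn, Finset.sum_const, hTcard,
    hScard, smul_eq_mul] at hle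
  have hpp : p ≤ p ^ 2 := Nat.le_self_pow two_ne_zero p
  omega
end

section
/- Let p ≥ 7 be a prime and Π a finite projective plane of order p². There is no nonzero code word c of C(Π)^⊥ with w(c) ≤ 2p² − 2p + 4 that takes more than 2 distinct nonzero values. -/
namespace SC
open Finset

def LP (p : ℕ) [Fact p.Prime] (n : ZMod p → ℕ) : Prop :=
  ∀ a, n a ≠ 0 → ∀ u : ZMod p → ℚ,
    (∀ M : Multiset (ZMod p), (∀ x ∈ M, n x ≠ 0) → M.sum = -a → 1 ≤ (M.map u).sum) →
    (p : ℚ) ^ 2 + 1 + u a ≤ ∑ x, (n x : ℚ) * u x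

lemma LP.scale {p : ℕ} [Fact p.Prime] {n : ZMod p → ℕ} (h : LP p n) (t : ZMod p) (ht : t ≠ 0) :
    LP p (fun x => n (t * x)) := by
  intro a ha u hu
  have := h (t * a) ha (fun x => u (t⁻¹ * x)) ?_
  · simp only [inv_mul_cancel_left₀ ht] at this
    refine this.trans (le_of_eq ?_)
    refine (Fintype.sum_equiv (Equiv.mulLeft₀ t ht) _ _ ?_).symm
    intro x
    simp [ht]
  · intro M hM hs
    have := hu (M.map (fun x => t⁻¹ * x)) ?_ ?_
    · simpa [Multiset.map_map, Function.comp_def] using this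
    · intro x hx
      rw [Multiset.mem_map] at hx
      obtain ⟨y, hy, rfl⟩ := hx
      show n (t * (t⁻¹ * y)) ≠ 0
      rw [mul_inv_cancel_left₀ ht]
      exact hM y hy
    · rw [Multiset.sum_map_mul_left, Multiset.map_id', hs]
      field_simp

lemma weight_sum {α : Type*} [DecidableEq α] (M : Multiset α) (B : Finset α) (J : ℕ) (hJ : 2 ≤ J) :
    2 * (J : ℚ) * (M.map (fun x => if x ∈ B then (1 : ℚ) / J else 1 / 2)).sum
      = J * M.card - (J - 2) * (M.filter (· ∈ B)).card := by
  have hJ0 : (J : ℚ) ≠ 0 := by positivity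
  induction M using Multiset.induction_on with
  | empty => simp
  | cons x M ih =>
    by_cases hx : x ∈ B
    · rw [Multiset.map_cons, Multiset.sum_cons, mul_add, ih, Multiset.card_cons,
        Multiset.filter_cons_of_pos _ hx, Multiset.card_cons, if_pos hx]
      push_cast; field_simp; ring
    · rw [Multiset.map_cons, Multiset.sum_cons, mul_add, ih, Multiset.card_cons,
        Multiset.filter_cons_of_neg _ hx, if_neg hx]
      push_cast; field_simp; ring

lemma weight_ge {p : ℕ} [Fact p.Prime] {n : ZMod p → ℕ} (h : LP p n) (hp2 : p ≠ 2)
    (h0 : n 0 = 0) (a : ZMod p) (ha : n a ≠ 0)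
    (B : Finset (ZMod p)) (haB : -a ∉ B) (J : ℕ) (hJ : 2 ≤ J)
    (hB : ∀ M : Multiset (ZMod p), (∀ x ∈ M, n x ≠ 0) → M.sum = -a → -a ∉ M → M.card < J →
      2 * J + (J - 2) * (M.filter (· ∈ B)).card ≤ J * M.card) :
    2 * (J : ℤ) * (p ^ 2 + 1) + (if a ∈ B then 2 else (J : ℤ)) + (J - 2) * ∑ x ∈ B, (n x : ℤ)
      ≤ J * ∑ x, (n x : ℤ) + J * n (-a) := by
  have hJ0 : (0 : ℚ) < J := by positivity
  have ha0 : a ≠ 0 := by rintro rfl; exact ha h0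
  have hne : a ≠ -a := by
    intro h'
    have h2 : (2 : ZMod p) * a = 0 := by linear_combination h'
    rcases mul_eq_zero.1 h2 with h3 | h3
    · have : ((2 : ℕ) : ZMod p) = 0 := by exact_mod_cast h3
      rw [ZMod.natCast_eq_zero_iff] at this
      exact hp2 ((Nat.prime_dvd_prime_iff_eq (Fact.out) Nat.prime_two).1 this)
    · exact ha0 h3
  set u : ZMod p → ℚ := fun x => if x = -a then 1 else if x ∈ B then (1 : ℚ) / J else 1 / 2 with hu
  have hupos : ∀ x, 0 ≤ u x := by
    intro x; simp only [hu]; split_ifs <;> positivity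
  have key := h a ha u ?_
  · have e1 : 2 * (J : ℚ) * u a = if a ∈ B then 2 else (J : ℚ) := by
      simp only [hu, if_neg hne]; split_ifs
      · field_simp
      · ring
    have e2 : 2 * (J : ℚ) * ∑ x, (n x : ℚ) * u x
        = J * ∑ x, (n x : ℚ) + J * n (-a) - (J - 2) * ∑ x ∈ B, (n x : ℚ) := by
      have : ∀ x, 2 * (J : ℚ) * ((n x : ℚ) * u x) = J * n x + (if x = -a then J * (n x : ℚ) else 0)
          - (if x ∈ B then (J - 2) * (n x : ℚ) else 0) := by
        intro x
        simp only [hu]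
        by_cases h1 : x = -a
        · subst h1; simp [haB]; ring
        · by_cases h2 : x ∈ B
          · simp [h1, h2]; field_simp; ring
          · simp [h1, h2]; ring
      rw [Finset.mul_sum, Finset.sum_congr rfl (fun x _ => this x), Finset.sum_sub_distrib,
        Finset.sum_add_distrib]
      simp [Finset.mul_sum, Finset.sum_ite_mem]
    have e3 : 2 * (J : ℚ) * ((p : ℚ) ^ 2 + 1 + u a) ≤ 2 * J * ∑ x, (n x : ℚ) * u x :=
      mul_le_mul_of_nonneg_left key (by positivity)
    rw [e2, mul_add, e1] at e3
    have e4 : 2 * (J : ℚ) * (p ^ 2 + 1) + (if a ∈ B then 2 else (J : ℚ))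
      + (J - 2) * ∑ x ∈ B, (n x : ℚ) ≤ J * ∑ x, (n x : ℚ) + J * n (-a) := by linarith
    split_ifs at e4 ⊢ <;> exact_mod_cast e4
  · intro M hM hs
    by_cases hmem : -a ∈ M
    · obtain ⟨M', rfl⟩ := Multiset.exists_cons_of_mem hmem
      have : 0 ≤ (M'.map u).sum := Multiset.sum_nonneg (by
        intro x hx; rw [Multiset.mem_map] at hx; obtain ⟨y, _, rfl⟩ := hx; exact hupos y)
      simp only [Multiset.map_cons, Multiset.sum_cons]
      have : u (-a) = 1 := by simp [hu]
      linarith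
    · have hmap : M.map u = M.map (fun x => if x ∈ B then (1 : ℚ) / J else 1 / 2) := by
        apply Multiset.map_congr rfl
        intro x hx
        have : x ≠ -a := by rintro rfl; exact hmem hx
        simp [hu, this]
      have hw := weight_sum M B J hJ
      rw [← hmap] at hw
      have hle : (M.filter (· ∈ B)).card ≤ M.card := Multiset.card_le_card (Multiset.filter_le _ _)
      have hJ2 : (0 : ℚ) ≤ J - 2 := by
        have : (2 : ℚ) ≤ J := by exact_mod_cast hJ
        linarith
      have main : 2 * (J : ℚ) ≤ J * M.card - (J - 2) * (M.filter (· ∈ B)).card := by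
        by_cases hc : M.card < J
        · have := hB M hM hs hmem hc
          have h' : 2 * (J : ℚ) + (J - 2) * (M.filter (· ∈ B)).card ≤ J * M.card := by
            have h3 : ((J - 2 : ℕ) : ℚ) = J - 2 := by push_cast [hJ]; ring
            rw [← h3]; exact_mod_cast this
          linarith
        · have h1 : (J : ℚ) ≤ M.card := by exact_mod_cast not_lt.1 hc
          have h2 : ((M.filter (· ∈ B)).card : ℚ) ≤ M.card := by exact_mod_cast hle
          nlinarith [mul_le_mul_of_nonneg_left h2 hJ2]
      rw [← hw] at main
      have : 2 * (J : ℚ) * 1 ≤ 2 * J * (M.map u).sum := by linarith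
      exact le_of_mul_le_mul_left this (by positivity)

end SC

namespace SC
open Finset

lemma ms2 {p : ℕ} [Fact p.Prime] (a : ZMod p) (ha0 : a ≠ 0) (M : Multiset (ZMod p))
    (hs : M.sum = -a) (hm : -a ∉ M) : 2 ≤ M.card := by
  by_contra hc
  have : M.card = 0 ∨ M.card = 1 := by omega
  rcases this with h | h
  · rw [Multiset.card_eq_zero] at h
    subst h
    simp at hs
    exact ha0 hs
  · obtain ⟨x, rfl⟩ := Multiset.card_eq_one.1 h
    simp at hs hm
    exact hm hs.symm

lemma step1 {p : ℕ} [Fact p.Prime] {n : ZMod p → ℕ} (h : LP p n) (hp : 7 ≤ p) (h0 : n 0 = 0)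
    (s : ℕ) (hw : ∑ x, n x + s = 2 * p ^ 2 + 3) (a : ZMod p) (ha : n a ≠ 0) : s ≤ n (-a) := by
  have ha0 : a ≠ 0 := by rintro rfl; exact ha h0
  have key := weight_ge h (by omega) h0 a ha ∅ (by simp) 2 le_rfl ?_
  · simp at key
    zify at hw ⊢
    linarith
  · intro M hM hs hm hc
    have := ms2 a ha0 M hs hm
    omega

/-- Elements of the support whose successor is neither zero nor in the support. -/
def Bs {p : ℕ} [Fact p.Prime] (n : ZMod p → ℕ) : Finset (ZMod p) :=
  univ.filter (fun x => n x ≠ 0 ∧ x ≠ -1 ∧ n (-1 - x) = 0)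

lemma card2B {p : ℕ} [Fact p.Prime] {n : ZMod p → ℕ} (M : Multiset (ZMod p))
    (hM : ∀ x ∈ M, n x ≠ 0) (hs : M.sum = -1) (hc : M.card = 2) :
    (M.filter (· ∈ Bs n)).card = 0 := by
  rw [Multiset.card_eq_zero, Multiset.filter_eq_nil]
  obtain ⟨x, y, rfl⟩ := Multiset.card_eq_two.1 hc
  have hxy : x + y = -1 := by simpa using hs
  have hx := hM x (by simp)
  have hy := hM y (by simp)
  intro z hz hB
  simp only [Bs, mem_filter, mem_univ, true_and] at hB
  simp at hz
  rcases hz with rfl | rfl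
  · apply hy; rw [← hB.2.2]; congr 1; linear_combination hxy
  · apply hx; rw [← hB.2.2]; congr 1; linear_combination hxy

lemma stepJ3 {p : ℕ} [Fact p.Prime] {n : ZMod p → ℕ} (h : LP p n) (hp : 7 ≤ p) (h0 : n 0 = 0)
    (s : ℕ) (hw : ∑ x, n x + s = 2 * p ^ 2 + 3) (h1 : n 1 ≠ 0) :
    3 * s + ∑ x ∈ Bs n, n x ≤ 3 * n (-1) + 1 := by
  have key := weight_ge h (by omega) h0 1 h1 (Bs n) (by simp [Bs]) 3 (by norm_num) ?_
  · have : (2 : ℤ) ≤ (if (1 : ZMod p) ∈ Bs n then 2 else ((3 : ℕ) : ℤ)) := by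
      split_ifs <;> norm_num
    zify at hw ⊢
    push_cast at key
    generalize (if (1 : ZMod p) ∈ Bs n then (2:ℤ) else 3) = t at *
    linarith
  · intro M hM hs hm hc
    have := ms2 1 one_ne_zero M hs hm
    have := card2B M hM hs (by omega)
    omega

lemma stepJ4 {p : ℕ} [Fact p.Prime] {n : ZMod p → ℕ} (h : LP p n) (hp : 7 ≤ p) (h0 : n 0 = 0)
    (s : ℕ) (hw : ∑ x, n x + s = 2 * p ^ 2 + 3) (h1 : n 1 ≠ 0)
    (h3 : ∀ x ∈ Bs n, ∀ y ∈ Bs n, ∀ z ∈ Bs n, x + y + z ≠ -1) :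
    4 * s + 2 * ∑ x ∈ Bs n, n x ≤ 4 * n (-1) + 2 := by
  have key := weight_ge h (by omega) h0 1 h1 (Bs n) (by simp [Bs]) 4 (by norm_num) ?_
  · have : (2 : ℤ) ≤ (if (1 : ZMod p) ∈ Bs n then 2 else ((4 : ℕ) : ℤ)) := by
      split_ifs <;> norm_num
    zify at hw ⊢
    push_cast at key
    generalize (if (1 : ZMod p) ∈ Bs n then (2:ℤ) else 4) = t at *
    linarith
  · intro M hM hs hm hc
    have h2 := ms2 1 one_ne_zero M hs hm
    have : M.card = 2 ∨ M.card = 3 := by omega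
    rcases this with hc2 | hc3
    · have := card2B M hM hs hc2
      omega
    · have hle : (M.filter (· ∈ Bs n)).card ≤ M.card :=
        Multiset.card_le_card (Multiset.filter_le _ _)
      have hne : (M.filter (· ∈ Bs n)).card ≠ 3 := by
        intro h'
        have hh : M.filter (· ∈ Bs n) = M :=
          Multiset.eq_of_le_of_card_le (Multiset.filter_le _ _) (by omega)
        rw [Multiset.filter_eq_self] at hh
        obtain ⟨x, y, z, rfl⟩ := Multiset.card_eq_three.1 hc3
        apply h3 x (hh x (by simp)) y (hh y (by simp)) z (hh z (by simp))
        rw [← hs]; simp [add_assoc]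
      omega

/-- Interval lemma. -/
lemma stepInt {p : ℕ} [Fact p.Prime] {n : ZMod p → ℕ} (h : LP p n) (hp : 7 ≤ p) (h0 : n 0 = 0)
    (s : ℕ) (hw : ∑ x, n x + s = 2 * p ^ 2 + 3) (k : ℕ) (h2k : 2 * k < p)
    (hX : ∀ x, n x ≠ 0 → |x.valMinAbs| ≤ k) (a : ℕ) (ha1 : 1 ≤ a) (hak : a ≤ k)
    (hna : n (a : ZMod p) ≠ 0) (J : ℕ) (hJ : 2 ≤ J) (hJk : (J - 1) * k + a < p)
    (B : Finset (ZMod p)) (hBm : ∀ x ∈ B, (k : ℤ) - a < x.valMinAbs) :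
    (J : ℤ) * s + (if (a : ZMod p) ∈ B then 2 else (J : ℤ)) + (J - 2) * ∑ x ∈ B, (n x : ℤ)
      ≤ J * n (-(a : ZMod p)) + J := by
  have ha0 : (a : ZMod p) ≠ 0 := by intro h'; rw [h'] at hna; exact hna h0
  have hva : (-(a : ZMod p)).valMinAbs = -a := by
    rw [ZMod.valMinAbs_spec]
    constructor
    · push_cast; ring
    · constructor <;> push_cast <;> omega
  have key := weight_ge h (by omega) h0 a hna B ?_ J hJ ?_
  · have hw' : (∑ x, (n x : ℤ)) = 2 * p ^ 2 + 3 - s := by zify at hw; linarith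
    rw [hw'] at key
    linarith
  · intro h'
    have := hBm _ h'
    rw [hva] at this; omega
  · intro M hM hs hm hc
    have h2 := ms2 _ ha0 M hs hm
    suffices hh : (M.filter (· ∈ B)).card + 2 ≤ M.card by
      obtain ⟨J', rfl⟩ := Nat.exists_eq_add_of_le hJ
      simp only [Nat.add_sub_cancel_left]
      nlinarith
    have hcast : ∀ N : Multiset (ZMod p), (((N.map ZMod.valMinAbs).sum : ℤ) : ZMod p) = N.sum := by
      intro N
      induction N using Multiset.induction_on with
      | empty => simp
      | cons x N ih => simp [ih]
    have hup : ∀ N : Multiset (ZMod p), (∀ x ∈ N, n x ≠ 0) →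
        (N.map ZMod.valMinAbs).sum ≤ N.card * (k : ℤ) ∧
        -(N.card * (k : ℤ)) ≤ (N.map ZMod.valMinAbs).sum := by
      intro N
      induction N using Multiset.induction_on with
      | empty => simp
      | cons x N ih =>
        intro hN
        have h1 := abs_le.1 (hX x (hN x (by simp)))
        have h2 := ih (fun y hy => hN y (by simp [hy]))
        simp only [Multiset.map_cons, Multiset.sum_cons, Multiset.card_cons]
        push_cast
        constructor <;> linarith [h1.1, h1.2, h2.1, h2.2]
    have hlow : ∀ N : Multiset (ZMod p), (∀ x ∈ N, x ∈ B) →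
        N.card * ((k : ℤ) - a + 1) ≤ (N.map ZMod.valMinAbs).sum := by
      intro N
      induction N using Multiset.induction_on with
      | empty => simp
      | cons x N ih =>
        intro hN
        have h1 := hBm x (hN x (by simp))
        have h2 := ih (fun y hy => hN y (by simp [hy]))
        simp only [Multiset.map_cons, Multiset.sum_cons, Multiset.card_cons]
        push_cast
        linarith
    have hsplit := Multiset.filter_add_not (· ∈ B) M
    set M1 := M.filter (· ∈ B) with hM1
    set M2 := M.filter (fun x => ¬ x ∈ B) with hM2
    have hcc : M1.card + M2.card = M.card := by rw [← hsplit, Multiset.card_add]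
    by_contra hcon
    have hM2c : M2.card ≤ 1 := by omega
    have hsum : (M1.map ZMod.valMinAbs).sum + (M2.map ZMod.valMinAbs).sum
        = (M.map ZMod.valMinAbs).sum := by
      rw [← Multiset.sum_add, ← Multiset.map_add, hsplit]
    have hb1 := hlow M1 (by intro x hx; rw [hM1, Multiset.mem_filter] at hx; exact hx.2)
    have hb2 := hup M2 (by intro x hx; rw [hM2, Multiset.mem_filter] at hx; exact hM x hx.1)
    have hb := hup M hM
    have hdvd : (p : ℤ) ∣ (M.map ZMod.valMinAbs).sum + a := by
      rw [← ZMod.intCast_zmod_eq_zero_iff_dvd]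
      rw [Int.cast_add, Int.cast_natCast, hcast, hs]; ring
    have hM1c : 1 ≤ M1.card := by omega
    have hpos : 0 < (M.map ZMod.valMinAbs).sum + a := by
      have e1 : ((k : ℤ) - a + 1) ≤ M1.card * ((k : ℤ) - a + 1) := by
        have : (1 : ℤ) ≤ M1.card := by exact_mod_cast hM1c
        have h3 : (0 : ℤ) ≤ (k : ℤ) - a + 1 := by omega
        nlinarith
      have e2 : (M2.card : ℤ) * k ≤ k := by
        have : (M2.card : ℤ) ≤ 1 := by exact_mod_cast hM2c
        nlinarith
      linarith [hb2.2]
    have hlt : (M.map ZMod.valMinAbs).sum + a < p := by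
      have : (M.card : ℤ) * k ≤ ((J - 1 : ℕ) : ℤ) * k := by
        have : (M.card : ℤ) ≤ ((J - 1 : ℕ) : ℤ) := by exact_mod_cast (by omega)
        nlinarith
      have h5 : ((J - 1 : ℕ) : ℤ) * k + a < p := by exact_mod_cast hJk
      linarith [hb.1]
    exact absurd (Int.le_of_dvd hpos hdvd) (by omega)

end SC

namespace SC
open Finset

lemma exists_max (Q : ℕ → Prop) (h0 : Q 0) (hne : ∃ j, ¬ Q j) :
    ∃ k, (∀ j ≤ k, Q j) ∧ ¬ Q (k + 1) := by
  classical
  have hf := Nat.find_spec hne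
  have hm := fun j => @Nat.find_min _ _ hne j
  rcases hk : Nat.find hne with _ | k
  · rw [hk] at hf; exact absurd h0 hf
  · refine ⟨k, fun j hj => ?_, by rw [hk] at hf; exact hf⟩
    have := hm j (by omega)
    simpa using this

lemma case1 {p : ℕ} [Fact p.Prime] {n : ZMod p → ℕ} (h : LP p n) (hp : 7 ≤ p) (h0 : n 0 = 0)
    (s : ℕ) (hw : ∑ x, n x + s = 2 * p ^ 2 + 3) (hs : 2 * p ≤ s + 1) (k : ℕ) (h2k : 2 * k + 1 < p)
    (hk : 2 ≤ k) (hX : ∀ x, n x ≠ 0 ↔ x ≠ 0 ∧ |x.valMinAbs| ≤ k)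
    (hmin : ∀ x, n x ≠ 0 → n (-1) ≤ n x) : False := by
  have hv : ∀ i : ℤ, |i| ≤ k → ((i : ZMod p)).valMinAbs = i := by
    intro i hi
    rw [abs_le] at hi
    rw [ZMod.valMinAbs_spec]
    refine ⟨rfl, ?_⟩
    constructor <;> push_cast <;> omega
  have hvn : ∀ i : ℕ, i ≤ k → ((i : ZMod p)).valMinAbs = i := by
    intro i hi
    have := hv i (by rw [abs_le]; constructor <;> omega)
    simpa using this
  have hmem : ∀ i : ℤ, i ≠ 0 → |i| ≤ k → n (i : ZMod p) ≠ 0 := by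
    intro i hi hik
    rw [hX, hv i hik]
    refine ⟨?_, hik⟩
    intro h'
    have := hv i hik
    rw [h', ZMod.valMinAbs_zero] at this
    exact hi this.symm
  have hmemn : ∀ i : ℕ, 1 ≤ i → i ≤ k → n (i : ZMod p) ≠ 0 := by
    intro i hi hik
    have := hmem i (by omega) (by rw [abs_le]; constructor <;> omega)
    simpa using this
  -- choose J
  obtain ⟨J, hJ1, hJ2⟩ : ∃ J, (J - 1) * k < p - 1 ∧ p - 1 ≤ J * k := by
    obtain ⟨J, h1, h2⟩ := exists_max (fun j => j * k < p - 1) (by simp; omega) ⟨p, by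
      simp only [not_lt]; nlinarith [Nat.sub_le p 1]⟩
    refine ⟨J + 1, by simpa using h1 J le_rfl, by simpa using h2⟩
  have hJ3 : 3 ≤ J := by
    by_contra hc
    have : J * k ≤ 2 * k := Nat.mul_le_mul_right _ (by omega)
    omega
  have hJ1' : ((J : ℤ) - 1) * k < p - 1 := by
    have := hJ1
    zify [show 1 ≤ J by omega, show 1 ≤ p by omega] at this; exact this
  have hJ2' : (p : ℤ) - 1 ≤ J * k := by
    have := hJ2
    zify [show 1 ≤ p by omega] at this; exact this
  have hXle : ∀ x, n x ≠ 0 → |x.valMinAbs| ≤ k := fun x hx => ((hX x).1 hx).2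
  have s1 := stepInt h hp h0 s hw k (by omega) hXle 1 le_rfl (by omega) (hmemn 1 le_rfl (by omega))
    J (by omega) (by omega) {(k : ZMod p)} (by
      intro x hx; rw [mem_singleton] at hx; subst hx; rw [hvn k le_rfl]; push_cast; omega)
  rw [if_neg (by
    rw [mem_singleton]
    intro h'
    have := congrArg ZMod.valMinAbs h'
    rw [hvn 1 (by omega), hvn k le_rfl] at this
    omega), sum_singleton] at s1
  have hmk := hmin _ (hmemn k (by omega) le_rfl)
  have hJz : (3 : ℤ) ≤ J := by exact_mod_cast hJ3
  have hmk' : ((n (-1) : ℕ) : ℤ) ≤ n (k : ZMod p) := by exact_mod_cast hmk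
  have hmu : (J : ℤ) * s ≤ 2 * n (-1) := by
    push_cast at s1
    nlinarith
  have hall : ∀ x, n x ≠ 0 → (J : ℤ) * s ≤ 2 * n x := by
    intro x hx
    have : ((n (-1) : ℕ) : ℤ) ≤ n x := by exact_mod_cast hmin x hx
    linarith
  -- the index set
  set I : Finset ℤ := (Finset.Icc (-(k : ℤ)) k).erase 0 with hI
  have hIc : (I.card : ℤ) = 2 * k := by
    rw [hI, Finset.card_erase_of_mem (by simp), Int.card_Icc]
    omega
  have hIm : ∀ i ∈ I, i ≠ 0 ∧ |i| ≤ k := by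
    intro i hi
    rw [hI, Finset.mem_erase, Finset.mem_Icc] at hi
    exact ⟨hi.1, abs_le.2 hi.2⟩
  have hinj : Set.InjOn (fun i : ℤ => (i : ZMod p)) I := by
    intro i hi j hj hij
    have := congrArg ZMod.valMinAbs hij
    simp only at this
    rwa [hv i (hIm i hi).2, hv j (hIm j hj).2] at this
  have hsumle : ∑ i ∈ I, (n (i : ZMod p) : ℤ) ≤ 2 * p ^ 2 + 3 - s := by
    have e1 : ∑ i ∈ I, (n (i : ZMod p) : ℤ) = ∑ x ∈ I.image (fun i : ℤ => (i : ZMod p)), (n x : ℤ) := by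
      rw [Finset.sum_image hinj]
    have e2 : ∑ x ∈ I.image (fun i : ℤ => (i : ZMod p)), (n x : ℤ) ≤ ∑ x, (n x : ℤ) :=
      Finset.sum_le_univ_sum_of_nonneg (fun x => by positivity)
    zify at hw
    linarith
  have hps : (p : ℤ) * s ≤ ∑ i ∈ I, (n (i : ZMod p) : ℤ) := by
    have hsz : (0 : ℤ) ≤ s := by positivity
    by_cases hJk : (p : ℤ) ≤ J * k
    · have : I.card • ((J : ℤ) * s) ≤ ∑ i ∈ I, 2 * (n (i : ZMod p) : ℤ) :=
        Finset.card_nsmul_le_sum I _ _ (fun i hi => hall _ (hmem i (hIm i hi).1 (hIm i hi).2))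
      rw [nsmul_eq_mul, hIc, ← Finset.mul_sum] at this
      nlinarith
    · have hJk' : (J : ℤ) * k = p - 1 := by omega
      have hcond : (J - 1) * k + 2 < p := by
        zify [show 1 ≤ J by omega]
        have : ((J : ℤ) - 1) * k = p - 1 - k := by linarith
        rw [this]; omega
      have gen : ∀ m : ZMod p → ℕ, LP p m → m 0 = 0 → ∑ x, m x + s = 2 * p ^ 2 + 3 →
          (∀ x, m x ≠ 0 ↔ x ≠ 0 ∧ |x.valMinAbs| ≤ k) → (∀ x, m x ≠ 0 → (J : ℤ) * s ≤ 2 * m x) →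
          ((J : ℤ) - 1) * s ≤ m (-2) := by
        intro m hm hm0 hmw hmX hmall
        have hmmem : ∀ i : ℕ, 1 ≤ i → i ≤ k → m (i : ZMod p) ≠ 0 := by
          intro i hi hik
          rw [hmX, ← hX]; exact hmemn i hi hik
        have hkk : (((k - 1 : ℕ)) : ZMod p) ≠ (k : ZMod p) := by
          intro h'
          have := congrArg ZMod.valMinAbs h'
          rw [hvn (k-1) (by omega), hvn k le_rfl] at this
          omega
        have s2 := stepInt hm hp hm0 s hmw k (by omega) (fun x hx => ((hmX x).1 hx).2) 2 (by omega)
          hk (hmmem 2 (by omega) hk) J (by omega) hcond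
          {((k - 1 : ℕ) : ZMod p), (k : ZMod p)} (by
            intro x hx
            rw [mem_insert, mem_singleton] at hx
            rcases hx with rfl | rfl
            · rw [hvn _ (by omega)]; push_cast; omega
            · rw [hvn _ le_rfl]; push_cast; omega)
        rw [sum_pair hkk] at s2
        have c1 := hmall _ (hmmem (k - 1) (by omega) (by omega))
        have c2 := hmall _ (hmmem k (by omega) (by omega))
        have c3 : (2 : ℤ) ≤ (if ((2 : ℕ) : ZMod p) ∈ ({((k - 1 : ℕ) : ZMod p), (k : ZMod p)} : Finset (ZMod p)) then 2 else (J : ℤ)) := by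
          split_ifs <;> omega
        generalize (if ((2 : ℕ) : ZMod p) ∈ ({((k - 1 : ℕ) : ZMod p), (k : ZMod p)} : Finset (ZMod p)) then 2 else (J : ℤ)) = t at *
        push_cast at s2
        have c4 : ((J : ℤ) - 2) * (J * s) ≤ (J - 2) * (m ((k - 1 : ℕ) : ZMod p) + m (k : ZMod p)) :=
          mul_le_mul_of_nonneg_left (by linarith) (by linarith)
        have c5 : (J : ℤ) * ((J - 1) * s - 1) < J * m (-2) := by linarith
        have := lt_of_mul_lt_mul_left c5 (by positivity)
        omega
      have g1 := gen n h h0 hw hX hall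
      have g2 : ((J : ℤ) - 1) * s ≤ n 2 := by
        have := gen (fun x => n (-1 * x)) (h.scale (-1) (by simp)) (by simpa using h0) ?_ ?_ ?_
        · simpa using this
        · rw [← hw]; congr 1
          exact Fintype.sum_equiv (Equiv.neg _) _ _ (by intro x; simp)
        · intro x
          rw [hX]
          have : |(-1 * x).valMinAbs| = |x.valMinAbs| := by
            rw [ZMod.abs_valMinAbs_eq_abs_valMinAbs]; right; ring
          rw [this]; simp
        · intro x hx; exact hall _ hx
      have hsub : ({2, -2} : Finset ℤ) ⊆ I := by
        intro i hi
        rw [mem_insert, mem_singleton] at hi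
        rw [hI, Finset.mem_erase, Finset.mem_Icc]
        omega
      have e1 : ∑ i ∈ ({2, -2} : Finset ℤ), (2 * (n (i : ZMod p) : ℤ) - J * s) ≤
          ∑ i ∈ I, (2 * (n (i : ZMod p) : ℤ) - J * s) :=
        Finset.sum_le_sum_of_subset_of_nonneg hsub (fun i hi _ => by
          have := hall _ (hmem i (hIm i hi).1 (hIm i hi).2); linarith)
      rw [sum_pair (by norm_num), sum_sub_distrib, ← mul_sum, sum_const, nsmul_eq_mul, hIc] at e1
      push_cast at e1
      nlinarith
  have hsz : 2 * (p : ℤ) ≤ s + 1 := by exact_mod_cast hs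
  have hpz : (7 : ℤ) ≤ p := by exact_mod_cast hp
  nlinarith

end SC

namespace SC
open Finset

lemma natCast_add_sub {p : ℕ} [Fact p.Prime] (q : ℕ) (h : p ≤ q) :
    ((q - p : ℕ) : ZMod p) = (q : ZMod p) := by
  rw [Nat.cast_sub h]; simp

lemma arith1 (p s m u : ℕ) (hp : 7 ≤ p) (hs : 2 * p ≤ s + 1) (hmu : 3 * s ≤ u + 1)
    (hmw : m * u + s ≤ 2 * p ^ 2 + 3) : 3 * m < p := by
  by_contra hc
  rw [not_lt] at hc
  zify at *
  have a1 : (m : ℤ) * (3 * s - 1) ≤ m * u :=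
    mul_le_mul_of_nonneg_left (by linarith) (by positivity)
  have a2 : (p : ℤ) * (3 * s - 1) ≤ 3 * m * (3 * s - 1) :=
    mul_le_mul_of_nonneg_right (by linarith) (by linarith)
  nlinarith

set_option maxHeartbeats 1000000 in
lemma core {p : ℕ} [Fact p.Prime] {n : ZMod p → ℕ} (h : LP p n) (hp : 7 ≤ p) (h0 : n 0 = 0)
    (s : ℕ) (hw : ∑ x, n x + s = 2 * p ^ 2 + 3) (hs : 2 * p ≤ s + 1)
    (hm1 : n (-1) ≠ 0) (hmin : ∀ x, n x ≠ 0 → n (-1) ≤ n x)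
    (hcard : 3 ≤ (univ.filter (fun x => n x ≠ 0)).card) :
    ∀ x, x ≠ 0 → n x ≠ 0 := by
  have hsym : ∀ a, n a ≠ 0 → n (-a) ≠ 0 := by
    intro a ha
    have := step1 h hp h0 s hw a ha
    omega
  have h1 : n 1 ≠ 0 := by simpa using hsym _ hm1
  set Y : ZMod p → Prop := fun x => x = 0 ∨ n x ≠ 0 with hY
  have hYs : ∀ x, Y x → Y (-x) := by
    rintro x (rfl | hx)
    · left; simp
    · right; exact hsym x hx
  have hYs' : ∀ x, Y (-x) → Y x := by
    intro x hx; simpa using hYs _ hx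
  by_contra hcon
  have hall : ¬ ∀ x, Y x := by
    intro hh; apply hcon; intro x hx
    exact (hh x).resolve_left hx
  have hB : ∀ x, x ∈ Bs n ↔ Y x ∧ ¬ Y (x + 1) := by
    intro x
    have e : n (-1 - x) = 0 ↔ n (x + 1) = 0 := by
      constructor
      · intro h'; by_contra hc; apply hsym _ hc; rw [← h']; congr 1; ring
      · intro h'; by_contra hc; apply hsym _ hc; rw [← h']; congr 1; ring
    have e2 : x + 1 = 0 ↔ x = -1 := by
      constructor
      · intro h'; linear_combination h'
      · intro h'; linear_combination h'
    simp only [Bs, mem_filter, mem_univ, true_and, e, hY, not_or, e2, not_not]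
    constructor
    · rintro ⟨a, b, c⟩; exact ⟨Or.inr a, b, c⟩
    · rintro ⟨a, b, c⟩
      refine ⟨?_, b, c⟩
      rcases a with rfl | a
      · simp at c; exact absurd c h1
      · exact a
  have hBn : ∀ x ∈ Bs n, n x ≠ 0 := by
    intro x hx; simp only [Bs, mem_filter] at hx; exact hx.2.1
  have hBsum : (Bs n).card * n (-1) ≤ ∑ x ∈ Bs n, n x := by
    rw [← smul_eq_mul]
    exact Finset.card_nsmul_le_sum _ _ _ (fun x hx => hmin x (hBn x hx))
  have hJ3 := stepJ3 h hp h0 s hw h1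
  have hB3 : (Bs n).card ≤ 2 := by
    by_contra hc
    have : 3 * n (-1) ≤ (Bs n).card * n (-1) := Nat.mul_le_mul_right _ (by omega)
    omega
  -- the central chain
  obtain ⟨k, hk1, hk2⟩ := exists_max (fun j => Y (j : ZMod p)) (by left; simp) (by
    by_contra hc
    push Not at hc
    apply hall
    intro x
    have := hc x.val
    rwa [ZMod.natCast_zmod_val] at this)
  have hkpos : 1 ≤ k := by
    by_contra hc
    have : k = 0 := by omega
    subst this
    apply hk2; right; simpa using h1
  have hk2' : ¬ Y ((k : ZMod p) + 1) := by simpa using hk2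
  have hkB : (k : ZMod p) ∈ Bs n := (hB _).2 ⟨hk1 k le_rfl, hk2'⟩
  have h2k : 2 * k + 1 < p := by
    by_contra hc
    by_cases hkp : p ≤ k + 1
    · have := hk1 (k + 1 - p) (by omega)
      rw [natCast_add_sub _ hkp] at this
      exact hk2 this
    · have := hk1 (p - (k + 1)) (by omega)
      rw [Nat.cast_sub (by omega)] at this
      apply hk2
      apply hYs'
      simpa using this
  -- any point j of the natural chain that is in Bs is k
  have hnatB : ∀ j : ℕ, (j : ZMod p) ∈ Bs n → j ≤ k → j = k := by
    intro j hj hjk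
    by_contra hc
    have := hk1 (j + 1) (by omega)
    apply ((hB _).1 hj).2
    simpa using this
  have hnegB : ∀ j : ℕ, -(j : ZMod p) ∈ Bs n → j ≤ k → False := by
    intro j hj hjk
    rcases Nat.eq_zero_or_pos j with rfl | hpos
    · have := hnatB 0 (by simpa using hj) (by omega)
      omega
    · have := hYs _ (hk1 (j - 1) (by omega))
      apply ((hB _).1 hj).2
      rw [Nat.cast_sub (by omega)] at this
      convert this using 1
      push_cast; ring
  -- chain downwards from z
  have hdown : ∀ z, Y z → ∃ q : ℕ, (∀ j ≤ q, Y (z - (j : ZMod p))) ∧ ¬ Y (z - (q : ZMod p) - 1) := by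
    intro z hz
    obtain ⟨q, h1, h2⟩ := exists_max (fun j => Y (z - (j : ZMod p))) (by simpa using hz) (by
      by_contra hc
      push Not at hc
      apply hall
      intro x
      have := hc (z - x).val
      rw [ZMod.natCast_zmod_val] at this
      simpa using this)
    refine ⟨q, h1, ?_⟩
    intro h'; apply h2
    convert h' using 1
    push_cast; ring
  have hYcard : ∀ T : Finset (ZMod p), (∀ x ∈ T, Y x) →
      T.card ≤ (univ.filter (fun x => n x ≠ 0)).card + 1 := by
    intro T hT
    have : T ⊆ insert 0 (univ.filter (fun x => n x ≠ 0)) := by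
      intro x hx
      rcases hT x hx with rfl | hx
      · simp
      · simp [hx]
    exact (card_le_card this).trans (card_insert_le _ _)
  set m := (univ.filter (fun x => n x ≠ 0)).card with hm
  have hBpos : 1 ≤ (Bs n).card := card_pos.2 ⟨_, hkB⟩
  by_cases hone : (Bs n).card = 1
  · -- interval case
    have hBeq : ∀ x ∈ Bs n, x = k := by
      obtain ⟨b, hb⟩ := card_eq_one.1 hone
      intro x hx
      rw [hb, mem_singleton] at hx hkB
      rw [hx, hkB]
    have hYint : ∀ y, Y y → ∃ j : ℕ, j ≤ 2 * k ∧ y = (k : ZMod p) - j := by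
      intro y hy
      obtain ⟨q, hq1, hq2⟩ := hdown (-y) (hYs _ hy)
      have hqB : y + q ∈ Bs n := by
        rw [hB]
        constructor
        · apply hYs'
          convert hq1 q le_rfl using 1; ring
        · intro h'; apply hq2
          convert hYs _ h' using 1; ring
      have e := hBeq _ hqB
      refine ⟨q, ?_, by rw [← e]; ring⟩
      by_contra hc
      have h2 := hq1 (q - (2 * k + 1)) (by omega)
      rw [Nat.cast_sub (by omega)] at h2
      apply hk2'
      convert h2 using 1
      push_cast
      linear_combination e
    have hv : ∀ i : ℤ, |i| ≤ k → ((i : ZMod p)).valMinAbs = i := by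
      intro i hi
      rw [abs_le] at hi
      rw [ZMod.valMinAbs_spec]
      refine ⟨rfl, ?_⟩
      constructor <;> omega
    have hXiff : ∀ x, n x ≠ 0 ↔ x ≠ 0 ∧ |x.valMinAbs| ≤ k := by
      intro x
      constructor
      · intro hx
        refine ⟨by rintro rfl; exact hx h0, ?_⟩
        obtain ⟨j, hj, rfl⟩ := hYint x (Or.inr hx)
        have := hv ((k : ℤ) - j) (by rw [abs_le]; constructor <;> omega)
        push_cast at this
        rw [this, abs_le]; constructor <;> omega
      · rintro ⟨hx, hxk⟩
        rw [abs_le] at hxk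
        have h2 : Y x := by
          rw [← ZMod.coe_valMinAbs x]
          rcases Int.natAbs_eq x.valMinAbs with h3 | h3
          · rw [h3]
            have := hk1 x.valMinAbs.natAbs (by omega)
            simpa using this
          · rw [h3]
            have := hYs _ (hk1 x.valMinAbs.natAbs (by omega))
            simpa using this
        exact h2.resolve_left hx
    have hk2 : 2 ≤ k := by
      by_contra hc
      have hk1 : k = 1 := by omega
      have hsub : (univ.filter (fun x => n x ≠ 0)) ⊆ {1, -1} := by
        intro x hx
        rw [mem_filter] at hx
        have h3 := (hXiff x).1 hx.2
        rw [abs_le, hk1] at h3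
        have hz : x.valMinAbs ≠ 0 := by rw [Ne, ZMod.valMinAbs_eq_zero]; exact h3.1
        have h5 : x.valMinAbs = 1 ∨ x.valMinAbs = -1 := by omega
        rw [mem_insert, mem_singleton, ← ZMod.coe_valMinAbs x]
        rcases h5 with h5 | h5
        · left; rw [h5]; simp
        · right; rw [h5]; simp
      have := (card_le_card hsub).trans card_le_two
      omega
    exact case1 h hp h0 s hw hs k h2k hk2 hXiff hmin
  · have htwo : (Bs n).card = 2 := by omega
    obtain ⟨z, hzB, hzk⟩ : ∃ z ∈ Bs n, z ≠ k := exists_mem_ne (by omega) _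
    have hBeq : ∀ x ∈ Bs n, x = k ∨ x = z := by
      intro x hx
      by_contra hc
      push Not at hc
      have hsub : ({x, (k : ZMod p), z} : Finset (ZMod p)) ⊆ Bs n := by
        intro y hy; simp at hy; rcases hy with rfl | rfl | rfl <;> assumption
      have := card_le_card hsub
      rw [card_eq_three.2 ⟨x, (k : ZMod p), z, hc.1, hc.2, hzk.symm, rfl⟩] at this
      omega
    obtain ⟨q, hq1, hq2⟩ := hdown z ((hB z).1 hzB).1
    have hz1 : ¬ Y (z + 1) := ((hB z).1 hzB).2
    -- z is not a natural number in the chain ranges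
    have hznat : ∀ j : ℕ, j ≤ q → z ≠ (j : ZMod p) := by
      intro j hj hzj
      by_cases hjk : j ≤ k
      · have := hnatB j (hzj ▸ hzB) hjk
        rw [this] at hzj; exact hzk hzj
      · have := hq1 (j - k - 1) (by omega)
        apply hk2'
        rw [Nat.cast_sub (by omega), Nat.cast_sub (by omega)] at this
        convert this using 1
        rw [hzj]; push_cast; ring
    have hqB : (q : ZMod p) - z ∈ Bs n := by
      rw [hB]
      constructor
      · apply hYs'; convert hq1 q le_rfl using 1; ring
      · intro h'; apply hq2; convert hYs _ h' using 1; ring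
    have h2z : 2 * z = q := by
      rcases hBeq _ hqB with e | e
      · exfalso
        by_cases hqk : k ≤ q
        · apply hznat (q - k) (by omega)
          rw [Nat.cast_sub hqk, ← e]; ring
        · apply hnegB (k - q) _ (by omega)
          convert hzB using 1
          rw [Nat.cast_sub (by omega), ← e]; ring
      · linear_combination -e
    have hqp : q + 1 < p := by
      by_contra hc
      have := hq1 (p - 1) (by omega)
      apply hz1
      rw [Nat.cast_sub (by omega)] at this
      simpa using this
    have hinj : ∀ i j : ℕ, i < p → j < p → (i : ZMod p) = j → i = j := by
      intro i j hi hj hij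
      have := congrArg ZMod.val hij
      rwa [ZMod.val_natCast_of_lt hi, ZMod.val_natCast_of_lt hj] at this
    have hqm : q + 2 ≤ m + 1 := by
      have hc := hYcard (insert 0 ((range (q + 1)).image (fun j : ℕ => z - (j : ZMod p)))) (by
        intro x hx
        rw [mem_insert, mem_image] at hx
        rcases hx with rfl | ⟨j, hj, rfl⟩
        · left; rfl
        · rw [mem_range] at hj; exact hq1 j (by omega))
      rw [card_insert_of_notMem, card_image_of_injOn, card_range] at hc
      · omega
      · intro i hi j hj hij
        simp only [coe_range, Set.mem_Iio] at hi hj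
        apply hinj i j (by omega) (by omega)
        simpa using hij
      · intro h'
        rw [mem_image] at h'
        obtain ⟨j, hj, hj'⟩ := h'
        rw [mem_range] at hj
        exact hznat j (by omega) (by linear_combination hj')
    have hkm : 2 * k + 2 ≤ m + 1 := by
      have hc := hYcard (insert z ((range (2 * k + 1)).image (fun j : ℕ => (k : ZMod p) - (j : ZMod p)))) (by
        intro x hx
        rw [mem_insert, mem_image] at hx
        rcases hx with rfl | ⟨j, hj, rfl⟩
        · exact ((hB _).1 hzB).1
        · rw [mem_range] at hj
          by_cases hjk : j ≤ k
          · have := hk1 (k - j) (by omega)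
            rwa [Nat.cast_sub hjk] at this
          · have := hYs _ (hk1 (j - k) (by omega))
            rw [Nat.cast_sub (by omega)] at this
            convert this using 1; ring)
      rw [card_insert_of_notMem, card_image_of_injOn, card_range] at hc
      · omega
      · intro i hi j hj hij
        simp only [coe_range, Set.mem_Iio] at hi hj
        apply hinj i j (by omega) (by omega)
        simpa using hij
      · intro h'
        rw [mem_image] at h'
        obtain ⟨j, hj, hj'⟩ := h'
        rw [mem_range] at hj
        by_cases hjk : j ≤ k
        · have e : ((k - j : ℕ) : ZMod p) = z := by rw [Nat.cast_sub hjk]; exact hj'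
          have := hnatB (k - j) (e ▸ hzB) (by omega)
          rw [this] at e; exact hzk e.symm
        · apply hnegB (j - k) _ (by omega)
          convert hzB using 1
          rw [Nat.cast_sub (by omega), ← hj']; ring
    have hmu : 3 * s ≤ n (-1) + 1 := by rw [htwo] at hBsum; omega
    have hmw : m * n (-1) ≤ ∑ x, n x := by
      rw [hm, ← smul_eq_mul]
      refine (Finset.card_nsmul_le_sum _ n _ (fun x hx => hmin x (by simpa using hx))).trans ?_
      exact Finset.sum_le_sum_of_subset (subset_univ _)
    have h3m : 3 * m < p := arith1 p s m (n (-1)) hp hs hmu (by omega)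
    have hJ4 := stepJ4 h hp h0 s hw h1 (by
      intro a ha b hb c hc habc
      have no : ∀ N : ℕ, 0 < N → N < p → (N : ZMod p) ≠ 0 := by
        intro N h1 h2 h3
        rw [ZMod.natCast_eq_zero_iff] at h3
        exact absurd (Nat.le_of_dvd h1 h3) (by omega)
      have d : ∀ x ∈ Bs n, ∃ N : ℕ, N + 1 ≤ m ∧ 2 * x = (N : ZMod p) := by
        intro x hx
        rcases hBeq x hx with rfl | rfl
        · exact ⟨2 * k, by omega, by push_cast; ring⟩
        · exact ⟨q, by omega, h2z⟩
      obtain ⟨N1, u1, v1⟩ := d a ha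
      obtain ⟨N2, u2, v2⟩ := d b hb
      obtain ⟨N3, u3, v3⟩ := d c hc
      apply no (N1 + N2 + N3 + 2) (by omega) (by omega)
      push_cast
      rw [← v1, ← v2, ← v3]
      linear_combination 2 * habc)
    rw [htwo] at hBsum
    omega

lemma partI {p : ℕ} [Fact p.Prime] {n : ZMod p → ℕ} (h : LP p n) (hp : 7 ≤ p) (h0 : n 0 = 0)
    (s : ℕ) (hw : ∑ x, n x + s = 2 * p ^ 2 + 3) (hs : 2 * p ≤ s + 1)
    (hcard : 3 ≤ (univ.filter (fun x => n x ≠ 0)).card) :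
    ∀ x, x ≠ 0 → s ≤ n x := by
  have hne : (univ.filter (fun x => n x ≠ 0)).Nonempty := by
    rw [← card_pos]; omega
  obtain ⟨b, hb, hbmin⟩ := exists_min_image _ n hne
  rw [mem_filter] at hb
  have hb0 : b ≠ 0 := by rintro rfl; exact hb.2 h0
  have hnb : -b ≠ 0 := neg_ne_zero.2 hb0
  have hall := core (h.scale (-b) hnb) hp (by simpa using h0) s
    (by rw [← hw]; congr 1; exact Fintype.sum_equiv (Equiv.mulLeft₀ (-b) hnb) _ _ (by intro x; simp))
    hs (by simpa using hb.2) (by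
      intro x hx
      have := hbmin (-b * x) (by simpa using hx)
      simpa using this) (by
      refine hcard.trans (le_of_eq ?_)
      symm
      apply card_bij (fun x _ => -b * x)
      · intro x hx; simpa using hx
      · intro x _ y _ hxy; exact mul_left_cancel₀ hnb hxy
      · intro y hy
        refine ⟨(-b)⁻¹ * y, ?_, by field_simp⟩
        rw [mem_filter] at hy ⊢
        refine ⟨mem_univ _, ?_⟩
        show n (-b * ((-b)⁻¹ * y)) ≠ 0
        rw [mul_inv_cancel_left₀ hnb]; exact hy.2)
  intro x hx
  have h1 := hall ((-b)⁻¹ * (-x)) (mul_ne_zero (inv_ne_zero hnb) (neg_ne_zero.2 hx))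
  rw [mul_inv_cancel_left₀ hnb] at h1
  have := step1 h hp h0 s hw _ h1
  simpa using this

end SC

namespace SC
open Finset
open scoped Classical

/-- Concrete form of the situation: finite incidence structure with a code word. -/
structure Geo (p : ℕ) [Fact p.Prime] {Pt Ln : Type} [Fintype Pt] [Fintype Ln]
    (R : Pt → Ln → Prop) (c : Pt → ZMod p) : Prop where
  line : ∀ P Q : Pt, P ≠ Q → ∃! l : Ln, R P l ∧ R Q l
  deg : ∀ P : Pt, (univ.filter (fun l => R P l)).card = p ^ 2 + 1
  code : ∀ l : Ln, ∑ Q ∈ univ.filter (fun Q => R Q l), c Q = 0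

noncomputable section

variable {p : ℕ} [Fact p.Prime] {Pt Ln : Type} [Fintype Pt] [Fintype Ln]

/-- lines through a point -/
def thr (R : Pt → Ln → Prop) (P : Pt) : Finset Ln := univ.filter (fun l => R P l)

/-- support points on a line -/
def pts (R : Pt → Ln → Prop) (c : Pt → ZMod p) (l : Ln) : Finset Pt :=
  univ.filter (fun Q => R Q l ∧ c Q ≠ 0)

/-- multiset of colours on a line -/
def T (R : Pt → Ln → Prop) (c : Pt → ZMod p) (l : Ln) : Multiset (ZMod p) :=
  (pts R c l).val.map c

/-- number of points of each nonzero colour -/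
def num (c : Pt → ZMod p) (x : ZMod p) : ℕ :=
  if x = 0 then 0 else (univ.filter (fun Q => c Q = x)).card

variable {R : Pt → Ln → Prop} {c : Pt → ZMod p}

lemma T_zero (l : Ln) : (0 : ZMod p) ∉ T R c l := by
  simp [T, pts]

lemma T_mem {l : Ln} {y : ZMod p} : y ∈ T R c l ↔ y ≠ 0 ∧ ∃ Q, R Q l ∧ c Q = y := by
  simp only [T, pts, Multiset.mem_map, mem_val, mem_filter, mem_univ, true_and]
  constructor
  · rintro ⟨Q, ⟨h1, h2⟩, rfl⟩; exact ⟨h2, Q, h1, rfl⟩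
  · rintro ⟨h1, Q, h2, rfl⟩; exact ⟨Q, ⟨h2, h1⟩, rfl⟩

lemma T_sum (g : Geo p R c) (l : Ln) : (T R c l).sum = 0 := by
  have h1 : (T R c l).sum = ∑ Q ∈ pts R c l, c Q := rfl
  rw [h1, ← g.code l, pts, ← filter_filter, sum_filter_ne_zero]

lemma T_count (l : Ln) (y : ZMod p) (hy : y ≠ 0) :
    (T R c l).count y = (univ.filter (fun Q => c Q = y ∧ R Q l)).card := by
  rw [T, Multiset.count_map, ← Finset.filter_val, pts]
  change Finset.card _ = _
  congr 1
  ext Q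
  simp only [mem_filter, mem_univ, true_and]
  constructor
  · rintro ⟨⟨h1, h2⟩, rfl⟩; exact ⟨rfl, h1⟩
  · rintro ⟨rfl, h⟩; exact ⟨⟨h, hy⟩, rfl⟩

lemma T_erase (l : Ln) (P : Pt) (hP : R P l) (hc : c P ≠ 0) :
    (T R c l).erase (c P) = ((pts R c l).erase P).val.map c := by
  have : P ∈ pts R c l := by simp [pts, hP, hc]
  rw [T, Finset.erase_val, Multiset.map_erase_of_mem]
  exact this

lemma flag (g : Geo p R c) (P : Pt) (hc : c P ≠ 0) {A : Type*} [AddCommMonoid A]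
    (u : ZMod p → A) :
    ∑ l ∈ thr R P, (((T R c l).erase (c P)).map u).sum + u (c P) = ∑ x, num c x • u x := by
  set S : Finset Pt := univ.filter (fun Q => c Q ≠ 0) with hS
  have hPS : P ∈ S := by simp [hS, hc]
  have e1 : ∑ l ∈ thr R P, (((T R c l).erase (c P)).map u).sum
      = ∑ l ∈ thr R P, ∑ Q ∈ S.erase P, if R Q l then u (c Q) else 0 := by
    apply sum_congr rfl
    intro l hl
    have hPl : R P l := by simpa [thr] using hl
    rw [T_erase l P hPl hc, Multiset.map_map]
    change ∑ Q ∈ (pts R c l).erase P, u (c Q) = _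
    rw [← sum_filter]
    apply sum_congr _ (fun _ _ => rfl)
    ext Q
    simp only [pts, hS, mem_erase, mem_filter, mem_univ, true_and]
    tauto
  have e2 : ∑ Q ∈ S.erase P, ∑ l ∈ thr R P, (if R Q l then u (c Q) else 0)
      = ∑ Q ∈ S.erase P, u (c Q) := by
    apply sum_congr rfl
    intro Q hQ
    have hne : P ≠ Q := fun h => (mem_erase.1 hQ).1 h.symm
    obtain ⟨l, ⟨h1, h2⟩, huniq⟩ := g.line P Q hne
    rw [sum_eq_single l]
    · simp [h2]
    · intro l' hl' hne'
      rw [if_neg]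
      intro h3
      exact hne' (huniq l' ⟨by simpa [thr] using hl', h3⟩)
    · intro h'; exact absurd (by simpa [thr] using h1) h'
  rw [e1, sum_comm, e2, sum_erase_add _ _ hPS]
  have e3 := sum_fiberwise_of_maps_to (s := S) (t := (univ : Finset (ZMod p))) (g := c)
    (fun _ _ => mem_univ _) (fun Q => u (c Q))
  rw [← e3]
  apply sum_congr rfl
  intro x _
  rw [sum_congr rfl (g := fun _ => u x) (by intro Q hQ; rw [(mem_filter.1 hQ).2]), sum_const]
  congr 1
  rw [num, hS]
  split_ifs with hx
  · rw [card_eq_zero, filter_eq_empty_iff]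
    intro Q hQ; rw [mem_filter] at hQ; rw [hx]; exact hQ.2
  · congr 1
    ext Q
    simp only [mem_filter, mem_univ, true_and]
    constructor
    · exact fun h => h.2
    · intro h; exact ⟨by rw [h]; exact hx, h⟩

lemma M_sum (g : Geo p R c) (P : Pt) (hc : c P ≠ 0) (l : Ln) (hl : l ∈ thr R P) :
    ((T R c l).erase (c P)).sum = - c P := by
  have hm : c P ∈ T R c l := T_mem.2 ⟨hc, P, by simpa [thr] using hl, rfl⟩
  have := T_sum g l
  rw [← Multiset.cons_erase hm, Multiset.sum_cons] at this
  linear_combination this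

lemma num_pos_iff (x : ZMod p) : num c x ≠ 0 ↔ x ≠ 0 ∧ ∃ Q, c Q = x := by
  unfold num
  split_ifs with h
  · simp [h]
  · rw [card_ne_zero]
    constructor
    · rintro ⟨Q, hQ⟩; exact ⟨h, Q, by simpa using hQ⟩
    · rintro ⟨_, Q, hQ⟩; exact ⟨Q, by simpa using hQ⟩

lemma geoLP (g : Geo p R c) : LP p (num c) := by
  intro a ha u hu
  obtain ⟨ha0, P, rfl⟩ := (num_pos_iff a).1 ha
  have h1 := flag g P ha0 u
  simp only [nsmul_eq_mul] at h1
  rw [← h1]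
  have h2 : (thr R P).card • (1 : ℚ) ≤ ∑ l ∈ thr R P, (((T R c l).erase (c P)).map u).sum := by
    apply card_nsmul_le_sum
    intro l hl
    apply hu _ _ (M_sum g P ha0 l hl)
    intro x hx
    obtain ⟨h3, Q, _, h4⟩ := T_mem.1 (Multiset.mem_of_mem_erase hx)
    exact (num_pos_iff x).2 ⟨h3, Q, h4⟩
  have h3 : (thr R P).card = p ^ 2 + 1 := g.deg P
  rw [h3] at h2
  simp at h2
  linarith

end
end SC

namespace SC
open Finset
open scoped Classical

noncomputable section
variable {p : ℕ} [Fact p.Prime] {Ln : Type}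

def Ee (L : Finset Ln) (M : Ln → Multiset (ZMod p)) : ℕ := ∑ l ∈ L, ((M l).card - 2)
def Gg (L : Finset Ln) (M : Ln → Multiset (ZMod p)) (y : ZMod p) : ℕ :=
  ∑ l ∈ L.filter (fun l => 3 ≤ (M l).card), (M l).count y
def Aa (L : Finset Ln) (M : Ln → Multiset (ZMod p)) (y : ZMod p) : ℕ :=
  ∑ l ∈ L.filter (fun l => ¬ 3 ≤ (M l).card), (M l).count y

lemma loc_tot (L : Finset Ln) (M : Ln → Multiset (ZMod p)) (y : ZMod p) :
    ∑ l ∈ L, (M l).count y = Aa L M y + Gg L M y := by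
  rw [Aa, Gg, add_comm, sum_filter_add_sum_filter_not]

lemma small_cases {x : ZMod p} (hx : x ≠ 0) {N : Multiset (ZMod p)} (hs : N.sum = x)
    (h : ¬ 3 ≤ N.card) : N = {x} ∨ ∃ b d, N = {b, d} ∧ b + d = x := by
  have : N.card = 0 ∨ N.card = 1 ∨ N.card = 2 := by omega
  rcases this with h | h | h
  · rw [Multiset.card_eq_zero] at h; subst h; simp at hs; exact absurd hs.symm hx
  · obtain ⟨b, rfl⟩ := Multiset.card_eq_one.1 h
    left; simp at hs; rw [hs]
  · obtain ⟨b, d, rfl⟩ := Multiset.card_eq_two.1 h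
    right; exact ⟨b, d, rfl, by simpa using hs⟩

lemma count_pair (y b d : ZMod p) : ({b, d} : Multiset (ZMod p)).count y
    = (if y = b then 1 else 0) + (if y = d then 1 else 0) := by
  rw [Multiset.insert_eq_cons, Multiset.count_cons, Multiset.count_singleton, add_comm]

variable {L : Finset Ln} {M : Ln → Multiset (ZMod p)} {x : ZMod p}

lemma loc_x (hx : x ≠ 0) (hs : ∀ l ∈ L, (M l).sum = x) (h0 : ∀ l ∈ L, (0 : ZMod p) ∉ M l) :
    Aa L M x = (L.filter (fun l => (M l).card = 1)).card := by
  rw [Aa, sum_filter, card_filter]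
  apply sum_congr rfl
  intro l hl
  by_cases h3 : 3 ≤ (M l).card
  · rw [if_neg (by simpa using h3), if_neg (by omega)]
  · rw [if_pos h3]
    rcases small_cases hx (hs l hl) h3 with h | ⟨b, d, h, hbd⟩
    · rw [h]; simp
    · have hb := h0 l hl
      rw [h] at hb ⊢
      simp at hb
      rw [count_pair, if_neg, if_neg]
      · simp
      · rintro rfl; apply hb.1; symm; linear_combination hbd
      · rintro rfl; apply hb.2; symm; linear_combination hbd

lemma loc_E (hx : x ≠ 0) (hs : ∀ l ∈ L, (M l).sum = x) :
    ∑ l ∈ L, (M l).card + (L.filter (fun l => (M l).card = 1)).card = 2 * L.card + Ee L M := by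
  rw [Ee, card_filter, ← sum_add_distrib, mul_comm, ← smul_eq_mul, ← sum_const, ← sum_add_distrib]
  apply sum_congr rfl
  intro l hl
  have : (M l).card ≠ 0 := by
    intro h; rw [Multiset.card_eq_zero] at h
    have := hs l hl; rw [h] at this; simp at this; exact hx this.symm
  split_ifs <;> omega

lemma loc_bal (hx : x ≠ 0) (hs : ∀ l ∈ L, (M l).sum = x) (y : ZMod p) (hy : y ≠ 0) (hyx : y ≠ x) :
    Aa L M y = Aa L M (x - y) := by
  rw [Aa, Aa]
  apply sum_congr rfl
  intro l hl
  rw [mem_filter] at hl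
  rcases small_cases hx (hs l hl.1) hl.2 with h | ⟨b, d, h, hbd⟩
  · rw [h, Multiset.count_singleton, Multiset.count_singleton, if_neg hyx, if_neg]
    intro h'; apply hy; linear_combination -h'
  · rw [h, count_pair, count_pair, add_comm]
    have e1 : y = d ↔ x - y = b := by
      constructor <;> intro h'
      · linear_combination -hbd - h'
      · linear_combination -hbd - h'
    have e2 : y = b ↔ x - y = d := by
      constructor <;> intro h'
      · linear_combination -hbd - h'
      · linear_combination -hbd - h'
    simp only [e1, e2]

lemma loc_even (hx : x ≠ 0) (hs : ∀ l ∈ L, (M l).sum = x) (y : ZMod p) (hy : y ≠ 0)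
    (hyy : y + y = x) : ∃ r, Aa L M y = 2 * r := by
  rw [← dvd_iff_exists_eq_mul_right, Aa]
  apply dvd_sum
  intro l hl
  rw [mem_filter] at hl
  rcases small_cases hx (hs l hl.1) hl.2 with h | ⟨b, d, h, hbd⟩
  · rw [h, Multiset.count_singleton, if_neg]
    · simp
    · rintro rfl; apply hy; linear_combination hyy
  · rw [h, count_pair]
    have e1 : y = d ↔ y = b := by
      constructor <;> intro h'
      · linear_combination hyy - hbd - h'
      · linear_combination hyy - hbd - h'
    simp only [e1]
    split_ifs <;> simp

lemma Ee_zero (h : Ee L M = 0) : ∀ l ∈ L, (M l).card ≤ 2 := by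
  intro l hl
  rw [Ee, sum_eq_zero_iff] at h
  have := h l hl
  omega

lemma Gg_zero_of (h : Ee L M = 0) (y : ZMod p) : Gg L M y = 0 := by
  rw [Gg, filter_eq_empty_iff.2, sum_empty]
  intro l hl
  have := Ee_zero h l hl
  omega

/-- excess one: unique long line -/
lemma Ee_one (h : Ee L M = 1) : ∃ l ∈ L, (M l).card = 3 ∧ (∀ l' ∈ L, l' ≠ l → (M l').card ≤ 2) ∧
    ∀ y, Gg L M y = (M l).count y := by
  have hex : ∃ l ∈ L, 3 ≤ (M l).card := by
    by_contra hc
    push Not at hc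
    have : Ee L M = 0 := by
      rw [Ee, sum_eq_zero_iff]; intro l hl; have := hc l hl; omega
    omega
  obtain ⟨l, hl, hl3⟩ := hex
  have hsp : (M l).card - 2 + ∑ l' ∈ L.erase l, ((M l').card - 2) = 1 := by
    rw [← h, Ee, add_sum_erase L (fun l => (M l).card - 2) hl]
  have hz : ∑ l' ∈ L.erase l, ((M l').card - 2) = 0 := by omega
  rw [sum_eq_zero_iff] at hz
  have hr : ∀ l' ∈ L, l' ≠ l → (M l').card ≤ 2 := by
    intro l' h1 h2
    have := hz l' (mem_erase.2 ⟨h2, h1⟩)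
    omega
  refine ⟨l, hl, by omega, hr, ?_⟩
  intro y
  have : L.filter (fun l => 3 ≤ (M l).card) = {l} := by
    ext l'
    rw [mem_filter, mem_singleton]
    constructor
    · rintro ⟨h1, h2⟩
      by_contra hne
      have := hr l' h1 hne
      omega
    · rintro rfl; exact ⟨hl, hl3⟩
  rw [Gg, this, sum_singleton]

/-- two long lines with excess at most two -/
lemma Ee_two (h : Ee L M ≤ 2) (l l' : Ln) (hl : l ∈ L) (hl' : l' ∈ L) (hne : l ≠ l')
    (h3 : 3 ≤ (M l).card) (h3' : 3 ≤ (M l').card) :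
    ∀ y, Gg L M y = (M l).count y + (M l').count y := by
  have hl2 : l' ∈ L.erase l := mem_erase.2 ⟨hne.symm, hl'⟩
  have hsp : (M l).card - 2 + ((M l').card - 2 + ∑ a ∈ (L.erase l).erase l', ((M a).card - 2)) ≤ 2 := by
    rw [add_sum_erase (L.erase l) (fun l => (M l).card - 2) hl2,
      add_sum_erase L (fun l => (M l).card - 2) hl]
    exact h
  have hz : ∑ a ∈ (L.erase l).erase l', ((M a).card - 2) = 0 := by omega
  rw [sum_eq_zero_iff] at hz
  intro y
  have : L.filter (fun l => 3 ≤ (M l).card) = {l, l'} := by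
    ext a
    rw [mem_filter, mem_insert, mem_singleton]
    constructor
    · rintro ⟨h1, h2⟩
      by_contra hc
      push Not at hc
      have := hz a (mem_erase.2 ⟨hc.2, mem_erase.2 ⟨hc.1, h1⟩⟩)
      omega
    · rintro (rfl | rfl)
      · exact ⟨hl, h3⟩
      · exact ⟨hl', h3'⟩
  rw [Gg, this, sum_pair hne]

lemma Ee_ge_two (l l' : Ln) (hl : l ∈ L) (hl' : l' ∈ L) (hne : l ≠ l')
    (h3 : 3 ≤ (M l).card) (h3' : 3 ≤ (M l').card) : 2 ≤ Ee L M := by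
  have hl2 : l' ∈ L.erase l := mem_erase.2 ⟨hne.symm, hl'⟩
  have : (M l).card - 2 + ((M l').card - 2 + ∑ a ∈ (L.erase l).erase l', ((M a).card - 2)) = Ee L M := by
    rw [add_sum_erase (L.erase l) (fun l => (M l).card - 2) hl2,
      add_sum_erase L (fun l => (M l).card - 2) hl, Ee]
  omega

end

noncomputable section
variable {p : ℕ} [Fact p.Prime] {Pt Ln : Type} [Fintype Pt] [Fintype Ln]
variable {R : Pt → Ln → Prop} {c : Pt → ZMod p}

/-- colours on a line apart from one point of colour `a` -/
def Mm (R : Pt → Ln → Prop) (c : Pt → ZMod p) (a : ZMod p) (l : Ln) : Multiset (ZMod p) :=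
  (T R c l).erase a

lemma Mm_zero (a : ZMod p) (l : Ln) : (0 : ZMod p) ∉ Mm R c a l :=
  fun h => T_zero l (Multiset.mem_of_mem_erase h)

lemma thr_mem (P : Pt) (hc : c P ≠ 0) (l : Ln) (hl : l ∈ thr R P) : c P ∈ T R c l :=
  T_mem.2 ⟨hc, P, by simpa [thr] using hl, rfl⟩

lemma Mm_card (P : Pt) (hc : c P ≠ 0) (l : Ln) (hl : l ∈ thr R P) :
    (T R c l).card = (Mm R c (c P) l).card + 1 := by
  rw [Mm, Multiset.card_erase_of_mem (thr_mem P hc l hl)]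
  have := Multiset.card_pos_iff_exists_mem.2 ⟨_, thr_mem P hc l hl⟩
  exact (Nat.succ_pred_eq_of_pos this).symm

lemma Mm_count (P : Pt) (hc : c P ≠ 0) (l : Ln) (hl : l ∈ thr R P) (y : ZMod p) :
    (T R c l).count y = (Mm R c (c P) l).count y + (if y = c P then 1 else 0) := by
  have := Multiset.cons_erase (thr_mem P hc l hl)
  conv_lhs => rw [← this]
  rw [Multiset.count_cons]; rfl

lemma flag_count (g : Geo p R c) (P : Pt) (hc : c P ≠ 0) (y : ZMod p) :
    num c y = ∑ l ∈ thr R P, (Mm R c (c P) l).count y + (if y = c P then 1 else 0) := by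
  have h := flag g P hc (fun x => if x = y then (1 : ℕ) else 0)
  have e : ∀ N : Multiset (ZMod p), (N.map (fun x => if x = y then (1 : ℕ) else 0)).sum = N.count y := by
    intro N
    induction N using Multiset.induction_on with
    | empty => simp
    | cons a N ih =>
      rw [Multiset.map_cons, Multiset.sum_cons, ih, Multiset.count_cons, add_comm]
      simp only [eq_comm]
  simp only [e] at h
  rw [sum_eq_single y (by intro b _ hb; simp [hb]) (by simp)] at h
  simp only [if_true, smul_eq_mul, mul_one] at h
  rw [← h]
  congr 1
  simp only [eq_comm]

lemma flag_card (g : Geo p R c) (P : Pt) (hc : c P ≠ 0) :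
    ∑ l ∈ thr R P, (Mm R c (c P) l).card + 1 = ∑ x, num c x := by
  have h := flag g P hc (fun _ => (1 : ℕ))
  simp at h
  rw [← h]; rfl

/-- Summary of the local structure at a point. -/
lemma local_main (g : Geo p R c) (hp2 : p ≠ 2) (s : ℕ) (hw : ∑ x, num c x + s = 2 * p ^ 2 + 3)
    (P : Pt) (x : ZMod p) (hx : x ≠ 0) (hP : c P = -x) :
    num c x = s + Ee (thr R P) (Mm R c (-x)) + Gg (thr R P) (Mm R c (-x)) x ∧
    (∀ y, num c y = Aa (thr R P) (Mm R c (-x)) y + Gg (thr R P) (Mm R c (-x)) y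
      + (if y = -x then 1 else 0)) ∧
    (∀ y, y ≠ 0 → y ≠ x → Aa (thr R P) (Mm R c (-x)) y = Aa (thr R P) (Mm R c (-x)) (x - y)) ∧
    (∀ y, y + y = x → ∃ r, Aa (thr R P) (Mm R c (-x)) y = 2 * r) := by
  have hc : c P ≠ 0 := by rw [hP]; exact neg_ne_zero.2 hx
  have hs : ∀ l ∈ thr R P, (Mm R c (-x) l).sum = x := by
    intro l hl
    have := M_sum g P hc l hl
    rw [hP] at this
    simpa [Mm] using this
  have h0 : ∀ l ∈ thr R P, (0 : ZMod p) ∉ Mm R c (-x) l := fun l _ => Mm_zero _ l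
  have hxx : x ≠ -x := by
    intro h'
    have h2 : (2 : ZMod p) * x = 0 := by linear_combination h'
    rcases mul_eq_zero.1 h2 with h3 | h3
    · have : ((2 : ℕ) : ZMod p) = 0 := by exact_mod_cast h3
      rw [ZMod.natCast_eq_zero_iff] at this
      exact hp2 ((Nat.prime_dvd_prime_iff_eq (Fact.out) Nat.prime_two).1 this)
    · exact hx h3
  have hn : ∀ y, num c y = Aa (thr R P) (Mm R c (-x)) y + Gg (thr R P) (Mm R c (-x)) y
      + (if y = -x then 1 else 0) := by
    intro y
    have := flag_count g P hc y
    rw [hP, loc_tot] at this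
    exact this
  refine ⟨?_, hn, fun y hy hyx => loc_bal hx hs y hy hyx, ?_⟩
  · have h1 := hn x
    rw [if_neg hxx, loc_x hx hs h0] at h1
    have h2 := loc_E hx hs
    have h3 := flag_card g P hc
    rw [hP] at h3
    have h4 : (thr R P).card = p ^ 2 + 1 := g.deg P
    rw [h4] at h2
    omega
  · intro y hyy
    apply loc_even hx hs y _ hyy
    rintro rfl; apply hx; rw [← hyy]; simp

end
end SC

namespace SC
open Finset
open scoped Classical

noncomputable section
variable {p : ℕ} [Fact p.Prime] {Pt Ln : Type} [Fintype Pt] [Fintype Ln]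
variable {R : Pt → Ln → Prop} {c : Pt → ZMod p}

lemma nz (hp : 7 ≤ p) (k : ℕ) (hk : 1 ≤ k) (hk6 : k ≤ 6) {x : ZMod p} (hx : x ≠ 0) :
    (k : ZMod p) * x ≠ 0 := by
  refine mul_ne_zero ?_ hx
  intro h
  rw [ZMod.natCast_eq_zero_iff] at h
  have := Nat.le_of_dvd (by omega) h
  omega

lemma exists_pt {y : ZMod p} (h : num c y ≠ 0) : ∃ P, c P = y := ((num_pos_iff y).1 h).2

lemma case_s (g : Geo p R c) (hp : 7 ≤ p) (s : ℕ) (hw : ∑ x, num c x + s = 2 * p ^ 2 + 3)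
    (hs : 2 * p ≤ s + 1) (hall : ∀ x, x ≠ 0 → s ≤ num c x) (x : ZMod p) (hx : x ≠ 0)
    (hn : num c x = s) :
    num c (-x) = num c (2 * x) + 1 ∧
    (∀ y, y ≠ 0 → y ≠ x → y ≠ -x → y ≠ 2 * x → num c (-x) ≤ num c y) ∧
    ∃ r, num c (-x) = 2 * r := by
  have hp2 : p ≠ 2 := by omega
  have n2 : 2 * x ≠ 0 := by simpa using nz hp 2 (by norm_num) (by norm_num) hx
  have n3 : 3 * x ≠ 0 := by simpa using nz hp 3 (by norm_num) (by norm_num) hx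
  have hpos : ∀ y, y ≠ 0 → num c y ≠ 0 := fun y hy => by have := hall y hy; omega
  have hnx : -x ≠ 0 := neg_ne_zero.2 hx
  have hE : ∀ P, c P = -x → Ee (thr R P) (Mm R c (-x)) = 0 := by
    intro P hP
    have := (local_main g hp2 s hw P x hx hP).1
    omega
  -- lines containing colour -x have at most three points
  have hT : ∀ l, -x ∈ T R c l → (T R c l).card ≤ 3 := by
    intro l hl
    obtain ⟨_, P, hPl, hP⟩ := T_mem.1 hl
    have hl' : l ∈ thr R P := by simpa [thr] using hPl
    have h1 := Ee_zero (hE P hP) l hl'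
    have h2 := Mm_card (c := c) P (by rw [hP]; exact hnx) l hl'
    rw [hP] at h2
    omega
  refine ⟨?_, ?_, ?_⟩
  · obtain ⟨P, hP⟩ := exists_pt (hpos _ hnx)
    obtain ⟨_, h2, h3, _⟩ := local_main g hp2 s hw P x hx hP
    have a1 := h2 (-x)
    have a2 := h2 (2 * x)
    have a3 := h3 (-x) hnx (by intro h; apply n2; linear_combination -h)
    rw [Gg_zero_of (hE P hP), if_pos rfl] at a1
    rw [Gg_zero_of (hE P hP), if_neg (by intro h; apply n3; linear_combination h)] at a2
    have e : x - -x = 2 * x := by ring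
    rw [e] at a3
    omega
  · intro z hz0 hzx hznx hz2x
    -- y = x - z
    set y := x - z with hy
    have hy0 : y ≠ 0 := by intro h; apply hzx; rw [hy] at h; linear_combination -h
    have hyx : y ≠ x := by intro h; apply hz0; rw [hy] at h; linear_combination -h
    have hynx : y ≠ -x := by intro h; apply hz2x; rw [hy] at h; linear_combination -h
    have hy2x : y ≠ 2 * x := by intro h; apply hznx; rw [hy] at h; linear_combination -h
    obtain ⟨Q, hQ⟩ := exists_pt (hpos y hy0)
    have hQ0 : c Q ≠ 0 := by rw [hQ]; exact hy0
    have f1 := flag_count g Q hQ0 (-x)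
    have f2 := flag_count g Q hQ0 z
    rw [if_neg (by rw [hQ]; exact hynx.symm)] at f1
    have : ∑ l ∈ thr R Q, (Mm R c (c Q) l).count (-x) ≤ ∑ l ∈ thr R Q, (Mm R c (c Q) l).count z := by
      apply sum_le_sum
      intro l hl
      by_cases hm : -x ∈ Mm R c (c Q) l
      · have hc3 := hT l (Multiset.mem_of_mem_erase hm)
        have hcc := Mm_card Q hQ0 l hl
        have hsum : (Mm R c (c Q) l).sum = - c Q := M_sum g Q hQ0 l hl
        rcases small_cases (neg_ne_zero.2 hQ0) hsum (by omega) with h | ⟨b, d, h, hbd⟩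
        · rw [h] at hm; simp at hm; rw [hQ] at hm; exact absurd hm.symm hyx
        · have key : ∀ b d : ZMod p, b = -x → b + d = - c Q → d = z ∧ -x ≠ d := by
            intro b d hb hbd
            have e : d = z := by rw [hQ, hy] at hbd; linear_combination hbd - hb
            exact ⟨e, by rw [e]; exact hznx.symm⟩
          rw [h, count_pair, count_pair]
          rw [h] at hm
          simp only [Multiset.insert_eq_cons, Multiset.mem_cons, Multiset.mem_singleton] at hm
          rcases hm with hm | hm
          · obtain ⟨e1, e2⟩ := key b d hm.symm hbd
            rw [if_pos hm, if_neg e2, if_pos e1.symm]; omega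
          · obtain ⟨e1, e2⟩ := key d b hm.symm (by rw [add_comm]; exact hbd)
            rw [if_pos hm, if_neg e2, if_pos e1.symm]; omega
      · rw [Multiset.count_eq_zero_of_notMem hm]; omega
    omega
  · obtain ⟨Q, hQ⟩ := exists_pt (hpos (2 * x) n2)
    have hQ0 : c Q ≠ 0 := by rw [hQ]; exact n2
    have f1 := flag_count g Q hQ0 (-x)
    rw [if_neg (by rw [hQ]; intro h; apply n3; linear_combination -h), add_zero] at f1
    rw [← dvd_iff_exists_eq_mul_right, f1]
    apply dvd_sum
    intro l hl
    by_cases hm : -x ∈ Mm R c (c Q) l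
    · have hc3 := hT l (Multiset.mem_of_mem_erase hm)
      have hcc := Mm_card Q hQ0 l hl
      have hsum : (Mm R c (c Q) l).sum = - c Q := M_sum g Q hQ0 l hl
      rcases small_cases (neg_ne_zero.2 hQ0) hsum (by omega) with h | ⟨b, d, h, hbd⟩
      · rw [h] at hm; simp at hm; rw [hQ] at hm
        exact absurd (show x = 0 by linear_combination -hm) hx
      · rw [h, count_pair]
        rw [h] at hm
        simp only [Multiset.insert_eq_cons, Multiset.mem_cons, Multiset.mem_singleton] at hm
        rw [hQ] at hbd
        have : -x = b ∧ -x = d := by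
          rcases hm with hm | hm
          · exact ⟨hm, by linear_combination -hbd - hm⟩
          · exact ⟨by linear_combination -hbd - hm, hm⟩
        rw [if_pos this.1, if_pos this.2]
    · rw [Multiset.count_eq_zero_of_notMem hm]; simp

lemma arith2 (p s v : ℕ) (hp : 7 ≤ p) (hs : 2 * p ≤ s + 1) (hv : s + 2 ≤ v) (hr : ∃ r, v = 2 * r)
    (h : (p : ℤ) * v - v - (v - s) - 1 + s ≤ 2 * p ^ 2 + 3) : False := by
  obtain ⟨r, hr⟩ := hr
  have h1 : p < 8 + 1 := by
    by_contra hc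
    zify at *
    nlinarith
  have : p = 7 ∨ p = 8 := by omega
  rcases this with rfl | rfl
  · norm_num at h
    omega
  · norm_num at h
    omega

lemma no_s (g : Geo p R c) (hp : 7 ≤ p) (s : ℕ) (hw : ∑ x, num c x + s = 2 * p ^ 2 + 3)
    (hs : 2 * p ≤ s + 1) (hall : ∀ x, x ≠ 0 → s ≤ num c x) (x : ZMod p) (hx : x ≠ 0) :
    num c x ≠ s := by
  intro hn
  have n2 : 2 * x ≠ 0 := by simpa using nz hp 2 (by norm_num) (by norm_num) hx
  have n3 : 3 * x ≠ 0 := by simpa using nz hp 3 (by norm_num) (by norm_num) hx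
  have n4 : 4 * x ≠ 0 := by simpa using nz hp 4 (by norm_num) (by norm_num) hx
  obtain ⟨h1, h2, h3⟩ := case_s g hp s hw hs hall x hx hn
  have h2x : num c (2 * x) ≠ s := by
    intro h
    obtain ⟨k1, k2, _⟩ := case_s g hp s hw hs hall (2 * x) n2 h
    have a1 := k2 x hx (by intro h; apply hx; linear_combination -h)
      (by intro h; apply n3; linear_combination h) (by intro h; apply n3; linear_combination -h)
    have a2 := hall (2 * (2 * x)) (by intro h; apply n4; linear_combination h)
    omega
  have h2x' := hall _ n2
  set v := num c (-x) with hv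
  apply arith2 p s v hp hs (by omega) h3
  have hbound : ∀ y : ZMod p, (v : ℤ) - (if y = 0 then (v : ℤ) else 0) - (if y = x then (v : ℤ) - s else 0)
      - (if y = 2 * x then 1 else 0) ≤ num c y := by
    intro y
    have hxx2 : x ≠ 2 * x := by intro h; apply hx; linear_combination -h
    by_cases hy0 : y = 0
    · rw [if_pos hy0, if_neg (by rw [hy0]; exact hx.symm), if_neg (by rw [hy0]; exact n2.symm)]
      simp
    · by_cases hyx : y = x
      · rw [if_neg hy0, if_pos hyx, if_neg (by rw [hyx]; exact hxx2), hyx, hn]; simp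
      · by_cases hy2 : y = 2 * x
        · rw [if_neg hy0, if_neg hyx, if_pos hy2, hy2, h1]; push_cast; linarith
        · rw [if_neg hy0, if_neg hyx, if_neg hy2]
          by_cases hyn : y = -x
          · rw [hyn, ← hv]; simp
          · have := h2 y hy0 hyx hyn hy2
            zify at this
            linarith
  have hsum := sum_le_sum (fun y (_ : y ∈ (univ : Finset (ZMod p))) => hbound y)
  simp only [sum_sub_distrib, sum_const, sum_ite_eq', mem_univ, if_true, card_univ, ZMod.card,
    nsmul_eq_mul] at hsum
  zify at hw
  linarith

lemma partII_s (g : Geo p R c) (hp : 7 ≤ p) (s : ℕ) (hw : ∑ x, num c x + s = 2 * p ^ 2 + 3)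
    (hs : 2 * p ≤ s + 1) (hall : ∀ x, x ≠ 0 → s ≤ num c x) :
    s + 1 = 2 * p ∧ (∀ x, x ≠ 0 → 2 * p ≤ num c x) ∧ ∑ x, (num c x - 2 * p) = 4 := by
  have h1 : ∀ x, x ≠ 0 → s + 1 ≤ num c x := by
    intro x hx
    have := hall x hx
    have := no_s g hp s hw hs hall x hx
    omega
  have h0 : num c 0 = 0 := by simp [num]
  have hsp : ∀ f : ZMod p → ℕ, f 0 = 0 → ∑ x, f x = ∑ x ∈ univ.erase 0, f x := by
    intro f hf
    rw [← add_sum_erase univ f (mem_univ 0), hf, zero_add]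
  have hcard : ((univ : Finset (ZMod p)).erase 0).card = p - 1 := by
    rw [card_erase_of_mem (mem_univ _), card_univ, ZMod.card]
  have h2 : (p - 1) * (s + 1) ≤ ∑ x, num c x := by
    rw [hsp _ h0, ← hcard, ← smul_eq_mul]
    apply card_nsmul_le_sum
    intro x hx
    exact h1 x (mem_erase.1 hx).1
  have hse : s + 1 = 2 * p := by
    by_contra hne
    have : 2 * p ≤ s := by omega
    obtain ⟨q, rfl⟩ : ∃ q, p = q + 1 := ⟨p - 1, by omega⟩
    simp only [Nat.add_sub_cancel] at h2
    nlinarith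
  rw [hse] at h1
  refine ⟨hse, h1, ?_⟩
  have h3 : ∑ x, (num c x - 2 * p) + (p - 1) * (2 * p) = ∑ x, num c x := by
    have e : (p - 1) * (2 * p) = ∑ x ∈ univ.erase (0 : ZMod p), 2 * p := by
      rw [sum_const, hcard, smul_eq_mul]
    rw [hsp _ h0, hsp (fun x => num c x - 2 * p) (by simp [h0]), e, ← sum_add_distrib]
    apply sum_congr rfl
    intro x hx
    have := h1 x (mem_erase.1 hx).1
    omega
  obtain ⟨q, rfl⟩ : ∃ q, p = q + 1 := ⟨p - 1, by omega⟩
  simp only [Nat.add_sub_cancel] at h3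
  nlinarith

end
end SC

namespace SC
open Finset
open scoped Classical

noncomputable section
variable {p : ℕ} [Fact p.Prime] {Pt Ln : Type} [Fintype Pt] [Fintype Ln]
variable {R : Pt → Ln → Prop} {c : Pt → ZMod p}

/-- excess of a colour class -/
def ep (c : Pt → ZMod p) (x : ZMod p) : ℕ := num c x - 2 * p

/-- the extremal situation -/
structure Ext (p : ℕ) [Fact p.Prime] {Pt Ln : Type} [Fintype Pt] [Fintype Ln]
    (R : Pt → Ln → Prop) (c : Pt → ZMod p) : Prop where
  g : Geo p R c
  hp : 7 ≤ p
  hw : ∑ x, num c x + (2 * p - 1) = 2 * p ^ 2 + 3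
  hn : ∀ x, x ≠ 0 → num c x = 2 * p + ep c x
  hsum : ∑ x, ep c x = 4

lemma Ext.pt (e : Ext p R c) {y : ZMod p} (hy : y ≠ 0) : ∃ P, c P = y :=
  exists_pt (by have := e.hn y hy; have := e.hp; omega)

lemma Ext.q1 (e : Ext p R c) {x : ZMod p} (hx : x ≠ 0) (hex : ep c x = 0) (P : Pt) (hP : c P = -x) :
    ∃ l ∈ thr R P, (T R c l).card = 4 ∧ x ∉ T R c l ∧
      (∀ l' ∈ thr R P, l' ≠ l → (T R c l').card ≤ 3) ∧
      (∀ y, y ≠ 0 → y ≠ x → num c y + (T R c l).count (x - y) = num c (x - y) + (T R c l).count y) ∧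
      (∀ y, y + y = x → ∃ r, num c y = 2 * r + (T R c l).count y) := by
  have hp := e.hp
  have hc : c P ≠ 0 := by rw [hP]; exact neg_ne_zero.2 hx
  have n2 : 2 * x ≠ 0 := by simpa using nz hp 2 (by norm_num) (by norm_num) hx
  obtain ⟨h1, h2, h3, h4⟩ := local_main e.g (by omega) (2 * p - 1) e.hw P x hx hP
  have hnx := e.hn x hx
  have hE : Ee (thr R P) (Mm R c (-x)) = 1 := by
    by_contra hne
    have h0 : Ee (thr R P) (Mm R c (-x)) = 0 := by omega
    have := Gg_zero_of h0 x
    omega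
  obtain ⟨l, hl, hl3, hl', hG⟩ := Ee_one hE
  have hcard : ∀ l ∈ thr R P, (T R c l).card = (Mm R c (-x) l).card + 1 := by
    intro l hl; have := Mm_card P hc l hl; rwa [hP] at this
  have hcount : ∀ y, (T R c l).count y = (Mm R c (-x) l).count y + if y = -x then 1 else 0 := by
    intro y; have := Mm_count P hc l hl y; rwa [hP] at this
  have hN : ∀ y, num c y = Aa (thr R P) (Mm R c (-x)) y + (T R c l).count y := by
    intro y; rw [h2 y, hG, hcount]; omega
  refine ⟨l, hl, by rw [hcard l hl, hl3], ?_, ?_, ?_, ?_⟩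
  · rw [← Multiset.count_eq_zero, hcount, if_neg (by intro h; apply n2; linear_combination h), ← hG]
    omega
  · intro l' h5 h6
    have := hl' l' h5 h6
    rw [hcard l' h5]; omega
  · intro y hy hyx
    have := h3 y hy hyx
    rw [hN y, hN (x - y)]; omega
  · intro y hyy
    obtain ⟨r, hr⟩ := h4 y hyy
    exact ⟨r, by rw [hN y, hr]⟩

/-- four colours containing a zero-sum triple -/
lemma zero_triple {N : Multiset (ZMod p)} (hc : N.card = 4) (hs : N.sum = 0) (h0 : (0 : ZMod p) ∉ N)
    (a b d : ZMod p) (habd : a + b + d = 0) (hle : ({a, b, d} : Multiset (ZMod p)) ≤ N) : False := by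
  obtain ⟨U, rfl⟩ := Multiset.le_iff_exists_add.1 hle
  have hU : U.card = 1 := by
    rw [Multiset.card_add] at hc; simp at hc; omega
  obtain ⟨z, rfl⟩ := Multiset.card_eq_one.1 hU
  have : z = 0 := by
    simp at hs
    linear_combination hs - habd
  subst this
  simp at h0

lemma count_triple (y a b d : ZMod p) : ({a, b, d} : Multiset (ZMod p)).count y
    = (if y = a then 1 else 0) + (if y = b then 1 else 0) + (if y = d then 1 else 0) := by
  rw [Multiset.insert_eq_cons, Multiset.count_cons, count_pair]; ring

lemma triple_le {N : Multiset (ZMod p)} {a b d : ZMod p}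
    (h : ∀ y, y = a ∨ y = b ∨ y = d → (if y = a then 1 else 0) + (if y = b then 1 else 0)
      + (if y = d then 1 else 0) ≤ N.count y) : ({a, b, d} : Multiset (ZMod p)) ≤ N := by
  rw [Multiset.le_iff_count]
  intro y
  rw [count_triple]
  by_cases hy : y = a ∨ y = b ∨ y = d
  · exact h y hy
  · push Not at hy
    rw [if_neg hy.1, if_neg hy.2.1, if_neg hy.2.2]; omega

/-- type of long lines meeting colour `-x` -/
lemma Ext.ttype (e : Ext p R c) {x : ZMod p} (hx : x ≠ 0) (h1 : ep c x = 0) (h2 : ep c (-x) = 0)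
    (l : Ln) (hl : 4 ≤ (T R c l).card) (hm : -x ∈ T R c l) :
    (T R c l).card = 4 ∧ (T R c l).count (-x) = 1 ∧ (T R c l).count (2 * x) = 1 + ep c (2 * x) := by
  have hp := e.hp
  have n2 : 2 * x ≠ 0 := by simpa using nz hp 2 (by norm_num) (by norm_num) hx
  have n3 : 3 * x ≠ 0 := by simpa using nz hp 3 (by norm_num) (by norm_num) hx
  obtain ⟨hx', P, hPl, hP⟩ := T_mem.1 hm
  obtain ⟨l', hl', k1, k2, k3, k4, k5⟩ := e.q1 hx h1 P hP
  have : l = l' := by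
    by_contra hne
    have := k3 l (by simpa [thr] using hPl) hne
    omega
  subst this
  have a := k4 (-x) hx' (by intro h; apply n2; linear_combination -h)
  have e1 : x - -x = 2 * x := by ring
  rw [e1, e.hn _ hx', e.hn _ n2, h2] at a
  have hpos : 1 ≤ (T R c l).count (-x) := Multiset.one_le_count_iff_mem.2 hm
  have hone : (T R c l).count (-x) = 1 := by
    by_contra hne
    apply zero_triple k1 (T_sum e.g l) (T_zero l) (-x) (-x) (2 * x) (by ring)
    apply triple_le
    have hd : -x ≠ 2 * x := by intro h; apply n3; linear_combination -h
    rintro y (rfl | rfl | rfl)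
    · rw [if_pos rfl, if_neg hd]; omega
    · rw [if_pos rfl, if_neg hd]; omega
    · rw [if_neg hd.symm, if_pos rfl]; omega
  exact ⟨k1, hone, by omega⟩

/-- a second long line -/
lemma Ext.second (e : Ext p R c) {x : ZMod p} (hx : x ≠ 0) (h1 : ep c x = 0) (h2 : ep c (-x) = 0) :
    ∃ Q, c Q = 2 * x ∧ ∃ l ∈ thr R Q, ∃ l' ∈ thr R Q, l ≠ l' ∧
      4 ≤ (T R c l).card ∧ 4 ≤ (T R c l').card ∧ -x ∈ T R c l ∧ -x ∈ T R c l' := by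
  have hp := e.hp
  have n2 : 2 * x ≠ 0 := by simpa using nz hp 2 (by norm_num) (by norm_num) hx
  have n3 : 3 * x ≠ 0 := by simpa using nz hp 3 (by norm_num) (by norm_num) hx
  have hx' : -x ≠ 0 := neg_ne_zero.2 hx
  obtain ⟨P, hP⟩ := e.pt hx'
  obtain ⟨l, hl, k1, -, -, -, -⟩ := e.q1 hx h1 P hP
  have hm : -x ∈ T R c l := by
    have := thr_mem (c := c) P (by rw [hP]; exact hx') l hl
    rwa [hP] at this
  obtain ⟨t1, t2, t3⟩ := e.ttype hx h1 h2 l (by omega) hm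
  have hm2 : 2 * x ∈ T R c l := by
    rw [← Multiset.one_le_count_iff_mem]; omega
  obtain ⟨_, Q, hQl, hQ⟩ := T_mem.1 hm2
  have hlQ : l ∈ thr R Q := by simpa [thr] using hQl
  have hQ0 : c Q ≠ 0 := by rw [hQ]; exact n2
  refine ⟨Q, hQ, l, hlQ, ?_⟩
  by_contra hcon
  push Not at hcon
  have hd : -x ≠ c Q := by rw [hQ]; intro h; apply n3; linear_combination -h
  have f := flag_count e.g Q hQ0 (-x)
  rw [if_neg hd, add_zero, e.hn _ hx', h2] at f
  rw [← add_sum_erase _ _ hlQ] at f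
  have c1 := Mm_count Q hQ0 l hlQ (-x)
  rw [if_neg hd, t2] at c1
  have hev : 2 ∣ ∑ l' ∈ (thr R Q).erase l, (Mm R c (c Q) l').count (-x) := by
    apply dvd_sum
    intro l' hl'
    obtain ⟨hne, hl'⟩ := mem_erase.1 hl'
    by_cases hm' : -x ∈ Mm R c (c Q) l'
    · have hmT := Multiset.mem_of_mem_erase hm'
      have hcc := Mm_card Q hQ0 l' hl'
      have hshort : ¬ 4 ≤ (T R c l').card := by
        intro h4
        exact hcon l' hl' hne.symm (by omega) h4 hm hmT
      have hsum : (Mm R c (c Q) l').sum = - c Q := M_sum e.g Q hQ0 l' hl'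
      rcases small_cases (neg_ne_zero.2 hQ0) hsum (by omega) with h | ⟨b, d, h, hbd⟩
      · rw [h] at hm'; simp at hm'; rw [hQ] at hm'
        exact absurd (show x = 0 by linear_combination -hm') hx
      · rw [h, count_pair]
        rw [h] at hm'
        simp only [Multiset.insert_eq_cons, Multiset.mem_cons, Multiset.mem_singleton] at hm'
        rw [hQ] at hbd
        have : -x = b ∧ -x = d := by
          rcases hm' with hm' | hm'
          · exact ⟨hm', by linear_combination -hbd - hm'⟩
          · exact ⟨by linear_combination -hbd - hm', hm'⟩
        rw [if_pos this.1, if_pos this.2]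
    · rw [Multiset.count_eq_zero_of_notMem hm']; simp
  omega

lemma Ext.q2a (e : Ext p R c) {x : ZMod p} (hx : x ≠ 0) (h1 : ep c x = 0) (h2 : ep c (-x) = 0) :
    1 ≤ ep c (-(2 * x)) := by
  have hp := e.hp
  have n2 : 2 * x ≠ 0 := by simpa using nz hp 2 (by norm_num) (by norm_num) hx
  have n2' : -(2 * x) ≠ 0 := neg_ne_zero.2 n2
  obtain ⟨Q, hQ, l, hl, l', hl', hne, c4, c4', m, m'⟩ := e.second hx h1 h2
  have hQ0 : c Q ≠ 0 := by rw [hQ]; exact n2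
  have hQ' : c Q = -(-(2 * x)) := by rw [hQ]; ring
  obtain ⟨k1, -, -, -⟩ := local_main e.g (by omega) (2 * p - 1) e.hw Q _ n2' hQ'
  have a1 := Mm_card Q hQ0 l hl
  have a2 := Mm_card Q hQ0 l' hl'
  rw [hQ'] at a1 a2
  have := Ee_ge_two (M := Mm R c (-(-(2 * x)))) l l' hl hl' hne (by omega) (by omega)
  have := e.hn _ n2'
  omega

lemma Ext.q2b (e : Ext p R c) {x : ZMod p} (hx : x ≠ 0) (h1 : ep c x = 0) (h2 : ep c (-x) = 0)
    (h3 : 1 ≤ ep c (2 * x)) (l : Ln) (hl : 4 ≤ (T R c l).card) (hm : -x ∈ T R c l) :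
    ep c (2 * x) = 1 ∧ T R c l = {-x, 2 * x, 2 * x, -(3 * x)} := by
  have hp := e.hp
  have n3 : 3 * x ≠ 0 := by simpa using nz hp 3 (by norm_num) (by norm_num) hx
  have n5 : 5 * x ≠ 0 := by simpa using nz hp 5 (by norm_num) (by norm_num) hx
  obtain ⟨t1, t2, t3⟩ := e.ttype hx h1 h2 l hl hm
  have hle : ({-x, 2 * x, 2 * x} : Multiset (ZMod p)) ≤ T R c l := by
    apply triple_le
    have hd : -x ≠ 2 * x := by intro h; apply n3; linear_combination -h
    rintro y (rfl | rfl | rfl)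
    · rw [if_pos rfl, if_neg hd]; omega
    · rw [if_neg hd.symm, if_pos rfl]; omega
    · rw [if_neg hd.symm, if_pos rfl]; omega
  obtain ⟨U, hU⟩ := Multiset.le_iff_exists_add.1 hle
  have hUc : U.card = 1 := by
    rw [hU, Multiset.card_add] at t1; simp at t1; omega
  obtain ⟨z, rfl⟩ := Multiset.card_eq_one.1 hUc
  have hz : z = -(3 * x) := by
    have hs := T_sum e.g l
    rw [hU] at hs
    simp at hs
    linear_combination hs
  subst hz
  refine ⟨?_, by rw [hU]; rfl⟩
  have hd : 2 * x ≠ -x := by intro h; apply n3; linear_combination h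
  rw [hU, Multiset.count_add, count_triple, Multiset.count_singleton, if_neg hd, if_pos rfl,
    if_neg (by intro h; apply n5; linear_combination h)] at t3
  omega

lemma Ext.q2c (e : Ext p R c) {x : ZMod p} (hx : x ≠ 0) (h1 : ep c x = 0) (h2 : ep c (-x) = 0)
    (h3 : 1 ≤ ep c (2 * x)) (h4 : ep c (-(2 * x)) = 1) : ep c (-(3 * x)) = 2 := by
  have hp := e.hp
  have n2 : 2 * x ≠ 0 := by simpa using nz hp 2 (by norm_num) (by norm_num) hx
  have n3 : 3 * x ≠ 0 := by simpa using nz hp 3 (by norm_num) (by norm_num) hx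
  have n4 : 4 * x ≠ 0 := by simpa using nz hp 4 (by norm_num) (by norm_num) hx
  have n5 : 5 * x ≠ 0 := by simpa using nz hp 5 (by norm_num) (by norm_num) hx
  have n2' : -(2 * x) ≠ 0 := neg_ne_zero.2 n2
  have n3' : -(3 * x) ≠ 0 := neg_ne_zero.2 n3
  obtain ⟨Q, hQ, l, hl, l', hl', hne, c4, c4', m, m'⟩ := e.second hx h1 h2
  have hQ0 : c Q ≠ 0 := by rw [hQ]; exact n2
  have hQ' : c Q = -(-(2 * x)) := by rw [hQ]; ring
  obtain ⟨k1, k2, k3, -⟩ := local_main e.g (by omega) (2 * p - 1) e.hw Q _ n2' hQ'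
  have a1 := Mm_card Q hQ0 l hl
  have a2 := Mm_card Q hQ0 l' hl'
  rw [hQ'] at a1 a2
  have hn2 := e.hn _ n2'
  have hG := Ee_two (M := Mm R c (-(-(2 * x)))) (by omega) l l' hl hl' hne (by omega) (by omega)
  have t1 := (e.q2b hx h1 h2 h3 l c4 m).2
  have t2 := (e.q2b hx h1 h2 h3 l' c4' m').2
  have cnt : ∀ l ∈ thr R Q, T R c l = {-x, 2 * x, 2 * x, -(3 * x)} →
      (Mm R c (-(-(2 * x))) l).count (-(3 * x)) = 1 ∧ (Mm R c (-(-(2 * x))) l).count x = 0 := by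
    intro l hl ht
    have b1 := Mm_count Q hQ0 l hl (-(3 * x))
    have b2 := Mm_count Q hQ0 l hl x
    rw [ht, hQ', Multiset.insert_eq_cons, Multiset.count_cons, count_triple] at b1 b2
    have f1 : -(3 * x) ≠ 2 * x := by intro h; apply n5; linear_combination -h
    have f2 : -(3 * x) ≠ -x := by intro h; apply n2; linear_combination -h
    have f3 : x ≠ 2 * x := by intro h; apply hx; linear_combination -h
    have f4 : x ≠ -(3 * x) := by intro h; apply n4; linear_combination h
    have f5 : x ≠ -x := by intro h; apply n2; linear_combination h
    rw [neg_neg, if_neg f1, if_neg f2, if_pos rfl] at b1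
    rw [neg_neg, if_neg f3, if_neg f4, if_neg f5] at b2
    rw [neg_neg]
    omega
  have u1 := cnt l hl t1
  have u2 := cnt l' hl' t2
  have v1 := k2 (-(3 * x))
  have v2 := k2 x
  have v3 := k3 (-(3 * x)) n3' (by intro h; apply hx; linear_combination -h)
  rw [hG, if_neg (by intro h; apply n5; linear_combination -h), e.hn _ n3'] at v1
  rw [hG, if_neg (by intro h; apply hx; linear_combination -h), e.hn _ hx] at v2
  have e1 : -(2 * x) - -(3 * x) = x := by ring
  rw [e1] at v3
  omega

lemma Ext.q2 (e : Ext p R c) {x : ZMod p} (hx : x ≠ 0) : 1 ≤ ep c x + ep c (-x) := by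
  by_contra hcon
  have hp := e.hp
  have h1 : ep c x = 0 := by omega
  have h2 : ep c (-x) = 0 := by omega
  have hx' : -x ≠ 0 := neg_ne_zero.2 hx
  have n5 : 5 * x ≠ 0 := by simpa using nz hp 5 (by norm_num) (by norm_num) hx
  have n6 : 6 * x ≠ 0 := by simpa using nz hp 6 (by norm_num) (by norm_num) hx
  have a1 := e.q2a hx h1 h2
  have a2 := e.q2a hx' h2 (by rwa [neg_neg])
  have e1 : 2 * -x = -(2 * x) := by ring
  have e2 : 3 * -x = -(3 * x) := by ring
  rw [e1, neg_neg] at a2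
  have gen : ∀ x : ZMod p, x ≠ 0 → ep c x = 0 → ep c (-x) = 0 → 1 ≤ ep c (2 * x) →
      ep c (2 * x) = 1 := by
    intro x hx h1 h2 h3
    obtain ⟨Q, hQ, l, hl, l', hl', hne, c4, c4', m, m'⟩ := e.second hx h1 h2
    exact (e.q2b hx h1 h2 h3 l c4 m).1
  have b1 := gen x hx h1 h2 a2
  have b2 := gen (-x) hx' h2 (by rwa [neg_neg]) (by rwa [e1])
  rw [e1] at b2
  have d1 := e.q2c hx h1 h2 a2 b2
  have d2 := e.q2c hx' h2 (by rwa [neg_neg]) (by rwa [e1]) (by rwa [e1, neg_neg])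
  rw [e2, neg_neg] at d2
  have hs : ∑ y ∈ ({2 * x, 3 * x, -(3 * x)} : Finset (ZMod p)), ep c y ≤ ∑ y, ep c y :=
    sum_le_sum_of_subset (subset_univ _)
  rw [e.hsum, sum_insert, sum_pair] at hs
  · omega
  · intro h; apply n6; linear_combination h
  · rw [mem_insert, mem_singleton]
    rintro (h | h)
    · apply hx; linear_combination -h
    · apply n5; linear_combination h

end
end SC

namespace SC
open Finset
open scoped Classical

noncomputable section
variable {p : ℕ} [Fact p.Prime] {Pt Ln : Type} [Fintype Pt] [Fintype Ln]
variable {R : Pt → Ln → Prop} {c : Pt → ZMod p}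

lemma ep_zero : ep c 0 = 0 := by simp [ep, num]

lemma Ext.q3 (e : Ext p R c) : p = 7 := by
  have hp := e.hp
  have h1 : ∑ x, ep c (-x) = 4 := by
    rw [← e.hsum]; exact Equiv.sum_comp (Equiv.neg (ZMod p)) (ep c)
  have h2 : ∑ x : ZMod p, (ep c x + ep c (-x)) = 8 := by
    rw [sum_add_distrib, h1, e.hsum]
  have h3 : ∑ x ∈ (univ.erase (0 : ZMod p)), 1 ≤ ∑ x ∈ (univ.erase (0 : ZMod p)), (ep c x + ep c (-x)) :=
    sum_le_sum (fun x hx => e.q2 (mem_erase.1 hx).1)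
  have h4 : ∑ x ∈ (univ.erase (0 : ZMod p)), (ep c x + ep c (-x)) ≤ 8 := by
    rw [← h2]; exact sum_le_sum_of_subset (subset_univ _)
  rw [sum_const, card_erase_of_mem (mem_univ _), card_univ, ZMod.card] at h3
  have hpr : p.Prime := Fact.out
  have : p ≤ 9 := by simp at h3; omega
  interval_cases p
  · rfl
  · exact absurd hpr (by norm_num)
  · exact absurd hpr (by norm_num)

lemma Ext.q4 (e : Ext p R c) {x : ZMod p} (hx : x ≠ 0) (hex : ep c x = 0) (P : Pt) (hP : c P = -x) :
    ∃ l ∈ thr R P, (∀ l' ∈ thr R P, l' ≠ l → (T R c l').card ≤ 3) ∧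
      (T R c l).card = 4 ∧ ∀ y, (T R c l).count y = ep c y := by
  have hp := e.hp
  have n2 : 2 * x ≠ 0 := by simpa using nz hp 2 (by norm_num) (by norm_num) hx
  have n3 : 3 * x ≠ 0 := by simpa using nz hp 3 (by norm_num) (by norm_num) hx
  have hx' : -x ≠ 0 := neg_ne_zero.2 hx
  obtain ⟨l, hl, k1, k2, k3, k4, k5⟩ := e.q1 hx hex P hP
  refine ⟨l, hl, k3, k1, ?_⟩
  have q2 := e.q2 hx
  have hmem : -x ∈ T R c l := by
    rw [← hP]; exact thr_mem P (by rw [hP]; exact hx') l hl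
  have hpos : 1 ≤ (T R c l).count (-x) := Multiset.one_le_count_iff_mem.2 hmem
  have hd : -x ≠ 2 * x := by intro h; apply n3; linear_combination -h
  have two : 2 ≤ (T R c l).count (-x) → 1 ≤ (T R c l).count (2 * x) → False := by
    intro a b
    apply zero_triple k1 (T_sum e.g l) (T_zero l) (-x) (-x) (2 * x) (by ring)
    apply triple_le
    rintro y (rfl | rfl | rfl)
    · rw [if_pos rfl, if_neg hd]; omega
    · rw [if_pos rfl, if_neg hd]; omega
    · rw [if_pos rfl, if_neg hd.symm]; omega
  have hle : ∀ y, (T R c l).count y ≤ ep c y := by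
    intro y
    by_contra hcon
    by_cases hy : y = 0
    · subst hy
      have := Multiset.count_eq_zero.2 (T_zero (R := R) (c := c) l)
      omega
    by_cases hyx : y = x
    · subst hyx
      have := Multiset.count_eq_zero.2 k2
      omega
    have hb := k4 y hy hyx
    have hxy : x - y ≠ 0 := fun h => hyx (by linear_combination -h)
    rw [e.hn _ hy, e.hn _ hxy] at hb
    by_cases h1 : y = x - y
    · obtain ⟨r, hr⟩ := k5 y (by linear_combination h1)
      rw [e.hn _ hy] at hr
      apply zero_triple k1 (T_sum e.g l) (T_zero l) y y (-x) (by linear_combination h1)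
      have hyx' : y ≠ -x := by
        intro h; apply n3; linear_combination -h1 + 2 * h
      apply triple_le
      rintro z (rfl | rfl | rfl)
      · rw [if_pos rfl, if_neg hyx']; omega
      · rw [if_pos rfl, if_neg hyx']; omega
      · rw [if_pos rfl, if_neg hyx'.symm]; omega
    by_cases h2 : y = -x
    · subst h2
      have e1 : x - -x = 2 * x := by ring
      rw [e1] at hb
      exact two (by omega) (by omega)
    by_cases h3 : x - y = -x
    · have : y = 2 * x := by linear_combination -h3
      rw [h3] at hb
      subst this
      exact two (by omega) (by omega)
    apply zero_triple k1 (T_sum e.g l) (T_zero l) y (x - y) (-x) (by ring)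
    apply triple_le
    rintro z (rfl | rfl | rfl)
    · rw [if_pos rfl, if_neg h1, if_neg h2]; omega
    · rw [if_pos rfl, if_neg (Ne.symm h1), if_neg h3]; omega
    · rw [if_pos rfl, if_neg (Ne.symm h2), if_neg (Ne.symm h3)]; omega
  have hs : ∑ y, (T R c l).count y = ∑ y, ep c y := by
    rw [e.hsum, ← k1]
    exact Multiset.sum_count_eq_card (fun a _ => mem_univ a)
  intro y
  exact (sum_eq_sum_iff_of_le (fun y _ => hle y)).1 hs y (mem_univ y)

lemma Ext.exz (e : Ext p R c) : ∃ x, x ≠ 0 ∧ ep c x = 0 := by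
  by_contra hcon
  push Not at hcon
  have hp := e.hp
  have h3 : ∑ x ∈ (univ.erase (0 : ZMod p)), 1 ≤ ∑ x ∈ (univ.erase (0 : ZMod p)), ep c x :=
    sum_le_sum (fun x hx => Nat.one_le_iff_ne_zero.2 (hcon x (mem_erase.1 hx).1))
  have h4 : ∑ x ∈ (univ.erase (0 : ZMod p)), ep c x ≤ 4 := by
    rw [← e.hsum]; exact sum_le_sum_of_subset (subset_univ _)
  rw [sum_const, card_erase_of_mem (mem_univ _), card_univ, ZMod.card] at h3
  simp at h3
  omega

lemma Ext.wsum (e : Ext p R c) : ∑ y, (ep c y : ZMod p) * y = 0 := by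
  obtain ⟨x, hx, hex⟩ := e.exz
  obtain ⟨P, hP⟩ := e.pt (neg_ne_zero.2 hx)
  obtain ⟨l, hl, -, -, h⟩ := e.q4 hx hex P hP
  have hs := T_sum e.g l
  rw [Finset.sum_multiset_count_of_subset _ univ (subset_univ _)] at hs
  rw [← hs]
  apply sum_congr rfl
  intro y _
  rw [h y, nsmul_eq_mul]

lemma Ext.q5 (e : Ext p R c) {u : ZMod p} (hu : u ≠ 0) (h : ep c (-u) = 0) :
    num c u = ep c u * (univ.filter (fun l : Ln => (T R c l).card = 4 ∧
      ∀ y, (T R c l).count y = ep c y)).card := by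
  set L := univ.filter (fun l : Ln => (T R c l).card = 4 ∧
      ∀ y, (T R c l).count y = ep c y) with hL
  have h1 : ∑ l ∈ L, (T R c l).count u = L.card * ep c u := by
    rw [sum_congr rfl (g := fun _ => ep c u), sum_const, smul_eq_mul]
    intro l hl
    exact (mem_filter.1 hl).2.2 u
  have h2 : ∑ l ∈ L, (T R c l).count u
      = ∑ l ∈ L, ∑ Q ∈ univ.filter (fun Q => c Q = u), if R Q l then 1 else 0 := by
    apply sum_congr rfl
    intro l _
    rw [T_count l u hu, ← filter_filter, card_filter]
  have h3 : ∑ Q ∈ univ.filter (fun Q => c Q = u), ∑ l ∈ L, (if R Q l then 1 else 0)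
      = ∑ Q ∈ univ.filter (fun Q => c Q = u), 1 := by
    apply sum_congr rfl
    intro Q hQ
    have hQ' : c Q = -(-u) := by rw [neg_neg]; exact (mem_filter.1 hQ).2
    obtain ⟨l, hl, k1, k2, k3⟩ := e.q4 (neg_ne_zero.2 hu) h Q hQ'
    rw [sum_eq_single l]
    · rw [if_pos (by simpa [thr] using hl)]
    · intro l' hl' hne
      rw [if_neg]
      intro hR
      have := k1 l' (by simpa [thr] using hR) hne
      have := (mem_filter.1 hl').2.1
      omega
    · intro hn
      exact absurd (mem_filter.2 ⟨mem_univ _, k2, k3⟩) hn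
  rw [mul_comm, ← h1, h2, sum_comm, h3, sum_const, smul_eq_mul, mul_one, num, if_neg hu]

lemma Ext.q6 (e : Ext p R c) {u v : ZMod p} (hu : u ≠ 0) (hv : v ≠ 0)
    (h : ep c (-u) = 0) (h' : ep c (-v) = 0) : ep c u = ep c v := by
  have a := e.q5 hu h
  have b := e.q5 hv h'
  rw [e.hn _ hu] at a
  rw [e.hn _ hv] at b
  have hp := e.hp
  generalize (univ.filter (fun l : Ln => (T R c l).card = 4 ∧
      ∀ y, (T R c l).count y = ep c y)).card = K at a b
  have h3 : (2 * p) * ep c u = (2 * p) * ep c v := by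
    have : (2 * p + ep c u) * (ep c v * K) = (ep c u * K) * (2 * p + ep c v) := by rw [← a, ← b]
    have hK : K ≠ 0 := by rintro rfl; omega
    have h5 : (2 * p + ep c u) * ep c v = ep c u * (2 * p + ep c v) := by
      apply Nat.eq_of_mul_eq_mul_right (Nat.pos_of_ne_zero hK)
      linarith
    linarith
  exact Nat.eq_of_mul_eq_mul_left (by omega) h3

lemma fin7 (f : ZMod 7 → ℕ) (h0 : f 0 = 0) (hs : ∑ x, f x = 4)
    (h2 : ∀ x, x ≠ 0 → 1 ≤ f x + f (-x)) (hw : ∑ y, (f y : ZMod 7) * y = 0)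
    (he' : ∀ u v, u ≠ 0 → v ≠ 0 → f (-u) = 0 → f (-v) = 0 → f u = f v) : False := by
  have he : ∀ u v, u ≠ 0 → v ≠ 0 → (f (-u) ≠ 0 ∨ f (-v) ≠ 0 ∨ f u = f v) := by
    intro u v hu hv; have := he' u v hu hv; tauto
  clear he'
  have s1 : f 0 + f 1 + f 2 + f 3 + f 4 + f 5 + f 6 = 4 := by
    exact (Fin.sum_univ_seven f).symm.trans hs
  have s2 : (f 0 : ZMod 7) * 0 + f 1 * 1 + f 2 * 2 + f 3 * 3 + f 4 * 4 + f 5 * 5 + f 6 * 6 = 0 := by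
    exact (Fin.sum_univ_seven (M := ZMod 7) (fun y : ZMod 7 => (f y : ZMod 7) * y)).symm.trans hw
  have s3 : 7 ∣ f 1 + f 2 * 2 + f 3 * 3 + f 4 * 4 + f 5 * 5 + f 6 * 6 := by
    rw [← ZMod.natCast_eq_zero_iff]
    push_cast
    linear_combination s2
  have m1 : -(1 : ZMod 7) = 6 := by decide
  have m2 : -(2 : ZMod 7) = 5 := by decide
  have m3 : -(3 : ZMod 7) = 4 := by decide
  have m4 : -(4 : ZMod 7) = 3 := by decide
  have m5 : -(5 : ZMod 7) = 2 := by decide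
  have m6 : -(6 : ZMod 7) = 1 := by decide
  have z1 : (1 : ZMod 7) ≠ 0 := by decide
  have z2 : (2 : ZMod 7) ≠ 0 := by decide
  have z3 : (3 : ZMod 7) ≠ 0 := by decide
  have z4 : (4 : ZMod 7) ≠ 0 := by decide
  have z5 : (5 : ZMod 7) ≠ 0 := by decide
  have z6 : (6 : ZMod 7) ≠ 0 := by decide
  have a1 := h2 1 z1
  have a2 := h2 2 z2
  have a3 := h2 3 z3
  have e12 := he 1 2 z1 z2
  have e13 := he 1 3 z1 z3
  have e14 := he 1 4 z1 z4
  have e15 := he 1 5 z1 z5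
  have e23 := he 2 3 z2 z3
  have e24 := he 2 4 z2 z4
  have e26 := he 2 6 z2 z6
  have e35 := he 3 5 z3 z5
  have e36 := he 3 6 z3 z6
  have e45 := he 4 5 z4 z5
  have e46 := he 4 6 z4 z6
  have e56 := he 5 6 z5 z6
  clear he h2 hw hs s2
  simp only [m1, m2, m3, m4, m5, m6] at *
  generalize f 1 = b1 at *
  generalize f 2 = b2 at *
  generalize f 3 = b3 at *
  generalize f 4 = b4 at *
  generalize f 5 = b5 at *
  generalize f 6 = b6 at *
  rw [h0] at s1
  clear m1 m2 m3 m4 m5 m6 z1 z2 z3 z4 z5 z6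
  have l1 : b1 ≤ 2 := by omega
  have l6 : b6 ≤ 2 := by omega
  have l2 : b2 ≤ 2 := by omega
  have l5 : b5 ≤ 2 := by omega
  interval_cases b1 <;> interval_cases b6 <;> (try omega) <;> interval_cases b2 <;> (try omega) <;>
    interval_cases b5 <;> omega

lemma Ext.false (e : Ext p R c) : False := by
  have h7 := e.q3
  subst h7
  exact fin7 (ep c) ep_zero e.hsum (fun x hx => e.q2 hx) e.wsum
    (fun u v hu hv h h' => e.q6 hu hv h h')

lemma num_sum : ∑ x, num c x = (univ.filter (fun Q => c Q ≠ 0)).card := by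
  rw [card_eq_sum_card_fiberwise (f := c) (t := univ) (fun _ _ => mem_univ _)]
  apply sum_congr rfl
  intro x _
  rw [num]
  split_ifs with hx
  · symm
    rw [card_eq_zero, filter_eq_empty_iff]
    intro Q hQ; rw [mem_filter] at hQ; rw [hx]; exact hQ.2
  · congr 1
    ext Q
    simp only [mem_filter, mem_univ, true_and]
    constructor
    · intro h; exact ⟨by rw [h]; exact hx, h⟩
    · exact fun h => h.2

theorem Geo.main (g : Geo p R c) (hp : 7 ≤ p)
    (hw : (univ.filter (fun Q => c Q ≠ 0)).card ≤ 2 * p ^ 2 - 2 * p + 4)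
    (hcol : 3 ≤ (univ.filter (fun x => num c x ≠ 0)).card) : False := by
  rw [← num_sum] at hw
  have hpp : 7 * p ≤ p ^ 2 := by rw [pow_two]; exact Nat.mul_le_mul_right _ hp
  obtain ⟨s, hs⟩ : ∃ s, ∑ x, num c x + s = 2 * p ^ 2 + 3 :=
    ⟨2 * p ^ 2 + 3 - ∑ x, num c x, by omega⟩
  have hs2 : 2 * p ≤ s + 1 := by omega
  have h0 : num c (0 : ZMod p) = 0 := by simp [num]
  have hall := partI (geoLP g) hp h0 s hs hs2 hcol
  obtain ⟨a1, a2, a3⟩ := partII_s g hp s hs hs2 hall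
  have e : Ext p R c :=
    { g := g, hp := hp
      hw := by have : s = 2 * p - 1 := by omega
               rw [← this]; exact hs
      hn := by intro x hx; have := a2 x hx; rw [ep]; omega
      hsum := a3 }
  exact e.false

end
end SC

/-- For `p ≥ 7`, there is no nonzero code word of the dual code of a projective plane
of order `p²` of weight at most `2p² - 2p + 4` using more than two nonzero values. -/
theorem no_small_codeword_many_colours {Pt Ln : Type} [Finite Pt] [Finite Ln]
    (p : ℕ) (hp : p.Prime) (hp7 : 7 ≤ p)
    (R : Pt → Ln → Prop) (hPP : IsProjectivePlaneOrder (p ^ 2) R) :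
    ¬ ∃ c : Pt → ZMod p, IsDualCodeWord p R c ∧ c ≠ 0 ∧
        (Function.support c).ncard ≤ 2 * p ^ 2 - 2 * p + 4 ∧
        2 < (Set.range c \ {0}).ncard := by
  classical
  rintro ⟨c, hc, -, hw, hcol⟩
  haveI : Fact p.Prime := ⟨hp⟩
  haveI := Fintype.ofFinite Pt
  haveI := Fintype.ofFinite Ln
  have g : SC.Geo p R c :=
    { line := hPP.existsUnique_line
      deg := by
        intro P
        rw [← hPP.point_card P, Set.ncard_eq_toFinset_card']
        congr 1
        ext l
        simp
      code := by
        intro l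
        have h := hc l
        rw [finsum_mem_eq_toFinset_sum] at h
        rw [← h]
        apply Finset.sum_congr _ (fun _ _ => rfl)
        ext Q
        simp }
  refine g.main hp7 ?_ ?_
  · rw [Set.ncard_eq_toFinset_card'] at hw
    refine le_trans (le_of_eq ?_) hw
    congr 1
    ext Q
    simp
  · rw [Set.ncard_eq_toFinset_card'] at hcol
    refine le_trans (Nat.succ_le_of_lt hcol) (le_of_eq ?_)
    congr 1
    ext x
    rw [Finset.mem_filter, SC.num_pos_iff]
    simp [and_comm]
end
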